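/- Let d > 1 be a cube-free integer and k = ℚ(∛d, ζ₃). Then rank(C_{k,3}^{(σ)}) = 1 if and only if d can be written in one of the following forms, where p₁ ≡ 1 (mod 3) and q₁, q₂, q₃ ≡ −1 (mod 3) are (pairwise distinct) prime numbers and e, e₁, f₁, f₂, f₃ ∈ {1, 2}: (i) d = p₁^{e₁} with p₁ ≡ 1 (mod 3); (ii) d = 3^{e} p₁^{e₁} with p₁ ≡ 4 or 7 (mod 9); (iii) d = p₁^{e₁} q₁^{f₁} ≡ ±1 (mod 9) with p₁ ≡ 4 or 7 (mod 9) and −q₁ ≡ 4 or 7 (mod 9); (iv) d = 3^{e} q₁^{f₁} with q₁ ≡ −1 (mod 9); (v) d = q₁^{f₁} q₂^{f₂} with q₁ ≡ q₂ ≡ −1 (mod 9); (vi) d = q₁^{f₁} q₂^{f₂} ≢ ±1 (mod 9) with q_i ≢ −1 (mod 9) for some i ∈ {1, 2}; (vii) d = 3^{e} q₁^{f₁} q₂^{f₂} with q_i ≢ −1 (mod 9) for some i ∈ {1, 2}; (viii) d = q₁^{f₁} q₂^{f₂} q₃^{f₃} ≡ ±1 (mod 9) with q₁, q₂ ≡ 2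 or 5 (mod 9) and q₃ ≡ −1 (mod 9); (ix) d = q₁^{f₁} q₂^{f₂} q₃^{f₃} ≡ ±1 (mod 9) with q₁, q₂, q₃ ≡ 2 or 5 (mod 9). -/

import Mathlib

open IntermediateField NumberField
open scoped nonZeroDivisors

set_option synthInstance.maxHeartbeats 1000000
set_option maxHeartbeats 2000000

noncomputable section

instance : Fact (Nat.Prime 3) := ⟨by norm_num⟩

/-- A positive integer is cube-free if no prime cube divides it. -/
def IsCubeFree (d : ℕ) : Prop := ∀ p : ℕ, p.Prime → ¬ (p ^ 3 ∣ d)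

/-- The primitive cube root of unity `ζ₃ = e^{2πi/3}`. -/
def zeta3 : ℂ := Complex.exp (2 * Real.pi * Complex.I / 3)

lemma zeta3_isPrimitiveRoot : IsPrimitiveRoot zeta3 3 := by
  simpa [zeta3] using Complex.isPrimitiveRoot_exp 3 (by norm_num)

lemma isIntegral_zeta3 : IsIntegral ℚ zeta3 :=
  (zeta3_isPrimitiveRoot.isIntegral (by norm_num)).tower_top

/-- The real cube root of `d`, as a complex number. -/
def cbrt (d : ℕ) : ℂ := ((d : ℝ) ^ ((3 : ℝ)⁻¹) : ℝ)

lemma cbrt_pow_three (d : ℕ) : (cbrt d) ^ 3 = (d : ℂ) := by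
  have h : ((d : ℝ) ^ ((3 : ℝ)⁻¹)) ^ (3 : ℕ) = (d : ℝ) := by
    rw [← Real.rpow_natCast ((d : ℝ) ^ ((3 : ℝ)⁻¹)) 3, ← Real.rpow_mul (by positivity)]
    norm_num
  calc (cbrt d) ^ 3 = (((((d : ℝ) ^ ((3 : ℝ)⁻¹)) ^ (3:ℕ) : ℝ)) : ℂ) := by
        push_cast [cbrt]; ring
    _ = ((d : ℝ) : ℂ) := by rw [h]
    _ = (d : ℂ) := by norm_num

lemma isIntegral_cbrt (d : ℕ) : IsIntegral ℚ (cbrt d) := by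
  have h : IsIntegral ℤ (cbrt d) := by
    refine ⟨Polynomial.X ^ 3 - Polynomial.C (d : ℤ), ?_, ?_⟩
    · exact Polynomial.monic_X_pow_sub_C _ (by norm_num)
    · simp [Polynomial.eval₂, cbrt_pow_three d]
  exact h.tower_top

/-- `k = ℚ(∛d, ζ₃)`, the normal closure of the pure cubic field `ℚ(∛d)`,
realized as a subfield of `ℂ`. -/
def Kc (d : ℕ) : IntermediateField ℚ ℂ := ℚ⟮cbrt d, zeta3⟯

instance (d : ℕ) : NumberField (Kc d) where
  to_finiteDimensional := by
    apply IntermediateField.finiteDimensional_adjoin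
    rintro x (rfl | rfl)
    · exact isIntegral_cbrt d
    · exact isIntegral_zeta3

lemma zeta3_mem (d : ℕ) : zeta3 ∈ Kc d :=
  IntermediateField.subset_adjoin _ _ (by simp)

lemma cbrt_mem (d : ℕ) : cbrt d ∈ Kc d :=
  IntermediateField.subset_adjoin _ _ (by simp)

/-- `ζ₃` as an element of `k`. -/
def zetaK (d : ℕ) : Kc d := ⟨zeta3, zeta3_mem d⟩

/-- `∛d` as an element of `k`. -/
def cbrtK (d : ℕ) : Kc d := ⟨cbrt d, cbrt_mem d⟩

/-- `k₀ = ℚ(ζ₃)` realized as a subfield of `k`. -/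
def k0S (d : ℕ) : IntermediateField ℚ (Kc d) := ℚ⟮zetaK d⟯

/-- `L = ℚ(∛d)` realized as a subfield of `k`. -/
def LS (d : ℕ) : IntermediateField ℚ (Kc d) := ℚ⟮cbrtK d⟯

instance (d : ℕ) : NumberField ↥(k0S d) where
instance (d : ℕ) : NumberField ↥(LS d) where

/-- `ζ₃` as an element of `k₀ ⊆ k`. -/
def zetaK0 (d : ℕ) : ↥(k0S d) := ⟨zetaK d, IntermediateField.mem_adjoin_simple_self ℚ (zetaK d)⟩

/-- `∛d` as an element of `L ⊆ k`. -/
def cbrtL (d : ℕ) : ↥(LS d) := ⟨cbrtK d, IntermediateField.mem_adjoin_simple_self ℚ (cbrtK d)⟩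

/-- The set of ideal classes of `k` fixed by the action of `σ` (ambiguous classes):
a class `c` is ambiguous if, whenever a nonzero ideal `I` represents `c`, the ideal
`σ(I)` also represents `c`. -/
def ambiguousSet (d : ℕ) (σ : ↥(Kc d) ≃ₐ[ℚ] ↥(Kc d)) : Set (ClassGroup (𝓞 ↥(Kc d))) :=
  {c | ∀ I : (Ideal (𝓞 ↥(Kc d)))⁰, ClassGroup.mk0 I = c →
    ∀ J : (Ideal (𝓞 ↥(Kc d)))⁰,
      (J : Ideal (𝓞 ↥(Kc d))) = Ideal.map (RingOfIntegers.mapRingHom σ) (I : Ideal (𝓞 ↥(Kc d))) →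
      ClassGroup.mk0 J = c}

/-- `C_{k,3}^{(σ)}`: the 3-group of ambiguous ideal classes of `k/k₀`, i.e. the subgroup of
the 3-Sylow subgroup of the ideal class group of `k` consisting of the classes fixed by `σ`. -/
def ambiguousClassGroup (d : ℕ) (σ : ↥(Kc d) ≃ₐ[ℚ] ↥(Kc d)) :
    Subgroup (ClassGroup (𝓞 ↥(Kc d))) :=
  CommGroup.primaryComponent (ClassGroup (𝓞 ↥(Kc d))) 3 ⊓ Subgroup.closure (ambiguousSet d σ)

section AmbiguousClasses

open Ideal

/-- A submonoid of a finite group is a subgroup. -/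
def Submonoid.toSubgroupOfFinite {G : Type*} [Group G] [Finite G] (M : Submonoid G) :
    Subgroup G where
  __ := M
  inv_mem' {x} hx := by
    have h : x⁻¹ = x ^ (orderOf x - 1) := by
      rw [inv_eq_iff_mul_eq_one, ← pow_succ', Nat.sub_add_cancel (orderOf_pos x),
        pow_orderOf_eq_one]
    rw [h]
    exact M.pow_mem hx _

/-- The order of a submonoid of a product of finite groups is the order of its first projection
times the order of the fibre over `1`. -/
lemma Submonoid.card_eq_card_fst_mul {G H : Type*} [Group G] [Group H] [Finite G] [Finite H]
    (M : Submonoid (G × H)) :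
    Nat.card M = Nat.card {g : G // ∃ h, (g, h) ∈ M} * Nat.card {h : H // (1, h) ∈ M} := by
  set P := M.toSubgroupOfFinite
  set f : P →* G := (MonoidHom.fst G H).comp P.subtype
  have h1 : Nat.card P = Nat.card f.range * Nat.card f.ker := by
    rw [mul_comm, ← Subgroup.index_ker, Subgroup.card_mul_index]
  have h2 : Nat.card f.range = Nat.card {g : G // ∃ h, (g, h) ∈ M} := by
    refine Nat.card_congr (Equiv.subtypeEquivRight fun g ↦ ⟨?_, ?_⟩)
    · rintro ⟨⟨⟨a, b⟩, hx⟩, rfl⟩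
      exact ⟨b, hx⟩
    · rintro ⟨h, hh⟩
      exact ⟨⟨(g, h), hh⟩, rfl⟩
  have h3 : Nat.card f.ker = Nat.card {h : H // (1, h) ∈ M} := by
    refine Nat.card_congr ⟨fun x ↦ ⟨x.1.1.2, ?_⟩, fun h ↦ ⟨⟨(1, h.1), h.2⟩, rfl⟩, ?_, ?_⟩
    · have hx : x.1.1.1 = 1 := x.2
      rw [← hx]
      exact x.1.2
    · rintro ⟨⟨⟨a, b⟩, hx⟩, hx'⟩
      have : a = 1 := hx'
      subst this
      rfl
    · intro h
      rfl
  rw [← h2, ← h3, ← h1]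
  rfl

lemma Submonoid.card_eq_card_snd_mul {G H : Type*} [Group G] [Group H] [Finite G] [Finite H]
    (M : Submonoid (G × H)) :
    Nat.card M = Nat.card {h : H // ∃ g, (g, h) ∈ M} * Nat.card {g : G // (g, 1) ∈ M} := by
  have h := Submonoid.card_eq_card_fst_mul (M.comap (MulEquiv.prodComm (M := H) (N := G)).toMonoidHom)
  have h1 : Nat.card (M.comap (MulEquiv.prodComm (M := H) (N := G)).toMonoidHom) = Nat.card M :=
    Nat.card_congr ((MulEquiv.prodComm (M := H) (N := G)).toEquiv.subtypeEquiv fun _ ↦ Iff.rfl)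
  rw [← h1, h]
  rfl

/-- The homomorphism `x ↦ s x / x`. -/
def MulEquiv.divSelfHom {E : Type*} [CommGroup E] (s : E ≃* E) : E →* E :=
  s.toMonoidHom / MonoidHom.id E

@[simp] lemma MulEquiv.divSelfHom_apply {E : Type*} [CommGroup E] (s : E ≃* E) (x : E) :
    s.divSelfHom x = s x / x := rfl

/-- A Herbrand quotient computation: if modulo a finite subgroup `T` the norm `1 + s + s²`
vanishes and the quotient is of rank two, then `s - 1` has index `3` times the order of its
kernel. -/
lemma index_range_divSelfHom {E : Type*} [CommGroup E] (s : E ≃* E) (T : Subgroup E) [Finite T]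
    (hsT : ∀ x ∈ T, s x ∈ T) (hN : ∀ x, x * s x * s (s x) ∈ T) (hT : ∀ x, x ^ 3 ∈ T → x ∈ T)
    (h9 : (powMonoidHom 3 : E ⧸ T →* E ⧸ T).range.index = 9) :
    s.divSelfHom.range.index = 3 * Nat.card s.divSelfHom.ker := by
  set D := s.divSelfHom with hD
  have hDT : ∀ x, D x ∈ T → x ∈ T := by
    intro x hx
    apply hT
    have h1 : s x = x * D x := by simp [hD]
    have h2 := hN x
    have h3 : x ^ 3 = (x * s x * s (s x)) * ((D x) * (D x) * s (D x))⁻¹ := by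
      rw [h1, map_mul, h1]
      have : x * (x * D x) * (x * D x * s (D x)) = x ^ 3 * (D x * D x * s (D x)) := by
        rw [pow_succ, pow_two]; ac_rfl
      rw [this, mul_inv_cancel_right]
    rw [h3]
    exact T.mul_mem h2 (T.inv_mem (T.mul_mem (T.mul_mem hx hx) (hsT _ hx)))
  have hTD : T ≤ T.comap D := fun x hx ↦ T.div_mem (hsT x hx) hx
  set Db : E ⧸ T →* E ⧸ T := QuotientGroup.map T T D hTD with hDb
  have hDbinj : Function.Injective Db := by
    rw [injective_iff_map_eq_one]
    intro y
    induction y using QuotientGroup.induction_on with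
    | H x =>
      intro hx
      rw [hDb, QuotientGroup.map_mk, QuotientGroup.eq_one_iff] at hx
      exact (QuotientGroup.eq_one_iff x).2 (hDT x hx)
  have hDD : (Db.comp Db).range = (powMonoidHom 3 : E ⧸ T →* E ⧸ T).range := by
    have key : ∀ x : E, Db (Db (x : E ⧸ T)) = (((s x)⁻¹ : E) : E ⧸ T) ^ 3 := by
      intro x
      rw [hDb, QuotientGroup.map_mk, QuotientGroup.map_mk, ← QuotientGroup.mk_pow,
        QuotientGroup.eq]
      have : (D (D x))⁻¹ * (s x)⁻¹ ^ 3 = (x * s x * s (s x))⁻¹ := by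
        simp only [hD, MulEquiv.divSelfHom_apply, div_eq_mul_inv, map_mul, map_inv, mul_inv_rev, inv_inv,
          pow_succ, pow_zero, one_mul]
        have : s x * (s x)⁻¹ = 1 := mul_inv_cancel _
        generalize s (s x) = z at *
        calc _ = (s x * (s x)⁻¹) * (s x * (s x)⁻¹) * (x⁻¹ * (s x)⁻¹ * z⁻¹) := by ac_rfl
          _ = _ := by rw [this]; simp only [one_mul]; ac_rfl
      rw [this]
      exact T.inv_mem (hN x)
    ext y
    constructor
    · rintro ⟨z, rfl⟩
      induction z using QuotientGroup.induction_on with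
      | H x => exact ⟨_, (key x).symm⟩
    · rintro ⟨z, rfl⟩
      induction z using QuotientGroup.induction_on with
      | H x =>
        refine ⟨((s.symm x⁻¹ : E) : E ⧸ T), ?_⟩
        rw [MonoidHom.comp_apply, key]
        simp
  have h3 : Db.range.index = 3 := by
    have : (Db.comp Db).range.index = Db.range.index * Db.range.index := by
      rw [MonoidHom.range_comp, Subgroup.index_map_of_injective _ hDbinj]
    rw [hDD, h9] at this
    nlinarith
  have hsup : (D.range ⊔ T).index = 3 := by
    have : D.range ⊔ T = Db.range.comap (QuotientGroup.mk' T) := by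
      have h1 : Db.range = D.range.map (QuotientGroup.mk' T) := by
        rw [← MonoidHom.range_comp]
        have : (QuotientGroup.mk' T).comp D = Db.comp (QuotientGroup.mk' T) := rfl
        rw [this, MonoidHom.range_comp, MonoidHom.range_eq_top.2 (QuotientGroup.mk'_surjective T),
          ← MonoidHom.range_eq_map]
      rw [h1, Subgroup.comap_map_eq, QuotientGroup.ker_mk']
    rw [this, Subgroup.index_comap_of_surjective _ (QuotientGroup.mk'_surjective T), h3]
  have hinf : (D.range).relIndex T = Nat.card D.ker := by
    have h1 : D.range ⊓ T = T.map D := by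
      ext y
      constructor
      · rintro ⟨⟨x, rfl⟩, hy⟩
        exact ⟨x, hDT x hy, rfl⟩
      · rintro ⟨x, hx, rfl⟩
        exact ⟨⟨x, rfl⟩, hTD hx⟩
    have hker : D.ker ≤ T := fun x hx ↦ hDT x (by rw [MonoidHom.mem_ker.1 hx]; exact T.one_mem)
    have h2 : Nat.card D.ker * Nat.card (T.map D) = Nat.card T := by
      rw [← Subgroup.relIndex_ker, ← Subgroup.relIndex_bot_left, ← Subgroup.relIndex_bot_left,
        Subgroup.relIndex_mul_relIndex _ _ _ bot_le hker]
    have h3 : Nat.card (T.map D) * (D.range).relIndex T = Nat.card T := by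
      rw [← h1, ← Subgroup.inf_relIndex_right, ← Subgroup.relIndex_bot_left,
        Subgroup.relIndex_mul_relIndex _ _ _ bot_le inf_le_right, Subgroup.relIndex_bot_left]
    have h4 : 0 < Nat.card (T.map D) := by
      have : Finite (T.map D) := Finite.Set.finite_image _ _
      exact Nat.card_pos
    apply Nat.eq_of_mul_eq_mul_left h4
    rw [h3, ← h2, mul_comm]
  rw [← Subgroup.relIndex_mul_index (le_sup_left : D.range ≤ D.range ⊔ T), hsup, sup_comm,
    Subgroup.relIndex_sup_right, hinf, mul_comm]

/-- The norm `x * s x * s (s x)` attached to an automorphism `s` of order three. -/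
def RingEquiv.cubicNorm {R : Type*} [CommRing R] (s : R ≃+* R) : R →* R where
  toFun x := x * s x * s (s x)
  map_one' := by simp
  map_mul' x y := by simp only [map_mul]; ring

lemma RingEquiv.cubicNorm_apply {R : Type*} [CommRing R] (s : R ≃+* R) (x : R) :
    s.cubicNorm x = x * s x * s (s x) := rfl

/-- The formal properties of the automorphism `s` of the ring of integers `R` of a cyclic cubic
extension of a number field with ring of integers `A` which enter in the ambiguous class number
formula. The finite set `S` consists of the totally ramified primes. -/
structure IsCubicSetup (A : Type*) {R : Type*} [CommRing A] [CommRing R] [IsDedekindDomain R]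
    [Algebra A R] (s : R ≃+* R) (S : Finset (Ideal R)) : Prop where
  cube : ∀ x, s (s (s x)) = x
  fixes : ∀ a : A, s (algebraMap A R a) = algebraMap A R a
  fixed : ∀ x, s x = x → ∃ a : A, algebraMap A R a = x
  inj : Function.Injective (algebraMap A R)
  hilbert90 : ∀ a b : R, a ≠ 0 → b ≠ 0 → s.cubicNorm a = s.cubicNorm b →
    ∃ β ≠ 0, b * s β = a * β
  prime : ∀ Q ∈ S, Prime Q
  map_eq : ∀ Q ∈ S, Q.map s = Q
  extended : ∀ I : Ideal R, I ≠ 0 → I.map s = I → (∀ Q ∈ S, 3 ∣ multiplicity Q I) →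
    ∃ a : A, a ≠ 0 ∧ I = span {algebraMap A R a}
  dvd : ∀ a : A, a ≠ 0 → ∀ Q ∈ S, 3 ∣ multiplicity Q (span {algebraMap A R a})

lemma Ideal.multiplicity_mul_of_prime {R : Type*} [CommRing R] [IsDedekindDomain R]
    {Q I J : Ideal R} (hQ : Prime Q) (hI : I ≠ 0) (hJ : J ≠ 0) :
    multiplicity Q (I * J) = multiplicity Q I + multiplicity Q J :=
  multiplicity_mul hQ (FiniteMultiplicity.of_prime_left hQ (mul_ne_zero hI hJ))

namespace IsCubicSetup

variable {A R : Type*} [CommRing A] [CommRing R] [IsDedekindDomain R]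
    [Algebra A R] {s : R ≃+* R} {S : Finset (Ideal R)}

lemma map_ne_zero {s : R ≃+* R} {I : Ideal R} (hI : I ≠ 0) : I.map s ≠ 0 := by
  rwa [Ne, Ideal.zero_eq_bot, Ideal.map_eq_bot_iff_of_injective s.injective]

lemma cubicNorm_fixed (h : IsCubicSetup A s S) (x : R) : s (s.cubicNorm x) = s.cubicNorm x := by
  simp only [RingEquiv.cubicNorm_apply, map_mul, h.cube]; ring

lemma cubicNorm_map (h : IsCubicSetup A s S) (x : R) : s.cubicNorm (s x) = s.cubicNorm x := by
  simp only [RingEquiv.cubicNorm_apply, h.cube]; ring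

lemma cubicNorm_ne_zero (s : R ≃+* R) {x : R} (hx : x ≠ 0) : s.cubicNorm x ≠ 0 := by
  simp [RingEquiv.cubicNorm_apply, hx]

lemma exists_unit_of_fixed (h : IsCubicSetup A s S) (ε : Rˣ) (hε : s (ε : R) = ε) :
    ∃ u : Aˣ, algebraMap A R u = ε := by
  obtain ⟨a, ha⟩ := h.fixed _ hε
  have hε' : s ((ε⁻¹ : Rˣ) : R) = (ε⁻¹ : Rˣ) := by
    have : s ((ε⁻¹ : Rˣ) : R) * ε = 1 := by
      calc _ = s ((ε⁻¹ : Rˣ) : R) * s ε := by rw [hε]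
        _ = 1 := by rw [← map_mul]; simp
    exact (Units.inv_eq_of_mul_eq_one_left this).symm
  obtain ⟨b, hb⟩ := h.fixed _ hε'
  refine ⟨⟨a, b, h.inj (by simp [ha, hb]), h.inj (by simp [ha, hb])⟩, ha⟩

/-- Pairs of a class `c` of an ideal `I` with `s I = (a / b) I` and a unit `N (a / b)`. -/
def classUnitRel (A : Type*) [CommRing A] [Algebra A R] (s : R ≃+* R) :
    Submonoid (ClassGroup R × Aˣ) where
  carrier := {p | ∃ I : (Ideal R)⁰, ∃ a b : R, a ≠ 0 ∧ b ≠ 0 ∧ ClassGroup.mk0 I = p.1 ∧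
    span {b} * (I : Ideal R).map s = span {a} * I ∧
    algebraMap A R p.2 * s.cubicNorm b = s.cubicNorm a}
  one_mem' := ⟨1, 1, 1, one_ne_zero, one_ne_zero, by simp, by simp [Ideal.map_top], by simp⟩
  mul_mem' := by
    rintro ⟨c, u⟩ ⟨c', u'⟩ ⟨I, a, b, ha, hb, hI, h1, h2⟩ ⟨I', a', b', ha', hb', hI', h1', h2'⟩
    refine ⟨I * I', a * a', b * b', mul_ne_zero ha ha', mul_ne_zero hb hb', ?_, ?_, ?_⟩
    · rw [map_mul, hI, hI']; rfl
    · rw [← span_singleton_mul_span_singleton, ← span_singleton_mul_span_singleton,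
        Submonoid.coe_mul, Ideal.map_mul, mul_mul_mul_comm, h1, h1', mul_mul_mul_comm]
    · dsimp only at h2 h2' ⊢
      rw [map_mul, map_mul, ← h2, ← h2']
      simp only [Prod.mk_mul_mk, Units.val_mul, map_mul]
      ring

/-- The classes fixed by `s`. -/
def IsFixedClass (s : R ≃+* R) (c : ClassGroup R) : Prop :=
  ∃ I : (Ideal R)⁰, ∃ a b : R, a ≠ 0 ∧ b ≠ 0 ∧ ClassGroup.mk0 I = c ∧
    span {b} * (I : Ideal R).map s = span {a} * I

/-- The classes containing an ideal fixed by `s`. -/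
def IsStrongClass (s : R ≃+* R) (c : ClassGroup R) : Prop :=
  ∃ I : (Ideal R)⁰, ClassGroup.mk0 I = c ∧ (I : Ideal R).map s = I

/-- The units of `A` which are norms of elements of the fraction field of `R`. -/
def IsNormUnit (s : R ≃+* R) (u : Aˣ) : Prop :=
  ∃ a b : R, a ≠ 0 ∧ b ≠ 0 ∧ algebraMap A R u * s.cubicNorm b = s.cubicNorm a

/-- The units of `A` which are norms of units. -/
def IsUnitNorm (s : R ≃+* R) (u : Aˣ) : Prop :=
  ∃ ε : Rˣ, algebraMap A R u = s.cubicNorm (ε : R)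

lemma classUnitRel_fst (h : IsCubicSetup A s S) (c : ClassGroup R) :
    (∃ u, (c, u) ∈ classUnitRel A s) ↔ IsFixedClass s c := by
  constructor
  · rintro ⟨u, I, a, b, ha, hb, hI, h1, h2⟩
    exact ⟨I, a, b, ha, hb, hI, h1⟩
  · rintro ⟨I, a, b, ha, hb, hI, h1⟩
    have hI0 : (I : Ideal R) ≠ 0 := nonZeroDivisors.coe_ne_zero I
    have h2 := congrArg (Ideal.map s) h1
    have h3 := congrArg (Ideal.map s) h2
    have hs3 : (((I : Ideal R).map s).map s).map s = I := by
      have hc : ∀ J : Ideal R, J.map s = J.comap s.symm := fun J ↦ Ideal.map_comap_of_equiv s (I := J)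
      rw [hc, hc, hc]
      ext x
      have : s.symm (s.symm (s.symm x)) = x := by
        rw [s.symm_apply_eq, s.symm_apply_eq, s.symm_apply_eq, h.cube]
      rw [Ideal.mem_comap, Ideal.mem_comap, Ideal.mem_comap, this]
    simp only [Ideal.map_mul, Ideal.map_span, Set.image_singleton] at h2 h3
    rw [hs3] at h3
    have h4 : span {s.cubicNorm b} = span {s.cubicNorm a} := by
      have hN : (I : Ideal R) * (I : Ideal R).map s * ((I : Ideal R).map s).map s ≠ 0 :=
        mul_ne_zero (mul_ne_zero hI0 (map_ne_zero hI0)) (map_ne_zero (map_ne_zero hI0))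
      apply mul_right_cancel₀ hN
      simp only [RingEquiv.cubicNorm_apply, ← span_singleton_mul_span_singleton]
      calc _ = (span {b} * (I : Ideal R).map s) * (span {s b} * ((I : Ideal R).map s).map s) *
            (span {s (s b)} * I) := by ring
        _ = _ := by rw [h1, h2, h3]; ring
    obtain ⟨ε, hε⟩ := (Ideal.span_singleton_eq_span_singleton.1 h4)
    obtain ⟨u, hu⟩ := h.exists_unit_of_fixed ε (by
      apply mul_left_cancel₀ (cubicNorm_ne_zero s hb)
      rw [hε, ← h.cubicNorm_fixed b, ← map_mul, hε, h.cubicNorm_fixed])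
    exact ⟨u, I, a, b, ha, hb, hI, h1, by rw [← hε, mul_comm, ← hu]⟩

lemma classUnitRel_one_fst (h : IsCubicSetup A s S) (u : Aˣ) :
    (1, u) ∈ classUnitRel A s ↔ IsUnitNorm s u := by
  constructor
  · rintro ⟨I, a, b, ha, hb, hI, h1, h2⟩
    obtain ⟨γ, hγ⟩ := ((ClassGroup.mk0_eq_one_iff I.2).1 hI).principal
    have hI0 : (I : Ideal R) ≠ 0 := nonZeroDivisors.coe_ne_zero I
    rw [← Ideal.span] at hγ
    have hγ0 : γ ≠ 0 := by
      rintro rfl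
      simp [hγ] at hI0
    rw [hγ, Ideal.map_span, Set.image_singleton, span_singleton_mul_span_singleton,
      span_singleton_mul_span_singleton] at h1
    obtain ⟨ε, hε⟩ := (Ideal.span_singleton_eq_span_singleton.1 h1)
    refine ⟨ε, ?_⟩
    have h3 := congrArg s.cubicNorm hε
    rw [map_mul, map_mul, map_mul, h.cubicNorm_map, ← h2] at h3
    apply mul_right_cancel₀ (mul_ne_zero (cubicNorm_ne_zero s hb) (cubicNorm_ne_zero s hγ0))
    dsimp only at h3
    rw [← mul_assoc, ← h3]
    ring
  · rintro ⟨ε, hε⟩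
    exact ⟨1, ε, 1, ε.ne_zero, one_ne_zero, by simp,
      by simp [Ideal.map_top, Ideal.span_singleton_eq_top.2 ε.isUnit], by simpa using hε⟩

lemma classUnitRel_snd (h : IsCubicSetup A s S) (u : Aˣ) :
    (∃ c, (c, u) ∈ classUnitRel A s) ↔ IsNormUnit s u := by
  constructor
  · rintro ⟨c, I, a, b, ha, hb, -, -, h2⟩
    exact ⟨a, b, ha, hb, h2⟩
  · rintro ⟨a, b, ha, hb, h2⟩
    have hsa : s a ≠ 0 := by simpa
    have hI0 : span {a * s a, b * s a, b * s b} ≠ 0 := by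
      rw [Ne, Ideal.zero_eq_bot, Ideal.span_eq_bot]
      exact fun h ↦ mul_ne_zero ha hsa (h _ (by simp))
    refine ⟨_, ⟨span {a * s a, b * s a, b * s b}, mem_nonZeroDivisors_of_ne_zero hI0⟩, s (s a), b,
      by simpa, hb, rfl, ?_, by rw [h.cubicNorm_map, h.cubicNorm_map]; exact h2⟩
    simp only [Ideal.map_span, Set.image_insert_eq, Set.image_singleton, map_mul,
      Ideal.span_mul_span', Set.singleton_mul]
    simp only [RingEquiv.cubicNorm_apply] at h2
    apply le_antisymm
    · rw [Ideal.span_le]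
      rintro _ (rfl | rfl | rfl)
      · exact Ideal.subset_span (Or.inr (Or.inl (by ring)))
      · exact Ideal.subset_span (Or.inr (Or.inr (by simp only [Set.mem_singleton_iff]; ring)))
      · have : b * (s b * s (s b)) = algebraMap A R (u⁻¹ : Aˣ) * (s (s a) * (a * s a)) := by
          calc _ = algebraMap A R (u⁻¹ : Aˣ) * (algebraMap A R u * (b * s b * s (s b))) := by
                rw [← mul_assoc (algebraMap A R _), ← map_mul (algebraMap A R), Units.inv_mul, map_one,
                  one_mul, mul_assoc]
            _ = _ := by rw [h2]; ring
        rw [this]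
        exact Ideal.mul_mem_left _ _ (Ideal.subset_span (Or.inl rfl))
    · rw [Ideal.span_le]
      rintro _ (rfl | rfl | rfl)
      · have : s (s a) * (a * s a) = algebraMap A R u * (b * (s b * s (s b))) := by
          rw [← mul_assoc b, h2]; ring
        simp only [this]
        exact Ideal.mul_mem_left _ _ (Ideal.subset_span (Or.inr (Or.inr rfl)))
      · exact Ideal.subset_span (Or.inl (by ring))
      · exact Ideal.subset_span (Or.inr (Or.inl (by ring)))

lemma classUnitRel_one_snd (h : IsCubicSetup A s S) (c : ClassGroup R) :
    (c, 1) ∈ classUnitRel A s ↔ IsStrongClass s c := by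
  constructor
  · rintro ⟨I, a, b, ha, hb, hI, h1, h2⟩
    obtain ⟨β, hβ, hβ'⟩ := h.hilbert90 a b ha hb (by simpa using h2.symm)
    have hI0 : (I : Ideal R) ≠ 0 := nonZeroDivisors.coe_ne_zero I
    have h1' : span {s β} * (I : Ideal R) = span {β} * (I : Ideal R).map s := by
      have : span {a} * span {b} ≠ 0 := by simp [ha, hb]
      apply mul_left_cancel₀ this
      calc _ = (span {b} * span {s β}) * (span {a} * I) := by ring
        _ = (span {a} * span {β}) * (span {b} * (I : Ideal R).map s) := by
          rw [span_singleton_mul_span_singleton, hβ', h1, span_singleton_mul_span_singleton]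
        _ = _ := by ring
    refine ⟨⟨I * span {s β * s (s β)}, mem_nonZeroDivisors_of_ne_zero
      (mul_ne_zero hI0 (by simpa using hβ))⟩, ?_, ?_⟩
    · dsimp only at hI ⊢
      rw [← hI, ClassGroup.mk0_eq_mk0_iff]
      exact ⟨1, s β * s (s β), one_ne_zero, by simpa using hβ, by simp [mul_comm]⟩
    · have h3 : (I : Ideal R) * span {s β} * span {s (s β)} =
          (I : Ideal R).map s * span {s (s β)} * span {β} := by
        rw [mul_comm (I : Ideal R), h1']; ring
      simp only [Ideal.map_mul, Ideal.map_span, Set.image_singleton, map_mul, h.cube]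
      rw [← span_singleton_mul_span_singleton, ← span_singleton_mul_span_singleton, ← mul_assoc,
        ← mul_assoc, h3]
  · rintro ⟨I, hI, hI'⟩
    exact ⟨I, 1, 1, one_ne_zero, one_ne_zero, hI, by rw [hI'], by simp⟩

/-- Pairs of the multiplicities of the primes in `S` modulo `3` and the class of
an ideal fixed by `s`. -/
def multClassRel (s : R ≃+* R) (S : Finset (Ideal R)) (hS : ∀ Q ∈ S, Prime Q) :
    Submonoid ((S → Multiplicative (ZMod 3)) × ClassGroup R) where
  carrier := {p | ∃ I : (Ideal R)⁰, (I : Ideal R).map s = I ∧ ClassGroup.mk0 I = p.2 ∧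
    ∀ Q : S, p.1 Q = Multiplicative.ofAdd ((multiplicity Q.1 (I : Ideal R) : ℕ) : ZMod 3)}
  one_mem' := ⟨1, by simp [Ideal.map_top], by simp, fun Q ↦ by
    have : multiplicity Q.1 (⊤ : Ideal R) = 0 :=
      multiplicity_eq_zero.2 fun h ↦ (hS _ Q.2).not_isUnit (isUnit_of_dvd_one (by rwa [Ideal.one_eq_top]))
    simp [this]⟩
  mul_mem' := by
    rintro ⟨x, c⟩ ⟨x', c'⟩ ⟨I, h1, h2, h3⟩ ⟨I', h1', h2', h3'⟩
    refine ⟨I * I', ?_, ?_, ?_⟩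
    · rw [Submonoid.coe_mul, Ideal.map_mul, h1, h1']
    · rw [map_mul, h2, h2']; rfl
    · intro Q
      rw [Submonoid.coe_mul, Ideal.multiplicity_mul_of_prime (hS _ Q.2)
        (nonZeroDivisors.coe_ne_zero I) (nonZeroDivisors.coe_ne_zero I')]
      have := h3 Q
      have := h3' Q
      simp_all

/-- The vectors of multiplicities modulo `3` of principal ideals fixed by `s`. -/
def IsPrincipalMult (s : R ≃+* R) (S : Finset (Ideal R)) (x : S → Multiplicative (ZMod 3)) :
    Prop :=
  ∃ β : R, β ≠ 0 ∧ (span {β}).map s = span {β} ∧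
    ∀ Q : S, x Q = Multiplicative.ofAdd ((multiplicity Q.1 (span {β}) : ℕ) : ZMod 3)

lemma multClassRel_fst (h : IsCubicSetup A s S) (x : S → Multiplicative (ZMod 3)) :
    ∃ c, (x, c) ∈ multClassRel s S h.prime := by
  have hp : ∏ Q : S, Q.1 ^ ((x Q).toAdd.val) ≠ 0 :=
    Finset.prod_ne_zero_iff.2 fun Q _ ↦ pow_ne_zero _ (h.prime _ Q.2).ne_zero
  refine ⟨_, ⟨∏ Q : S, Q.1 ^ ((x Q).toAdd.val), mem_nonZeroDivisors_of_ne_zero hp⟩, ?_, rfl, ?_⟩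
  · have : ∀ I : Ideal R, I.map s = Ideal.mapHom s I := fun _ ↦ rfl
    simp only [this, map_prod, map_pow]
    exact Finset.prod_congr rfl fun Q _ ↦ by rw [← this, h.map_eq _ Q.2]
  · intro Q
    dsimp only
    simp only [← Finset.mul_prod_erase _ _ (Finset.mem_univ Q)]
    rw [
      Ideal.multiplicity_mul_of_prime (h.prime _ Q.2) (pow_ne_zero _ (h.prime _ Q.2).ne_zero)
      (Finset.prod_ne_zero_iff.2 fun Q _ ↦ pow_ne_zero _ (h.prime _ Q.2).ne_zero),
      multiplicity_pow_self_of_prime (h.prime _ Q.2), multiplicity_eq_zero.2]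
    · simp
    · rw [(h.prime _ Q.2).dvd_finsetProd_iff]
      rintro ⟨P, hP, hQP⟩
      have h1 := (h.prime _ Q.2).dvd_of_dvd_pow hQP
      have h2 := (h.prime _ Q.2).associated_of_dvd (h.prime _ P.2) h1
      exact (Finset.mem_erase.1 hP).1 (Subtype.ext (associated_iff_eq.1 h2).symm)

lemma multClassRel_one_fst (h : IsCubicSetup A s S) (c : ClassGroup R) :
    (1, c) ∈ multClassRel s S h.prime ↔ c = 1 := by
  constructor
  · rintro ⟨I, h1, h2, h3⟩
    obtain ⟨a, ha, ha'⟩ := h.extended I (nonZeroDivisors.coe_ne_zero I) h1 (fun Q hQ ↦ by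
      have := h3 ⟨Q, hQ⟩
      exact (ZMod.natCast_eq_zero_iff _ _).1 (Multiplicative.ofAdd.injective this).symm)
    dsimp only at h2
    rw [← h2]
    exact (ClassGroup.mk0_eq_one_iff I.2).2 (ha' ▸ ⟨⟨_, rfl⟩⟩)
  · rintro rfl
    exact Submonoid.one_mem _

lemma multClassRel_snd (h : IsCubicSetup A s S) (c : ClassGroup R) :
    (∃ x, (x, c) ∈ multClassRel s S h.prime) ↔ IsStrongClass s c := by
  constructor
  · rintro ⟨x, I, h1, h2, h3⟩
    exact ⟨I, h2, h1⟩
  · rintro ⟨I, h1, h2⟩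
    exact ⟨fun Q ↦ _, I, h2, h1, fun Q ↦ rfl⟩

lemma multClassRel_one_snd (h : IsCubicSetup A s S) (x : S → Multiplicative (ZMod 3)) :
    (x, 1) ∈ multClassRel s S h.prime ↔ IsPrincipalMult s S x := by
  constructor
  · rintro ⟨I, h1, h2, h3⟩
    obtain ⟨γ, hγ⟩ := ((ClassGroup.mk0_eq_one_iff I.2).1 h2).principal
    have hI0 : (I : Ideal R) ≠ 0 := nonZeroDivisors.coe_ne_zero I
    rw [← Ideal.span] at hγ
    rw [hγ] at h1 h3 hI0
    exact ⟨γ, by simpa using hI0, h1, h3⟩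
  · rintro ⟨β, hβ, h1, h2⟩
    have hβ' : span {β} ≠ 0 := by simpa using hβ
    exact ⟨⟨span {β}, mem_nonZeroDivisors_of_ne_zero hβ'⟩, h1,
      (ClassGroup.mk0_eq_one_iff _).2 ⟨⟨_, rfl⟩⟩, h2⟩

/-- The action of `s` on units. -/
abbrev unitsEquiv (s : R ≃+* R) : Rˣ ≃* Rˣ := Units.mapEquiv s.toMulEquiv

/-- Pairs of the multiplicities of `β` at the primes in `S` modulo `3` and the unit `s β / β`. -/
def multUnitRel (s : R ≃+* R) (S : Finset (Ideal R)) (hS : ∀ Q ∈ S, Prime Q) :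
    Submonoid ((S → Multiplicative (ZMod 3)) × (Rˣ ⧸ (unitsEquiv s).divSelfHom.range)) where
  carrier := {p | ∃ β : R, β ≠ 0 ∧ ∃ η : Rˣ, s β = η * β ∧ (η : Rˣ ⧸ _) = p.2 ∧
    ∀ Q : S, p.1 Q = Multiplicative.ofAdd ((multiplicity Q.1 (span {β}) : ℕ) : ZMod 3)}
  one_mem' := ⟨1, one_ne_zero, 1, by simp, rfl, fun Q ↦ by
    have : multiplicity Q.1 (⊤ : Ideal R) = 0 :=
      multiplicity_eq_zero.2 fun h ↦ (hS _ Q.2).not_isUnit (isUnit_of_dvd_one (by rwa [Ideal.one_eq_top]))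
    simp [this]⟩
  mul_mem' := by
    rintro ⟨x, c⟩ ⟨x', c'⟩ ⟨β, hβ, η, h1, h2, h3⟩ ⟨β', hβ', η', h1', h2', h3'⟩
    refine ⟨β * β', mul_ne_zero hβ hβ', η * η', ?_, ?_, ?_⟩
    · rw [map_mul, h1, h1', Units.val_mul]; ring
    · rw [QuotientGroup.mk_mul, h2, h2']; rfl
    · intro Q
      rw [← span_singleton_mul_span_singleton, Ideal.multiplicity_mul_of_prime (hS _ Q.2)
        (by simpa using hβ) (by simpa using hβ')]
      have := h3 Q
      have := h3' Q
      simp_all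

lemma multUnitRel_one_fst (h : IsCubicSetup A s S) (y : Rˣ ⧸ (unitsEquiv s).divSelfHom.range) :
    (1, y) ∈ multUnitRel s S h.prime ↔ y = 1 := by
  constructor
  · rintro ⟨β, hβ, η, h1, h2, h3⟩
    obtain ⟨a, ha, ha'⟩ := h.extended (span {β}) (by simpa using hβ) (by
      rw [Ideal.map_span, Set.image_singleton, h1, Ideal.span_singleton_mul_left_unit η.isUnit])
      (fun Q hQ ↦ by
        have := h3 ⟨Q, hQ⟩
        exact (ZMod.natCast_eq_zero_iff _ _).1 (Multiplicative.ofAdd.injective this).symm)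
    obtain ⟨ε, hε⟩ := (Ideal.span_singleton_eq_span_singleton.1 ha'.symm)
    dsimp only at h2
    rw [← h2, QuotientGroup.eq_one_iff]
    refine ⟨ε, ?_⟩
    rw [MulEquiv.divSelfHom_apply, div_eq_iff_eq_mul]
    ext
    have ha0 : algebraMap A R a ≠ 0 := by rwa [Ne, map_eq_zero_iff _ h.inj]
    apply mul_left_cancel₀ ha0
    rw [← hε, map_mul, h.fixes] at h1
    simp only [Units.coe_mapEquiv, Units.val_mul]
    refine Eq.trans h1 ?_
    ring
  · rintro rfl
    exact Submonoid.one_mem _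

lemma multUnitRel_one_snd (h : IsCubicSetup A s S) (x : S → Multiplicative (ZMod 3)) :
    (x, 1) ∈ multUnitRel s S h.prime ↔ x = 1 := by
  constructor
  · rintro ⟨β, hβ, η, h1, h2, h3⟩
    dsimp only at h2
    rw [QuotientGroup.eq_one_iff] at h2
    obtain ⟨ε, rfl⟩ := h2
    have h4 : s β * ε = s ε * β := by
      rw [h1]
      have : (((unitsEquiv s).divSelfHom ε : Rˣ) : R) * ε = s ε := by
        rw [← Units.val_mul, MulEquiv.divSelfHom_apply, div_mul_cancel]; rfl
      rw [← this]; ring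
    have h5 : s (β * (ε⁻¹ : Rˣ)) = β * (ε⁻¹ : Rˣ) := by
      have h6 : s ε ≠ 0 := by simp
      apply mul_right_cancel₀ h6
      apply mul_right_cancel₀ ε.ne_zero
      have e1 : s ((ε⁻¹ : Rˣ) : R) * s ε = 1 := by rw [← map_mul]; simp
      have e2 : ((ε⁻¹ : Rˣ) : R) * ε = 1 := by simp
      rw [map_mul]
      linear_combination (s β * ε) * e1 - (β * s ε) * e2 + h4
    obtain ⟨a, ha⟩ := h.fixed _ h5
    have ha0 : a ≠ 0 := by
      rintro rfl
      simp [hβ, eq_comm] at ha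
    have h7 : span {β} = span {algebraMap A R a} := by
      rw [ha, Ideal.span_singleton_mul_right_unit (ε⁻¹).isUnit]
    funext Q
    refine (h3 Q).trans ?_
    rw [h7, (ZMod.natCast_eq_zero_iff _ _).2 (h.dvd a ha0 Q.1 Q.2)]
    rfl
  · rintro rfl
    exact Submonoid.one_mem _

lemma multUnitRel_fst (h : IsCubicSetup A s S) (x : S → Multiplicative (ZMod 3)) :
    (∃ y, (x, y) ∈ multUnitRel s S h.prime) ↔ IsPrincipalMult s S x := by
  constructor
  · rintro ⟨y, β, hβ, η, h1, h2, h3⟩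
    exact ⟨β, hβ, by
      rw [Ideal.map_span, Set.image_singleton, h1, Ideal.span_singleton_mul_left_unit η.isUnit], h3⟩
  · rintro ⟨β, hβ, h1, h2⟩
    rw [Ideal.map_span, Set.image_singleton, eq_comm] at h1
    obtain ⟨ε, hε⟩ := (Ideal.span_singleton_eq_span_singleton.1 h1)
    exact ⟨_, β, hβ, ε, by rw [← hε, mul_comm], rfl, h2⟩

/-- Pairs of the class modulo `s - 1` and the norm of a unit. -/
def unitNormRel (A : Type*) [CommRing A] [Algebra A R] (s : R ≃+* R) :
    Submonoid ((Rˣ ⧸ (unitsEquiv s).divSelfHom.range) × Aˣ) where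
  carrier := {p | ∃ η : Rˣ, (η : Rˣ ⧸ _) = p.1 ∧ algebraMap A R p.2 = s.cubicNorm (η : R)}
  one_mem' := ⟨1, rfl, by simp⟩
  mul_mem' := by
    rintro ⟨x, c⟩ ⟨x', c'⟩ ⟨η, h1, h2⟩ ⟨η', h1', h2'⟩
    dsimp only at *
    exact ⟨η * η', by rw [QuotientGroup.mk_mul, h1, h1']; rfl, by
      rw [Units.val_mul, map_mul, ← h2, ← h2', ← map_mul]; rfl⟩

lemma unitNormRel_fst (h : IsCubicSetup A s S) (y : Rˣ ⧸ (unitsEquiv s).divSelfHom.range) :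
    ∃ u, (y, u) ∈ unitNormRel A s := by
  induction y using QuotientGroup.induction_on with
  | H η =>
    obtain ⟨u, hu⟩ := h.exists_unit_of_fixed (Units.map s.cubicNorm η) (h.cubicNorm_fixed _)
    exact ⟨u, η, rfl, hu⟩

lemma unitNormRel_one_fst (h : IsCubicSetup A s S) (u : Aˣ) :
    (1, u) ∈ unitNormRel A s ↔ u = 1 := by
  constructor
  · rintro ⟨η, h1, h2⟩
    dsimp only at h1 h2
    rw [QuotientGroup.eq_one_iff] at h1
    obtain ⟨ε, rfl⟩ := h1
    ext
    apply h.inj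
    have h3 : (((unitsEquiv s).divSelfHom ε : Rˣ) : R) * ε = s ε := by
      rw [← Units.val_mul, MulEquiv.divSelfHom_apply, div_mul_cancel]; rfl
    have h4 := congrArg s.cubicNorm h3
    rw [map_mul, h.cubicNorm_map] at h4
    rw [h2]
    apply mul_right_cancel₀ (cubicNorm_ne_zero s ε.ne_zero)
    simpa using h4
  · rintro rfl
    exact Submonoid.one_mem _

lemma unitNormRel_one_snd (h : IsCubicSetup A s S) (y : Rˣ ⧸ (unitsEquiv s).divSelfHom.range) :
    (y, 1) ∈ unitNormRel A s ↔ ∃ x, (x, y) ∈ multUnitRel s S h.prime := by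
  constructor
  · rintro ⟨η, h1, h2⟩
    obtain ⟨β, hβ, hβ'⟩ := h.hilbert90 η 1 η.ne_zero one_ne_zero (by simpa using h2.symm)
    exact ⟨_, β, hβ, η, by simpa using hβ', h1, fun Q ↦ rfl⟩
  · rintro ⟨x, β, hβ, η, h1, h2, h3⟩
    refine ⟨η, h2, ?_⟩
    have h4 := congrArg s.cubicNorm h1
    rw [map_mul, h.cubicNorm_map] at h4
    apply mul_right_cancel₀ (cubicNorm_ne_zero s hβ)
    simpa using h4

/-- **The ambiguous class number formula** for cyclic cubic extensions of a field of class number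
one with finite unit group. -/
theorem card_fixedClass (h : IsCubicSetup A s S) [Finite (ClassGroup R)] [Finite Aˣ]
    (hE : (unitsEquiv s).divSelfHom.range.index = 3 * Nat.card Aˣ) :
    Nat.card {c : ClassGroup R // IsFixedClass s c} * (3 * Nat.card Aˣ) =
      Nat.card {u : Aˣ // IsNormUnit s u} * 3 ^ S.card := by
  have hfin : Finite (Rˣ ⧸ (unitsEquiv s).divSelfHom.range) := by
    refine Nat.finite_of_card_ne_zero ?_
    change (unitsEquiv s).divSelfHom.range.index ≠ 0
    rw [hE]
    have := Nat.card_pos (α := Aˣ)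
    positivity
  have h1 := (classUnitRel A s).card_eq_card_fst_mul
  have h1' := (classUnitRel A s).card_eq_card_snd_mul
  have h2 := (multClassRel s S h.prime).card_eq_card_fst_mul
  have h2' := (multClassRel s S h.prime).card_eq_card_snd_mul
  have h3 := (multUnitRel s S h.prime).card_eq_card_fst_mul
  have h3' := (multUnitRel s S h.prime).card_eq_card_snd_mul
  have h4 := (unitNormRel A s).card_eq_card_fst_mul
  have h4' := (unitNormRel A s).card_eq_card_snd_mul
  simp only [h.classUnitRel_fst, h.classUnitRel_one_fst] at h1
  simp only [h.classUnitRel_snd, h.classUnitRel_one_snd] at h1'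
  simp only [h.multClassRel_fst, h.multClassRel_one_fst] at h2
  simp only [h.multClassRel_snd, h.multClassRel_one_snd] at h2'
  simp only [h.multUnitRel_fst, h.multUnitRel_one_fst] at h3
  simp only [h.multUnitRel_one_snd] at h3'
  simp only [h.unitNormRel_fst, h.unitNormRel_one_fst] at h4
  simp only [h.unitNormRel_one_snd] at h4'
  have hU : ∀ u : Aˣ, (∃ g, (g, u) ∈ unitNormRel A s) ↔ IsUnitNorm s u := fun u ↦
    ⟨fun ⟨_, η, _, hη⟩ ↦ ⟨η, hη⟩, fun ⟨η, hη⟩ ↦ ⟨_, η, rfl, hη⟩⟩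
  simp only [hU] at h4'
  have e1 : Nat.card {x : S → Multiplicative (ZMod 3) // True} = 3 ^ S.card := by
    rw [Nat.card_congr (Equiv.subtypeUnivEquiv fun _ ↦ trivial)]
    simp [Nat.card_eq_fintype_card]
  have e2 : Nat.card {x : Rˣ ⧸ (unitsEquiv s).divSelfHom.range // True} = 3 * Nat.card Aˣ := by
    rw [Nat.card_congr (Equiv.subtypeUnivEquiv fun _ ↦ trivial), ← hE]
    rfl
  rw [e1] at h2
  rw [e2] at h4
  simp only [Nat.card_unique, mul_one] at h2 h3 h3' h4
  rw [h1] at h1'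
  rw [h2] at h2'
  rw [h3] at h3'
  rw [h4] at h4'
  rw [h4', h2', h3', ← mul_assoc, ← mul_assoc, h1']

end IsCubicSetup

section RamifiedPrimes

variable {F K : Type} [Field F] [NumberField F] [Field K] [NumberField K] [Algebra F K]

/-- The automorphism of the ring of integers induced by an element of the Galois group. -/
abbrev galRingEquiv (σ : Gal(K/F)) : 𝓞 K ≃+* 𝓞 K := MulSemiringAction.toRingEquiv _ _ σ

/-- The nonzero primes whose inertia group contains `σ`. -/
def ramifiedPrimes (σ : Gal(K/F)) : Set (Ideal (𝓞 K)) :=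
  {Q | Prime Q ∧ ∀ x : 𝓞 K, σ • x - x ∈ Q}

omit [NumberField F] in
lemma exists_smul_ne {σ : Gal(K/F)} (hσ : σ ≠ 1) : ∃ x : 𝓞 K, σ • x - x ≠ 0 := by
  by_contra! h
  refine hσ (AlgEquiv.ext fun z ↦ ?_)
  obtain ⟨x, y, hy, rfl⟩ := IsFractionRing.div_surjective (𝓞 K) z
  have key : ∀ x : 𝓞 K, σ (algebraMap (𝓞 K) K x) = algebraMap (𝓞 K) K x := fun x ↦
    congrArg (algebraMap (𝓞 K) K) (sub_eq_zero.mp (h x))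
  simp [map_div₀, key]

omit [NumberField F] in
lemma finite_ramifiedPrimes {σ : Gal(K/F)} (hσ : σ ≠ 1) : (ramifiedPrimes σ).Finite := by
  obtain ⟨x, hx⟩ := exists_smul_ne hσ
  have h0 : span {σ • x - x} ≠ (0 : Ideal (𝓞 K)) := by simpa using hx
  have : Finite {Q // Q ∣ span {σ • x - x}} :=
    @Finite.of_fintype _ (UniqueFactorizationMonoid.fintypeSubtypeDvd (span {σ • x - x}) h0)
  refine (Set.finite_coe_iff (s := {Q | Q ∣ span {σ • x - x}}).mp this).subset fun Q hQ ↦ ?_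
  rw [Set.mem_ofPred_eq, Ideal.dvd_span_singleton]
  exact hQ.2 x

section Cubic

variable [IsGalois F K] (h3 : Module.finrank F K = 3) {σ : Gal(K/F)} (hσ : σ ≠ 1)

include h3

lemma card_gal_eq_three : Nat.card Gal(K/F) = 3 := by
  rw [IsGalois.card_aut_eq_finrank, h3]

include hσ in
lemma gal_mem_zpowers (g : Gal(K/F)) : g ∈ Subgroup.zpowers σ :=
  have : Fact (Nat.Prime 3) := ⟨Nat.prime_three⟩
  mem_zpowers_of_prime_card (card_gal_eq_three h3) hσ

lemma gal_pow_three : σ ^ 3 = 1 := by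
  rw [← card_gal_eq_three h3]; exact pow_card_eq_one'

include hσ in
lemma gal_eq_or (g : Gal(K/F)) : g = 1 ∨ g = σ ∨ g = σ ^ 2 := by
  obtain ⟨n, rfl⟩ := Subgroup.mem_zpowers_iff.mp (gal_mem_zpowers h3 hσ g)
  rw [← Int.emod_add_mul_ediv n 3, zpow_add, zpow_mul]
  have : σ ^ (3 : ℤ) = 1 := mod_cast gal_pow_three h3
  rw [this, one_zpow, mul_one]
  have h0 := Int.emod_nonneg n (b := 3) (by norm_num)
  have h1 := Int.emod_lt_of_pos n (b := 3) (by norm_num)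
  interval_cases n % 3 <;> simp [zpow_ofNat]

open Pointwise in
lemma smul_eq_of_mem_ramifiedPrimes {Q : Ideal (𝓞 K)} (hQ : Q ∈ ramifiedPrimes σ) :
    σ • Q = Q := by
  have hle : σ • Q ≤ Q := by
    rw [Ideal.pointwise_smul_def, Ideal.map_le_iff_le_comap]
    intro x hx
    have := Q.add_mem (hQ.2 x) hx
    simpa using this
  refine le_antisymm hle ?_
  have hmono : ∀ {I J : Ideal (𝓞 K)}, I ≤ J → σ • I ≤ σ • J := fun h ↦ Ideal.map_mono h
  have h2 := hmono hle
  have h3' := hmono h2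
  have e : σ • σ • σ • Q = Q := by
    rw [← mul_smul, ← mul_smul]
    have := gal_pow_three h3 (σ := σ)
    rw [show σ * σ * σ = σ ^ 3 by simp only [pow_succ, pow_zero, one_mul], this, one_smul]
  rw [e] at h3'
  exact h3'.trans h2

include hσ in
open Pointwise in
lemma inertia_eq_top {Q : Ideal (𝓞 K)} (hQ : Q ∈ ramifiedPrimes σ) :
    Q.inertia Gal(K/F) = ⊤ := by
  have : σ ∈ Q.inertia Gal(K/F) := hQ.2
  rw [eq_top_iff]
  intro g _
  exact (Subgroup.zpowers_le.mpr this) (gal_mem_zpowers h3 hσ g)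

lemma inertia_eq_bot {Q : Ideal (𝓞 K)} (hQ : Prime Q) (hQs : Q ∉ ramifiedPrimes σ) :
    Q.inertia Gal(K/F) = ⊥ := by
  have : Fact (Nat.Prime (Nat.card Gal(K/F))) := ⟨by
    rw [card_gal_eq_three h3]; exact Nat.prime_three⟩
  refine (Subgroup.eq_bot_or_eq_top_of_prime_card (Q.inertia Gal(K/F))).resolve_right fun h ↦ hQs ?_
  exact ⟨hQ, (h ▸ Subgroup.mem_top σ : σ ∈ Q.inertia Gal(K/F))⟩

omit h3 in
lemma ramificationIdx_eq_card_inertia (Q : Ideal (𝓞 K)) [Q.IsPrime] :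
    Q.ramificationIdx (𝓞 F) = Nat.card (Q.inertia Gal(K/F)) := by
  rw [Ideal.card_inertia_eq_ramificationIdxIn (Q.under (𝓞 F)) Q,
    Ideal.ramificationIdxIn_eq_ramificationIdx _ Q Gal(K/F)]

lemma ramificationIdx_eq_one {Q : Ideal (𝓞 K)} (hQ : Prime Q) (hQs : Q ∉ ramifiedPrimes σ) :
    Q.ramificationIdx (𝓞 F) = 1 := by
  have := Ideal.isPrime_of_prime hQ
  rw [ramificationIdx_eq_card_inertia, inertia_eq_bot h3 hQ hQs, Subgroup.card_bot]

include hσ in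
lemma ramificationIdx_eq_three {Q : Ideal (𝓞 K)} (hQ : Q ∈ ramifiedPrimes σ) :
    Q.ramificationIdx (𝓞 F) = 3 := by
  have := Ideal.isPrime_of_prime hQ.1
  rw [ramificationIdx_eq_card_inertia, inertia_eq_top h3 hσ hQ, Subgroup.card_top,
    card_gal_eq_three h3]

end Cubic

/-- The multiplicity of a prime in an extended ideal. -/
lemma multiplicity_map_algebraMap {Q : Ideal (𝓞 K)} (hQ : Prime Q) {p : Ideal (𝓞 F)} (hp : p ≠ ⊥) :
    multiplicity Q (p.map (algebraMap (𝓞 F) (𝓞 K))) =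
      Q.ramificationIdx (𝓞 F) * multiplicity (Q.under (𝓞 F)) p := by
  have := Ideal.isPrime_of_prime hQ
  have hu : Q.under (𝓞 F) ≠ ⊥ := Ideal.under_ne_bot _ hQ.ne_zero
  have hup : Prime (Q.under (𝓞 F)) := Ideal.prime_of_isPrime hu inferInstance
  have h := IsDedekindDomain.emultiplicity_map_eq_ramificationIdx'_mul (S := 𝓞 K) hp
    hup.irreducible hQ.irreducible hQ.ne_zero
  rw [Ideal.ramificationIdx'_eq_ramificationIdx _ _ hu,
    (FiniteMultiplicity.of_prime_left hQ (Ideal.map_ne_bot_of_ne_bot hp)).emultiplicity_eq_multiplicity,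
    (FiniteMultiplicity.of_prime_left hup hp).emultiplicity_eq_multiplicity] at h
  exact_mod_cast h

lemma multiplicity_map_under {Q : Ideal (𝓞 K)} (hQ : Prime Q) :
    multiplicity Q ((Q.under (𝓞 F)).map (algebraMap (𝓞 F) (𝓞 K))) = Q.ramificationIdx (𝓞 F) := by
  have := Ideal.isPrime_of_prime hQ
  have hu : Q.under (𝓞 F) ≠ ⊥ := Ideal.under_ne_bot _ hQ.ne_zero
  have hup : Prime (Q.under (𝓞 F)) := Ideal.prime_of_isPrime hu inferInstance
  rw [multiplicity_map_algebraMap hQ hu, multiplicity_self,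
    mul_one]

end RamifiedPrimes

section Setup

variable {F K : Type} [Field F] [NumberField F] [Field K] [NumberField K] [Algebra F K]
  [IsGalois F K] (h3 : Module.finrank F K = 3) {σ : Gal(K/F)} (hσ : σ ≠ 1)

omit [NumberField F] [NumberField K] [IsGalois F K] in
lemma galRingEquiv_apply (x : 𝓞 K) : galRingEquiv σ x = σ • x := rfl

omit [NumberField F] [NumberField K] [IsGalois F K] in
lemma galRingEquiv_fixes (a : 𝓞 F) :
    galRingEquiv σ (algebraMap (𝓞 F) (𝓞 K) a) = algebraMap (𝓞 F) (𝓞 K) a :=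
  RingOfIntegers.ext (σ.commutes (a : F))

include h3

lemma galRingEquiv_cube (x : 𝓞 K) :
    galRingEquiv σ (galRingEquiv σ (galRingEquiv σ x)) = x := by
  simp only [galRingEquiv_apply, ← mul_smul]
  have := gal_pow_three h3 (σ := σ)
  rw [show σ * (σ * σ) = σ ^ 3 by simp only [pow_succ, pow_zero, one_mul, mul_assoc], this, one_smul]

include hσ

lemma galRingEquiv_fixed (x : 𝓞 K) (hx : galRingEquiv σ x = x) :
    ∃ a : 𝓞 F, algebraMap (𝓞 F) (𝓞 K) a = x := by
  have hx' : σ (x : K) = x := congrArg (algebraMap (𝓞 K) K) hx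
  obtain ⟨a, ha⟩ := (IsGalois.mem_range_algebraMap_iff_fixed (F := F) (x : K)).mpr fun g ↦ by
    rcases gal_eq_or h3 hσ g with rfl | rfl | rfl
    · rfl
    · exact hx'
    · rw [pow_two, AlgEquiv.mul_apply, hx', hx']
  have h_int : IsIntegral ℤ a := by
    rw [← isIntegral_algebraMap_iff (FaithfulSMul.algebraMap_injective F K), ha]
    exact x.isIntegral_coe
  exact ⟨⟨a, h_int⟩, RingOfIntegers.ext ha⟩

lemma algebraMap_norm_eq_of_cubic (x : K) :
    algebraMap F K (Algebra.norm F x) = x * σ x * σ (σ x) := by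
  classical
  rw [Algebra.norm_eq_prod_automorphisms]
  have h2 : σ ^ 2 ≠ 1 := fun h ↦ hσ (by
    have := gal_pow_three h3 (σ := σ)
    rwa [pow_succ, h, one_mul] at this)
  have h21 : σ ^ 2 ≠ σ := fun h ↦ hσ (by rwa [pow_two, mul_eq_left] at h)
  have : (Finset.univ : Finset Gal(K/F)) = {1, σ, σ ^ 2} := by
    ext g
    simpa using gal_eq_or h3 hσ g
  rw [this, Finset.prod_insert (by simp [hσ.symm, h2.symm]), Finset.prod_insert (by simp [h21.symm]),
    Finset.prod_singleton, pow_two]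
  simp [mul_assoc]

lemma galRingEquiv_hilbert90 (a b : 𝓞 K) (ha : a ≠ 0) (hb : b ≠ 0)
    (hab : (galRingEquiv σ).cubicNorm a = (galRingEquiv σ).cubicNorm b) :
    ∃ β ≠ 0, b * galRingEquiv σ β = a * β := by
  have hgen := gal_mem_zpowers h3 hσ
  have : IsCyclic Gal(K/F) := ⟨σ, hgen⟩
  have ha' : (a : K) ≠ 0 := by simpa using ha
  have hb' : (b : K) ≠ 0 := by simpa using hb
  have hnorm : Algebra.norm F ((b : K) / a) = 1 := by
    apply FaithfulSMul.algebraMap_injective F K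
    have h := congrArg (algebraMap (𝓞 K) K) hab
    change (a : K) * σ a * σ (σ a) = b * σ b * σ (σ b) at h
    have hσa : σ (a : K) ≠ 0 := by simpa using ha'
    have hσσa : σ (σ (a : K)) ≠ 0 := by simpa using ha'
    rw [algebraMap_norm_eq_of_cubic h3 hσ, map_one, map_div₀, map_div₀, div_mul_div_comm,
      div_mul_div_comm, h, div_self]
    rw [← h]
    positivity
  obtain ⟨y, hy⟩ := groupCohomology.exists_div_of_norm_eq_one hgen hnorm
  obtain ⟨n, d, hd, hnd⟩ := IsFractionRing.div_surjective (𝓞 K) (y : K)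
  have hd0 : d ≠ 0 := nonZeroDivisors.ne_zero hd
  have hd' : (d : K) ≠ 0 := by simpa using hd0
  have hsd : (galRingEquiv σ d) * galRingEquiv σ (galRingEquiv σ d) ≠ 0 :=
    by
    rw [← map_mul]
    exact (map_ne_zero_iff _ (galRingEquiv σ).injective).mpr (mul_ne_zero hd0
      ((map_ne_zero_iff _ (galRingEquiv σ).injective).mpr hd0))
  have hn0 : n ≠ 0 := fun h ↦ y.ne_zero (by rw [← hnd, h]; simp)
  refine ⟨n * (galRingEquiv σ d * galRingEquiv σ (galRingEquiv σ d)), mul_ne_zero hn0 hsd, ?_⟩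
  have hk : b * (galRingEquiv σ n * d) = a * (n * galRingEquiv σ d) := by
    apply RingOfIntegers.ext
    change (b : K) * (σ n * d) = a * (n * σ d)
    have hy0 : σ (y : K) ≠ 0 := by simp
    have e1 : (y : K) * a = b * σ y := by
      field_simp at hy
      linear_combination hy
    have hσd : σ (d : K) ≠ 0 := by simpa using hd'
    rw [← hnd, map_div₀] at e1
    field_simp at e1
    linear_combination -e1
  have hc := galRingEquiv_cube h3 (σ := σ) d
  rw [map_mul, map_mul, hc]
  linear_combination (galRingEquiv σ (galRingEquiv σ d)) * hk

omit hσ in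
lemma three_dvd_multiplicity (hσ : σ ≠ 1) {Q : Ideal (𝓞 K)} (hQ : Q ∈ ramifiedPrimes σ)
    {p : Ideal (𝓞 F)} (hp : p ≠ ⊥) :
    3 ∣ multiplicity Q (p.map (algebraMap (𝓞 F) (𝓞 K))) := by
  rw [multiplicity_map_algebraMap hQ.1 hp, ramificationIdx_eq_three h3 hσ hQ]
  exact dvd_mul_right _ _

open Pointwise in
lemma multiplicity_smul_eq (I : Ideal (𝓞 K)) (hI : σ • I = I) (g : Gal(K/F)) (Q : Ideal (𝓞 K)) :
    multiplicity (g • Q) I = multiplicity Q I := by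
  have hg : g • I = I := by
    rcases gal_eq_or h3 hσ g with rfl | rfl | rfl
    · simp
    · exact hI
    · rw [pow_two, mul_smul, hI, hI]
  have key : ∀ (g : Gal(K/F)), g • I = I → ∀ (Q : Ideal (𝓞 K)) n, Q ^ n ∣ I → (g • Q) ^ n ∣ I := by
    intro g hg Q n h
    rw [Ideal.dvd_iff_le] at h ⊢
    have h2 : g • I ≤ g • (Q ^ n) := Ideal.map_mono h
    rw [hg] at h2
    refine h2.trans (le_of_eq ?_)
    simp only [Ideal.pointwise_smul_def, Ideal.map_pow]
  have hg' : g⁻¹ • I = I := by rw [inv_smul_eq_iff, hg]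
  apply multiplicity_eq_of_emultiplicity_eq
  rw [emultiplicity_eq_emultiplicity_iff]
  refine fun n ↦ ⟨fun h ↦ ?_, key g hg Q n⟩
  simpa using key g⁻¹ hg' _ n h

open Pointwise in
lemma map_under_dvd {I : Ideal (𝓞 K)} (hI0 : I ≠ 0) (hI : σ • I = I)
    (hS : ∀ Q ∈ ramifiedPrimes σ, 3 ∣ multiplicity Q I) {Q : Ideal (𝓞 K)} (hQ : Prime Q)
    (hQI : Q ∣ I) : (Q.under (𝓞 F)).map (algebraMap (𝓞 F) (𝓞 K)) ∣ I := by
  have hQ' := Ideal.isPrime_of_prime hQ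
  have hu : Q.under (𝓞 F) ≠ ⊥ := Ideal.under_ne_bot _ hQ.ne_zero
  have hm0 : (Q.under (𝓞 F)).map (algebraMap (𝓞 F) (𝓞 K)) ≠ 0 := Ideal.map_ne_bot_of_ne_bot hu
  rw [UniqueFactorizationMonoid.dvd_iff_emultiplicity_le hm0]
  intro P hP
  rw [(FiniteMultiplicity.of_prime_left hP hm0).emultiplicity_eq_multiplicity,
    (FiniteMultiplicity.of_prime_left hP hI0).emultiplicity_eq_multiplicity, Nat.cast_le]
  have hP' := Ideal.isPrime_of_prime hP
  by_cases hPQ : P.under (𝓞 F) = Q.under (𝓞 F)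
  · have : P.LiesOver (Q.under (𝓞 F)) := ⟨hPQ.symm⟩
    obtain ⟨g, rfl⟩ := Ideal.exists_smul_eq_of_isGaloisGroup (Q.under (𝓞 F)) Q P Gal(K/F)
    have h1 : 1 ≤ multiplicity (g • Q) I := by
      rw [multiplicity_smul_eq h3 hσ I hI g Q]
      rwa [← (FiniteMultiplicity.of_prime_left hQ hI0).pow_dvd_iff_le_multiplicity, pow_one]
    rw [← hPQ, multiplicity_map_under hP]
    by_cases hPS : g • Q ∈ ramifiedPrimes σ
    · rw [ramificationIdx_eq_three h3 hσ hPS]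
      exact Nat.le_of_dvd h1 (hS _ hPS)
    · rwa [ramificationIdx_eq_one h3 hP hPS]
  · rw [multiplicity_eq_zero.mpr]
    · exact Nat.zero_le _
    · intro h
      rw [Ideal.dvd_iff_le, Ideal.map_le_iff_le_comap] at h
      have hmax : (Q.under (𝓞 F)).IsMaximal := Ideal.IsPrime.isMaximal inferInstance hu
      exact hPQ (hmax.eq_of_le (Ideal.IsPrime.ne_top inferInstance) h).symm

open Pointwise in
lemma exists_extended [IsPrincipalIdealRing (𝓞 F)] (I : Ideal (𝓞 K)) (hI0 : I ≠ 0)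
    (hI : σ • I = I) (hS : ∀ Q ∈ ramifiedPrimes σ, 3 ∣ multiplicity Q I) :
    ∃ a : 𝓞 F, a ≠ 0 ∧ I = span {algebraMap (𝓞 F) (𝓞 K) a} := by
  induction I using (wellFounded_dvdNotUnit (α := Ideal (𝓞 K))).induction with
  | _ I ih =>
  by_cases hu : IsUnit I
  · refine ⟨1, one_ne_zero, ?_⟩
    rw [map_one, Ideal.span_singleton_one, Ideal.isUnit_iff.mp hu]
  obtain ⟨Q, hQ, hQI⟩ := WfDvdMonoid.exists_irreducible_factor hu hI0
  have hQ := hQ.prime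
  have hQ' := Ideal.isPrime_of_prime hQ
  obtain ⟨J, hJ⟩ := map_under_dvd h3 hσ hI0 hI hS hQ hQI
  obtain ⟨π, hπ⟩ := IsPrincipalIdealRing.principal (Q.under (𝓞 F))
  rw [Ideal.submodule_span_eq] at hπ
  have hQu : Q.under (𝓞 F) ≠ ⊥ := Ideal.under_ne_bot _ hQ.ne_zero
  have hπ0 : π ≠ 0 := by
    rintro rfl
    exact hQu (by rw [hπ]; simp)
  have hm0 : (Q.under (𝓞 F)).map (algebraMap (𝓞 F) (𝓞 K)) ≠ 0 := Ideal.map_ne_bot_of_ne_bot hQu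
  have hJ0 : J ≠ 0 := by rintro rfl; exact hI0 (by rw [hJ, mul_zero])
  have hmap : (Q.under (𝓞 F)).map (algebraMap (𝓞 F) (𝓞 K)) =
      span {algebraMap (𝓞 F) (𝓞 K) π} := by
    rw [hπ, Ideal.map_span, Set.image_singleton]
  have hfix : σ • (Q.under (𝓞 F)).map (algebraMap (𝓞 F) (𝓞 K)) =
      (Q.under (𝓞 F)).map (algebraMap (𝓞 F) (𝓞 K)) := by
    rw [hmap, Ideal.pointwise_smul_def, Ideal.map_span, Set.image_singleton]
    exact congrArg (fun x ↦ span {x}) (galRingEquiv_fixes (σ := σ) π)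
  obtain ⟨a, ha0, ha⟩ := ih J ⟨hJ0, _, fun h ↦ hQ.not_isUnit (isUnit_of_dvd_unit
      (Ideal.dvd_iff_le.mpr (Ideal.map_le_iff_le_comap.mpr le_rfl)) h), by rw [mul_comm, hJ]⟩ hJ0
    (by
      have h2 : σ • I = σ • (Q.under (𝓞 F)).map (algebraMap (𝓞 F) (𝓞 K)) * σ • J := by
        rw [hJ]; simp only [Ideal.pointwise_smul_def, Ideal.map_mul]
      rw [hI, hfix, hJ] at h2
      exact (mul_left_cancel₀ hm0 h2).symm)
    (fun P hP ↦ by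
      have h4 := hS P hP
      rw [hJ, Ideal.multiplicity_mul_of_prime hP.1 hm0 hJ0] at h4
      exact (Nat.dvd_add_right (three_dvd_multiplicity h3 hσ hP hQu)).mp h4)
  refine ⟨π * a, mul_ne_zero hπ0 ha0, ?_⟩
  rw [hJ, hmap, ha, map_mul, Ideal.span_singleton_mul_span_singleton]

theorem isCubicSetup_galRingEquiv [IsPrincipalIdealRing (𝓞 F)] :
    IsCubicSetup (𝓞 F) (galRingEquiv σ) (finite_ramifiedPrimes hσ).toFinset where
  cube := galRingEquiv_cube h3
  fixes := galRingEquiv_fixes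
  fixed := galRingEquiv_fixed h3 hσ
  inj := FaithfulSMul.algebraMap_injective _ _
  hilbert90 := galRingEquiv_hilbert90 h3 hσ
  prime Q hQ := ((Set.Finite.mem_toFinset _).mp hQ).1
  map_eq Q hQ := smul_eq_of_mem_ramifiedPrimes h3 ((Set.Finite.mem_toFinset _).mp hQ)
  extended I hI0 hI hS := exists_extended h3 hσ I hI0 hI fun Q hQ ↦
    hS Q ((Set.Finite.mem_toFinset _).mpr hQ)
  dvd a ha Q hQ := by
    have := three_dvd_multiplicity h3 hσ ((Set.Finite.mem_toFinset _).mp hQ) (p := span {a})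
      (by simpa using ha)
    rwa [Ideal.map_span, Set.image_singleton] at this

end Setup

lemma Group.rank_eq_one_iff_card {G : Type*} [CommGroup G] [Finite G] (h : ∀ x : G, x ^ 3 = 1) :
    Group.rank G = 1 ↔ Nat.card G = 3 := by
  have : Fact (Nat.Prime 3) := ⟨Nat.prime_three⟩
  constructor
  · intro h1
    obtain ⟨S, hS, hS'⟩ := Group.rank_spec G
    rw [h1, Finset.card_eq_one] at hS
    obtain ⟨g, rfl⟩ := hS
    rw [Finset.coe_singleton, ← Subgroup.zpowers_eq_closure] at hS'
    have hcard : Nat.card G = orderOf g := by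
      rw [← Nat.card_zpowers, hS', Subgroup.card_top]
    have hdvd : orderOf g ∣ 3 := orderOf_dvd_of_pow_eq_one (h g)
    rcases (Nat.dvd_prime Nat.prime_three).mp hdvd with h2 | h2
    · have : Subsingleton G := (Nat.card_eq_one_iff_unique.mp (hcard.trans h2)).1
      rw [Group.rank_eq_zero] at h1
      omega
    · rw [hcard, h2]
  · intro h3
    have hnt : Nontrivial G := Finite.one_lt_card_iff_nontrivial.mp (by omega)
    have hcyc : IsCyclic G := isCyclic_of_prime_card h3
    obtain ⟨g, hg⟩ := hcyc.exists_generator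
    have hle : Group.rank G ≤ ({g} : Finset G).card := Group.rank_le (by
      rw [Finset.coe_singleton, ← Subgroup.zpowers_eq_closure, eq_top_iff]
      exact fun x _ ↦ hg x)
    have h0 : Group.rank G ≠ 0 := fun h0 ↦ not_subsingleton G (Group.rank_eq_zero_iff.mp h0)
    rw [Finset.card_singleton] at hle
    omega

namespace IsCubicSetup

variable {A R : Type*} [CommRing A] [CommRing R] [IsDedekindDomain R]
    [Algebra A R] {s : R ≃+* R} {S : Finset (Ideal R)}

lemma multiplicity_map (h : IsCubicSetup A s S) {Q : Ideal R} (hQ : Q ∈ S) (I : Ideal R) :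
    multiplicity Q (I.map s) = multiplicity Q I := by
  apply multiplicity_eq_of_emultiplicity_eq
  rw [emultiplicity_eq_emultiplicity_iff]
  intro n
  have hQn : (Q ^ n).map s = Q ^ n := by
    rw [Ideal.map_pow, h.map_eq Q hQ]
  have hc : (Q ^ n).comap s = Q ^ n := by
    conv_lhs => rw [← hQn]
    exact Ideal.comap_map_of_bijective s s.bijective
  rw [Ideal.dvd_iff_le, Ideal.dvd_iff_le, Ideal.map_le_iff_le_comap, hc]

lemma pow_three_of_isFixedClass (h : IsCubicSetup A s S) {c : ClassGroup R}
    (hc : IsFixedClass s c) : c ^ 3 = 1 := by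
  obtain ⟨I, a, b, ha, hb, hI, hab⟩ := hc
  have hI0 : (I : Ideal R) ≠ 0 := nonZeroDivisors.ne_zero I.2
  set J : (Ideal R)⁰ := ⟨(I : Ideal R).map s, mem_nonZeroDivisors_of_ne_zero (map_ne_zero hI0)⟩
  set J' : (Ideal R)⁰ := ⟨(J : Ideal R).map s,
    mem_nonZeroDivisors_of_ne_zero (map_ne_zero (map_ne_zero hI0))⟩
  have hJ : ClassGroup.mk0 J = c := by
    rw [← hI]
    exact ClassGroup.mk0_eq_mk0_iff.mpr ⟨b, a, hb, ha, hab⟩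
  have hJ' : ClassGroup.mk0 J' = c := by
    rw [← hJ]
    refine ClassGroup.mk0_eq_mk0_iff.mpr ⟨s b, s a, by simpa, by simpa, ?_⟩
    have := congrArg (Ideal.map s) hab
    simpa only [Ideal.map_mul, Ideal.map_span, Set.image_singleton] using this
  have hsss : (J' : Ideal R).map s = I := by
    have hid : ((s : R →+* R).comp (s : R →+* R)).comp (s : R →+* R) = RingHom.id R :=
      RingHom.ext fun x ↦ h.cube x
    change Ideal.map (s : R →+* R) (Ideal.map (s : R →+* R) (Ideal.map (s : R →+* R) I)) = I
    rw [Ideal.map_map, Ideal.map_map, hid, Ideal.map_id]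
  have hmap : (I * J * J' : Ideal R).map s = I * J * J' := by
    rw [Ideal.map_mul, Ideal.map_mul, hsss]
    change (J : Ideal R) * J' * I = _
    ac_rfl
  obtain ⟨x, hx0, hx⟩ := h.extended (I * J * J') (nonZeroDivisors.ne_zero (I * J * J').2) hmap
    (fun Q hQ ↦ by
      have hQp := h.prime Q hQ
      rw [Ideal.multiplicity_mul_of_prime hQp (mul_ne_zero hI0 (nonZeroDivisors.ne_zero J.2))
        (nonZeroDivisors.ne_zero J'.2), Ideal.multiplicity_mul_of_prime hQp hI0
        (nonZeroDivisors.ne_zero J.2)]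
      have e1 : multiplicity Q (J : Ideal R) = multiplicity Q (I : Ideal R) :=
        h.multiplicity_map hQ _
      have e2 : multiplicity Q (J' : Ideal R) = multiplicity Q (J : Ideal R) :=
        h.multiplicity_map hQ _
      rw [e2, e1]
      exact ⟨multiplicity Q (I : Ideal R), by ring⟩)
  have h1 : ClassGroup.mk0 (I * J * J') = 1 := by
    rw [ClassGroup.mk0_eq_one_iff]
    exact ⟨⟨_, hx⟩⟩
  rw [map_mul, map_mul, hI, hJ, hJ'] at h1
  rw [pow_three', h1]

end IsCubicSetup

section Eisenstein

variable {F : Type} [Field F] [NumberField F] [IsCyclotomicExtension {3} ℚ F]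

lemma units_pow_six (u : (𝓞 F)ˣ) : u ^ 6 = 1 := by
  have hζ := IsCyclotomicExtension.zeta_spec 3 ℚ F
  have h := IsCyclotomicExtension.Rat.Three.Units.mem hζ u
  have h3 : (hζ.toInteger_isPrimitiveRoot.isUnit (by norm_num)).unit ^ 3 = 1 :=
    Units.ext (by simpa using hζ.toInteger_cube_eq_one)
  have h6 : (hζ.toInteger_isPrimitiveRoot.isUnit (by norm_num)).unit ^ 6 = 1 := by
    rw [show 6 = 3 * 2 by norm_num, pow_mul, h3, one_pow]
  have h12 : (hζ.toInteger_isPrimitiveRoot.isUnit (by norm_num)).unit ^ 12 = 1 := by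
    rw [show 12 = 3 * 4 by norm_num, pow_mul, h3, one_pow]
  simp only [List.mem_cons, List.not_mem_nil, or_false] at h
  rcases h with rfl | rfl | rfl | rfl | rfl | rfl
  · simp
  · exact (by decide : Even 6).neg_one_pow
  · exact h6
  · rw [(by decide : Even 6).neg_pow, h6]
  · rw [← pow_mul, h12]
  · rw [(by decide : Even 6).neg_pow, ← pow_mul, h12]

lemma torsion_eq_top : Units.torsion F = ⊤ := by
  rw [eq_top_iff]
  intro u _
  exact (CommGroup.mem_torsion _).mpr (isOfFinOrder_iff_pow_eq_one.mpr ⟨6, by norm_num, units_pow_six u⟩)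

lemma card_units : Nat.card (𝓞 F)ˣ = 6 := by
  have h := IsCyclotomicExtension.Rat.torsionOrder_eq (n := 3) (K := F)
  rw [if_neg (by decide)] at h
  rw [← Subgroup.card_top, ← torsion_eq_top]
  exact h

instance finite_units : Finite (𝓞 F)ˣ := Nat.finite_of_card_ne_zero (by rw [card_units]; norm_num)

end Eisenstein

section UnitIndex

variable {F K : Type} [Field F] [NumberField F] [IsCyclotomicExtension {3} ℚ F]
  [Field K] [NumberField K] [Algebra F K] [IsGalois F K] (h3 : Module.finrank F K = 3)
  {σ : Gal(K/F)} (hσ : σ ≠ 1)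

include h3

lemma units_rank_eq_two : Units.rank K = 2 := by
  have hζ := IsCyclotomicExtension.zeta_spec 3 ℚ F
  have hζK := hζ.map_of_injective (FaithfulSMul.algebraMap_injective F K)
  have h0 := NumberField.InfinitePlace.IsPrimitiveRoot.nrRealPlaces_eq_zero_of_two_lt
    (by norm_num) hζK
  have h1 := InfinitePlace.card_add_two_mul_card_eq_rank K
  have h2 := InfinitePlace.card_eq_nrRealPlaces_add_nrComplexPlaces K
  have hF : Module.finrank ℚ F = 2 := by
    rw [IsCyclotomicExtension.finrank (n := 3) F (Polynomial.cyclotomic.irreducible_rat (by norm_num))]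
    rfl
  rw [← Module.finrank_mul_finrank ℚ F K, hF, h3] at h1
  rw [Units.rank]
  omega

include hσ

lemma index_divSelfHom_units :
    (IsCubicSetup.unitsEquiv (galRingEquiv σ)).divSelfHom.range.index =
      3 * Nat.card (𝓞 F)ˣ := by
  have hpid : IsPrincipalIdealRing (𝓞 F) := IsCyclotomicExtension.Rat.three_pid F
  have hset := isCubicSetup_galRingEquiv h3 hσ
  have key := index_range_divSelfHom (IsCubicSetup.unitsEquiv (galRingEquiv σ)) (Units.torsion K)
    (fun x hx ↦ (CommGroup.mem_torsion _).mpr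
      (MonoidHom.isOfFinOrder (IsCubicSetup.unitsEquiv (galRingEquiv σ)).toMonoidHom
        ((CommGroup.mem_torsion _).mp hx)))
    (fun x ↦ by
      obtain ⟨u, hu⟩ := hset.exists_unit_of_fixed
        (x * IsCubicSetup.unitsEquiv (galRingEquiv σ) x *
          IsCubicSetup.unitsEquiv (galRingEquiv σ) (IsCubicSetup.unitsEquiv (galRingEquiv σ) x))
        (hset.cubicNorm_fixed (x : 𝓞 K))
      refine (CommGroup.mem_torsion _).mpr (isOfFinOrder_iff_pow_eq_one.mpr ⟨6, by norm_num, ?_⟩)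
      apply Units.ext
      rw [Units.val_pow_eq_pow_val, ← hu, ← map_pow, ← Units.val_pow_eq_pow_val, units_pow_six]
      simp)
    (fun x hx ↦ by
      have := (CommGroup.mem_torsion _).mp hx
      exact (CommGroup.mem_torsion _).mpr (this.of_pow (by norm_num)))
    (by
      have h := AddSubgroup.index_range_nsmul (M := Additive ((𝓞 K)ˣ ⧸ Units.torsion K)) 3
      rw [Units.finrank_modTorsion, units_rank_eq_two h3] at h
      exact h)
  rw [key]
  congr 1
  refine (Nat.card_congr (Equiv.ofBijective (fun u : (𝓞 F)ˣ ↦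
    (⟨Units.map (algebraMap (𝓞 F) (𝓞 K)) u, ?_⟩ :
      (IsCubicSetup.unitsEquiv (galRingEquiv σ)).divSelfHom.ker)) ⟨?_, ?_⟩)).symm
  · rw [MonoidHom.mem_ker, MulEquiv.divSelfHom_apply, div_eq_one]
    exact Units.ext (galRingEquiv_fixes (σ := σ) (u : 𝓞 F))
  · intro u v huv
    have := congrArg (fun x ↦ ((x.1 : (𝓞 K)ˣ) : 𝓞 K)) huv
    exact Units.ext (hset.inj this)
  · rintro ⟨x, hx⟩
    rw [MonoidHom.mem_ker, MulEquiv.divSelfHom_apply, div_eq_one] at hx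
    obtain ⟨u, hu⟩ := hset.exists_unit_of_fixed x (congrArg Units.val hx)
    exact ⟨u, Subtype.ext (Units.ext hu)⟩

omit hσ in
theorem card_fixedClass_galois (hσ : σ ≠ 1) :
    Nat.card {c // IsCubicSetup.IsFixedClass (galRingEquiv σ) c} * 18 =
      Nat.card {u : (𝓞 F)ˣ // IsCubicSetup.IsNormUnit (galRingEquiv σ) u} *
        3 ^ (ramifiedPrimes σ).ncard := by
  have hpid : IsPrincipalIdealRing (𝓞 F) := IsCyclotomicExtension.Rat.three_pid F
  have h := (isCubicSetup_galRingEquiv h3 hσ).card_fixedClass (index_divSelfHom_units h3 hσ)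
  rwa [card_units, ← Set.ncard_eq_toFinset_card _ (finite_ramifiedPrimes hσ)] at h

end UnitIndex

section NormUnits

variable {F K : Type} [Field F] [NumberField F] [IsCyclotomicExtension {3} ℚ F]
  [Field K] [NumberField K] [Algebra F K] {σ : Gal(K/F)} {ζ : F} (hζ : IsPrimitiveRoot ζ 3)

/-- The unit of `𝓞 F` given by a primitive cube root of unity. -/
def etaUnit : (𝓞 F)ˣ := (hζ.toInteger_isPrimitiveRoot.isUnit (by norm_num)).unit

omit [NumberField F] [IsCyclotomicExtension {3} ℚ F] in
lemma etaUnit_pow_three : etaUnit hζ ^ 3 = 1 :=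
  Units.ext (by simpa [etaUnit] using hζ.toInteger_cube_eq_one)

omit [NumberField F] [IsCyclotomicExtension {3} ℚ F] in
lemma coe_etaUnit : (((etaUnit hζ : (𝓞 F)ˣ) : 𝓞 F) : F) = ζ := rfl

lemma units_eq_or (u : (𝓞 F)ˣ) : u = 1 ∨ u = -1 ∨ u = etaUnit hζ ∨ u = -etaUnit hζ ∨
    u = etaUnit hζ ^ 2 ∨ u = -etaUnit hζ ^ 2 := by
  have h := IsCyclotomicExtension.Rat.Three.Units.mem hζ u
  simp only [List.mem_cons, List.not_mem_nil, or_false] at h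
  exact h

omit [NumberField F] [IsCyclotomicExtension {3} ℚ F] [NumberField K] in
lemma isNormUnit_mul {u v : (𝓞 F)ˣ} (hu : IsCubicSetup.IsNormUnit (galRingEquiv σ) u)
    (hv : IsCubicSetup.IsNormUnit (galRingEquiv σ) v) :
    IsCubicSetup.IsNormUnit (galRingEquiv σ) (u * v) := by
  obtain ⟨a, b, ha, hb, h⟩ := hu
  obtain ⟨a', b', ha', hb', h'⟩ := hv
  refine ⟨a * a', b * b', mul_ne_zero ha ha', mul_ne_zero hb hb', ?_⟩
  rw [map_mul, map_mul, ← h, ← h', Units.val_mul, map_mul]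
  ring

omit [NumberField F] [IsCyclotomicExtension {3} ℚ F] [NumberField K] in
lemma isNormUnit_one : IsCubicSetup.IsNormUnit (galRingEquiv σ) (1 : (𝓞 F)ˣ) :=
  ⟨1, 1, one_ne_zero, one_ne_zero, by simp⟩

omit [NumberField F] [IsCyclotomicExtension {3} ℚ F] [NumberField K] in
lemma isNormUnit_neg_one : IsCubicSetup.IsNormUnit (galRingEquiv σ) (-1 : (𝓞 F)ˣ) :=
  ⟨-1, 1, by simp, one_ne_zero, by simp [RingEquiv.cubicNorm_apply]⟩

omit [NumberField F] [IsCyclotomicExtension {3} ℚ F] [NumberField K] in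
lemma isNormUnit_neg {u : (𝓞 F)ˣ} (hu : IsCubicSetup.IsNormUnit (galRingEquiv σ) u) :
    IsCubicSetup.IsNormUnit (galRingEquiv σ) (-u) := by
  rw [← neg_one_mul]; exact isNormUnit_mul isNormUnit_neg_one hu

omit [NumberField K] in
lemma card_normUnit_of_isNormUnit
    (h : IsCubicSetup.IsNormUnit (galRingEquiv σ) (etaUnit hζ)) :
    Nat.card {u : (𝓞 F)ˣ // IsCubicSetup.IsNormUnit (galRingEquiv σ) u} = 6 := by
  have hall : ∀ u : (𝓞 F)ˣ, IsCubicSetup.IsNormUnit (galRingEquiv σ) u := by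
    intro u
    have h2 := isNormUnit_mul h h
    rw [← pow_two] at h2
    rcases units_eq_or hζ u with rfl | rfl | rfl | rfl | rfl | rfl
    exacts [isNormUnit_one, isNormUnit_neg_one, h, isNormUnit_neg h, h2, isNormUnit_neg h2]
  rw [← card_units (F := F)]
  exact Nat.card_congr (Equiv.subtypeUnivEquiv hall)

omit [NumberField K] in
lemma card_normUnit_of_not_isNormUnit
    (h : ¬ IsCubicSetup.IsNormUnit (galRingEquiv σ) (etaUnit hζ)) :
    Nat.card {u : (𝓞 F)ˣ // IsCubicSetup.IsNormUnit (galRingEquiv σ) u} = 2 := by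
  have h2 : ¬ IsCubicSetup.IsNormUnit (galRingEquiv σ) (etaUnit hζ ^ 2) := fun h' ↦ h (by
    have := isNormUnit_mul h' h'
    rwa [← pow_add, show 2 + 2 = 3 + 1 by rfl, pow_succ, etaUnit_pow_three, one_mul] at this)
  have hset : {u : (𝓞 F)ˣ | IsCubicSetup.IsNormUnit (galRingEquiv σ) u} = {1, -1} := by
    ext u
    constructor
    · intro hu
      rcases units_eq_or hζ u with rfl | rfl | rfl | rfl | rfl | rfl
      · simp
      · simp
      · exact absurd hu h
      · exact absurd (by simpa using isNormUnit_neg hu) h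
      · exact absurd hu h2
      · exact absurd (by simpa using isNormUnit_neg hu) h2
    · rintro (rfl | rfl)
      exacts [isNormUnit_one, isNormUnit_neg_one]
  have hne : (1 : (𝓞 F)ˣ) ≠ -1 := fun h ↦ by
    have h1 := congrArg (fun u : (𝓞 F)ˣ ↦ ((u : 𝓞 F) : F)) h
    simp only [Units.val_one, Units.val_neg, map_one, map_neg] at h1
    exact absurd h1 (by norm_num)
  rw [← Set.ncard_pair hne, ← hset]
  rfl

theorem card_fixedClass_eq_three_iff [IsGalois F K] (h3 : Module.finrank F K = 3) (hσ : σ ≠ 1) :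
    Nat.card {c // IsCubicSetup.IsFixedClass (galRingEquiv σ) c} = 3 ↔
      ((ramifiedPrimes σ).ncard = 2 ∧ IsCubicSetup.IsNormUnit (galRingEquiv σ) (etaUnit hζ)) ∨
      ((ramifiedPrimes σ).ncard = 3 ∧ ¬ IsCubicSetup.IsNormUnit (galRingEquiv σ) (etaUnit hζ)) := by
  have h := card_fixedClass_galois h3 hσ
  generalize Nat.card {c // IsCubicSetup.IsFixedClass (galRingEquiv σ) c} = c at h ⊢
  generalize (ramifiedPrimes σ).ncard = t at h ⊢
  have hinj : ∀ a b, 3 ^ a = 3 ^ b → a = b := fun a b h ↦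
    Nat.pow_right_injective (by norm_num) h
  by_cases hN : IsCubicSetup.IsNormUnit (galRingEquiv σ) (etaUnit hζ)
  · rw [card_normUnit_of_isNormUnit hζ hN] at h
    simp only [hN, not_true_eq_false, and_true, and_false, or_false]
    constructor
    · rintro rfl
      exact hinj t 2 (by omega)
    · rintro rfl
      omega
  · rw [card_normUnit_of_not_isNormUnit hζ hN] at h
    simp only [hN, not_false_eq_true, and_true, and_false, false_or]
    constructor
    · rintro rfl
      exact hinj t 3 (by omega)
    · rintro rfl
      omega

end NormUnits

section Kummer

variable {F K : Type} [Field F] [NumberField F] [IsCyclotomicExtension {3} ℚ F]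
  [Field K] [NumberField K] [Algebra F K] [IsGalois F K] {σ : Gal(K/F)}

omit [NumberField F] [IsCyclotomicExtension {3} ℚ F] [Algebra F K] [IsGalois F K] in
lemma natCast_mem_iff {R : Type*} [CommRing R] {Q : Ideal R} [Q.IsPrime] {p : ℕ}
    (hp : p.Prime) (hpQ : (p : R) ∈ Q) (n : ℕ) : (n : R) ∈ Q ↔ p ∣ n := by
  constructor
  · intro hn
    by_contra hpn
    have hcop : IsCoprime (p : ℤ) (n : ℤ) :=
      Nat.isCoprime_iff_coprime.mpr ((Nat.Prime.coprime_iff_not_dvd hp).mpr hpn)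
    obtain ⟨a, b, hab⟩ := hcop
    apply Ideal.IsPrime.ne_top (I := Q) inferInstance
    rw [Ideal.eq_top_iff_one]
    have h1 : ((a * p + b * n : ℤ) : R) = 1 := by rw [hab]; simp
    rw [← h1]
    push_cast
    exact Q.add_mem (Q.mul_mem_left _ hpQ) (Q.mul_mem_left _ hn)
  · rintro ⟨m, rfl⟩
    rw [Nat.cast_mul]
    exact Q.mul_mem_right _ hpQ

lemma natCast_notMem_pow_three {q : Ideal (𝓞 F)} [q.IsPrime] {p : ℕ}
    (hp : p.Prime) : (p : 𝓞 F) ∉ q ^ 3 := by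
  intro h
  have hdvd : q ^ 3 ∣ span {(p : 𝓞 F)} := (Ideal.dvd_span_singleton).mpr h
  have hF : Module.finrank ℤ (𝓞 F) = 2 := by
    rw [RingOfIntegers.rank, IsCyclotomicExtension.finrank (n := 3) F
      (Polynomial.cyclotomic.irreducible_rat (by norm_num))]
    rfl
  have hN := map_dvd Ideal.absNorm hdvd
  have hNp : Ideal.absNorm (span {(p : 𝓞 F)}) = p ^ 2 := by
    have := Ideal.absNorm_span_singleton (p : 𝓞 F)
    rw [this, show (p : 𝓞 F) = algebraMap ℤ (𝓞 F) (p : ℤ) by simp, Algebra.norm_algebraMap, hF]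
    simp [Int.natAbs_pow]
  rw [map_pow, hNp] at hN
  have h1 : Ideal.absNorm q ∣ p ^ 2 := (dvd_pow_self _ (by norm_num)).trans hN
  obtain ⟨k, hk, hk'⟩ := (Nat.dvd_prime_pow hp).mp h1
  have hk0 : k ≠ 0 := by
    rintro rfl
    rw [pow_zero, Ideal.absNorm_eq_one_iff] at hk'
    exact Ideal.IsPrime.ne_top inferInstance hk'
  rw [hk', ← pow_mul, Nat.pow_dvd_pow_iff_le_right hp.one_lt] at hN
  omega

variable {d : ℕ} {θ : 𝓞 K} (hθ : θ ^ 3 = d) {η : 𝓞 F} (hη : η ^ 2 + η + 1 = 0)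
  (hσθ : σ • θ = algebraMap (𝓞 F) (𝓞 K) η * θ)

/-- `p` is one of the rational primes below the ramified primes of `K / F`. -/
def IsRamifiedBelow (d p : ℕ) : Prop := p ∣ d ∨ (p = 3 ∧ ¬ (d % 9 = 1 ∨ d % 9 = 8))

include hη in
omit [NumberField F] [IsCyclotomicExtension {3} ℚ F] [IsGalois F K] [NumberField K] in
lemma algebraMap_eta_eq :
    (algebraMap (𝓞 F) (𝓞 K) η) ^ 2 + algebraMap (𝓞 F) (𝓞 K) η + 1 = 0 := by
  rw [← map_pow, ← map_add, ← map_one (algebraMap (𝓞 F) (𝓞 K)), ← map_add, hη, map_zero]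

lemma exists_kummer_integer {K : Type*} [Field K] [NumberField K] {d : ℕ} {θ z : 𝓞 K}
    (hθ : θ ^ 3 = d) (hz : z ^ 2 + z + 1 = 0) {ε : ℤ} (hε : ε = 1 ∨ ε = -1)
    (hd : (9 : ℤ) ∣ d - ε) : ∃ y : 𝓞 K, (z - 1) * y = θ - ε := by
  obtain ⟨m, hm⟩ := hd
  have hz1 : z - 1 ≠ 0 := by
    intro h
    have : z = 1 := by linear_combination h
    rw [this] at hz
    norm_num at hz
  have hzK : (z : K) ^ 2 + z + 1 = 0 := congrArg (algebraMap (𝓞 K) K) hz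
  have hθK : (θ : K) ^ 3 = d := by
    have := congrArg (algebraMap (𝓞 K) K) hθ
    simpa using this
  have hz1K : (z : K) - 1 ≠ 0 := fun h ↦ hz1 (RingOfIntegers.ext (by simpa using h))
  have hmK : (d : K) - ε = 9 * m := by exact_mod_cast congrArg (Int.cast : ℤ → K) hm
  have h_int : IsIntegral (𝓞 K) (((θ : K) - ε) / (z - 1)) := by
    refine ⟨Polynomial.X ^ 3 + Polynomial.C (-z ^ 2 * (z - 1) * ε) * Polynomial.X ^ 2 +
      Polynomial.C (-z ^ 2) * Polynomial.X + Polynomial.C (-m * z * (z - 1)), by monicity!, ?_⟩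
    simp only [Polynomial.eval₂_add, Polynomial.eval₂_mul, Polynomial.eval₂_pow,
      Polynomial.eval₂_X, Polynomial.eval₂_C]
    simp only [map_mul, map_neg, map_pow, map_sub, map_one, map_intCast]
    have hε2 : (ε : K) ^ 2 = 1 := by rcases hε with rfl | rfl <;> norm_num
    set y := ((θ : K) - ε) / (z - 1) with hy
    have hy' : (θ : K) = (z - 1) * y + ε := by rw [hy]; field_simp; ring
    rw [hy'] at hθK
    have h3 : ((z : K) - 1) ^ 3 * (y ^ 3 + -z ^ 2 * (z - 1) * ε * y ^ 2 + -z ^ 2 * y +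
        -m * z * (z - 1)) = 0 := by
      have hl : ((z : K) - 1) ^ 2 = -3 * z := by linear_combination hzK
      have hz3 : (z : K) ^ 3 = 1 := by linear_combination (z - 1 : K) * hzK
      have e1 : ((z : K) - 1) ^ 3 * (-z ^ 2 * (z - 1) * ε * y ^ 2) =
          3 * (z - 1) ^ 2 * ε * y ^ 2 := by
        linear_combination (-z ^ 2 * ε * y ^ 2 * (z - 1) ^ 2) * hl +
          (3 * (z - 1) ^ 2 * ε * y ^ 2) * hz3
      have e2 : ((z : K) - 1) ^ 3 * (-z ^ 2 * y) = 3 * (z - 1) * y := by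
        linear_combination (-z ^ 2 * y * (z - 1)) * hl + (3 * (z - 1) * y) * hz3
      have e3 : ((z : K) - 1) ^ 3 * (-m * z * (z - 1)) = - (9 * m) := by
        linear_combination (-m * z * ((z - 1) ^ 2 - 3 * z)) * hl - 9 * m * hz3
      have hε3 : (ε : K) ^ 3 = ε := by linear_combination (ε : K) * hε2
      linear_combination e1 + e2 + e3 + hθK + hmK - hε3 - 3 * (z - 1) * y * hε2
    exact (mul_eq_zero.mp h3).resolve_left (pow_ne_zero 3 hz1K)
  obtain ⟨y, hy⟩ := IsIntegrallyClosed.isIntegral_iff.mp h_int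
  refine ⟨y, RingOfIntegers.ext ?_⟩
  simp only [map_mul, map_sub, map_one, map_intCast]
  rw [hy]
  exact mul_div_cancel₀ _ hz1K

include hθ hη hσθ in
omit [NumberField F] [IsCyclotomicExtension {3} ℚ F] [IsGalois F K] in
lemma isRamifiedBelow_of_mem {Q : Ideal (𝓞 K)} (hQ : Q ∈ ramifiedPrimes σ) {p : ℕ} (hp : p.Prime)
    (hpQ : (p : 𝓞 K) ∈ Q) : IsRamifiedBelow d p := by
  have := Ideal.isPrime_of_prime hQ.1
  set z := algebraMap (𝓞 F) (𝓞 K) η with hz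
  have hz0 : z ^ 2 + z + 1 = 0 := algebraMap_eta_eq hη
  have hzσ : σ • z = z := galRingEquiv_fixes (σ := σ) η
  have hθd : θ ∈ Q → p ∣ d := fun h ↦ by
    rw [← natCast_mem_iff hp hpQ, ← hθ]
    exact Q.pow_mem_of_mem h 3 (by norm_num)
  by_cases hpd : p ∣ d
  · exact Or.inl hpd
  have hθQ : θ ∉ Q := fun h ↦ hpd (hθd h)
  have h1 : (z - 1) * θ ∈ Q := by
    have := hQ.2 θ
    rwa [hσθ, show z * θ - θ = (z - 1) * θ by ring] at this
  have hzQ : z - 1 ∈ Q := (Ideal.IsPrime.mem_or_mem inferInstance h1).resolve_right hθQ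
  have h3Q : ((3 : ℕ) : 𝓞 K) ∈ Q := by
    have : ((3 : ℕ) : 𝓞 K) = -z ^ 2 * (z - 1) * (z - 1) := by
      push_cast
      linear_combination (z ^ 2 - 3 * z + 3) * hz0
    rw [this]
    exact Q.mul_mem_left _ hzQ
  have hp3 : p = 3 := (Nat.prime_dvd_prime_iff_eq hp Nat.prime_three).mp
    ((natCast_mem_iff hp hpQ 3).mp h3Q)
  refine Or.inr ⟨hp3, fun hd ↦ ?_⟩
  obtain ⟨ε, hε, hdε⟩ : ∃ ε : ℤ, (ε = 1 ∨ ε = -1) ∧ (9 : ℤ) ∣ d - ε := by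
    rcases hd with hd | hd
    · exact ⟨1, Or.inl rfl, by omega⟩
    · exact ⟨-1, Or.inr rfl, by omega⟩
  obtain ⟨y, hy⟩ := exists_kummer_integer hθ hz0 hε hdε
  have hz1 : z - 1 ≠ 0 := by
    intro h
    have : z = 1 := by linear_combination h
    rw [this] at hz0
    norm_num at hz0
  have hσy : (z - 1) * (σ • y) = z * θ - ε := by
    have := congrArg (galRingEquiv σ) hy
    rw [map_mul, map_sub, map_sub, map_one, map_intCast] at this
    change (σ • z - 1) * (σ • y) = σ • θ - ε at this
    rwa [hzσ, hσθ] at this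
  have : σ • y - y = θ := by
    apply mul_left_cancel₀ hz1
    linear_combination hσy - hy
  exact hθQ (this ▸ hQ.2 y)

end Kummer

section KummerConverse

variable {F K : Type} [Field F] [NumberField F] [IsCyclotomicExtension {3} ℚ F]
  [Field K] [NumberField K] [Algebra F K] [IsGalois F K] {σ : Gal(K/F)}

variable (h3 : Module.finrank F K = 3)

include h3 in
lemma natCast_notMem_pow_three_of_notMem_ramifiedPrimes {Q : Ideal (𝓞 K)} (hQ : Prime Q)
    (hQs : Q ∉ ramifiedPrimes σ) {p : ℕ} (hp : p.Prime) : (p : 𝓞 K) ∉ Q ^ 3 := by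
  have := Ideal.isPrime_of_prime hQ
  intro h
  have hp0 : span {(p : 𝓞 F)} ≠ ⊥ := by simpa using hp.ne_zero
  have hmap : (span {(p : 𝓞 F)}).map (algebraMap (𝓞 F) (𝓞 K)) = span {(p : 𝓞 K)} := by
    rw [Ideal.map_span, Set.image_singleton, map_natCast]
  have hm := multiplicity_map_algebraMap (F := F) hQ hp0
  rw [ramificationIdx_eq_one h3 hQ hQs, one_mul, hmap] at hm
  have hpK : span {(p : 𝓞 K)} ≠ 0 := by simpa using hp.ne_zero
  have hfin : FiniteMultiplicity Q (span {(p : 𝓞 K)}) := FiniteMultiplicity.of_prime_left hQ hpK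
  have h3le : 3 ≤ multiplicity Q (span {(p : 𝓞 K)}) :=
    hfin.le_multiplicity_of_pow_dvd (Ideal.dvd_span_singleton.mpr h)
  rw [hm] at h3le
  exact natCast_notMem_pow_three (q := Q.under (𝓞 F)) hp
    (Ideal.dvd_span_singleton.mp (pow_dvd_of_le_multiplicity h3le))

variable {d : ℕ} {θ : 𝓞 K} (hθ : θ ^ 3 = d) {η : 𝓞 F} (hη : η ^ 2 + η + 1 = 0)

include h3 hθ hη in
lemma mem_ramifiedPrimes_of_isRamifiedBelow (hdcf : ∀ p : ℕ, p.Prime → ¬ p ^ 3 ∣ d)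
    {Q : Ideal (𝓞 K)} (hQ : Prime Q) {p : ℕ} (hp : p.Prime)
    (hpQ : (p : 𝓞 K) ∈ Q) (hpd : IsRamifiedBelow d p) : Q ∈ ramifiedPrimes σ := by
  by_contra hQs
  have hprime := Ideal.isPrime_of_prime hQ
  have hp3 := natCast_notMem_pow_three_of_notMem_ramifiedPrimes h3 hQ hQs hp
  rcases (Classical.em (p ∣ d)) with hpd' | hpd'
  · have hd0 : d ≠ 0 := by
      rintro rfl
      exact hdcf p hp (dvd_zero _)
    obtain ⟨a, d', hd', rfl⟩ := Nat.exists_eq_pow_mul_and_not_dvd hd0 p hp.ne_one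
    have ha3 : a < 3 := by
      by_contra! h
      exact hdcf p hp ((pow_dvd_pow p h).trans (dvd_mul_right _ _))
    have ha0 : a ≠ 0 := by
      rintro rfl
      exact hd' (by simpa using hpd')
    have hd'0 : d' ≠ 0 := fun h ↦ hd0 (by simp [h])
    have hpK : span {(p : 𝓞 K)} ≠ 0 := by simpa using hp.ne_zero
    have hdK : span {(d' : 𝓞 K)} ≠ 0 := by simpa using hd'0
    have hθ0 : span {θ} ≠ 0 := by
      intro h
      rw [Ideal.zero_eq_bot, span_singleton_eq_bot] at h
      rw [h, zero_pow three_ne_zero] at hθ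
      exact hd0 (Nat.cast_eq_zero.mp hθ.symm)
    have hid : span {θ} ^ 3 = span {(p : 𝓞 K)} ^ a * span {(d' : 𝓞 K)} := by
      rw [span_singleton_pow, hθ, span_singleton_pow, span_singleton_mul_span_singleton]
      push_cast
      rfl
    have hmd : multiplicity Q (span {(d' : 𝓞 K)}) = 0 := by
      refine multiplicity_eq_zero.mpr ?_
      rwa [Ideal.dvd_span_singleton, natCast_mem_iff hp hpQ]
    have hm := congrArg (multiplicity Q) hid
    rw [FiniteMultiplicity.multiplicity_pow hQ (FiniteMultiplicity.of_prime_left hQ hθ0),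
      Ideal.multiplicity_mul_of_prime hQ (pow_ne_zero _ hpK) hdK,
      FiniteMultiplicity.multiplicity_pow hQ (FiniteMultiplicity.of_prime_left hQ hpK), hmd]
      at hm
    have hfin : FiniteMultiplicity Q (span {(p : 𝓞 K)}) := FiniteMultiplicity.of_prime_left hQ hpK
    have hlt : multiplicity Q (span {(p : 𝓞 K)}) < 3 := by
      by_contra! h
      exact hp3 (Ideal.dvd_span_singleton.mp (pow_dvd_of_le_multiplicity h))
    have hpos : 1 ≤ multiplicity Q (span {(p : 𝓞 K)}) :=
      hfin.le_multiplicity_of_pow_dvd (by rwa [pow_one, Ideal.dvd_span_singleton])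
    interval_cases a <;> omega
  · obtain ⟨rfl, hd⟩ := hpd.resolve_left hpd'
    set z := algebraMap (𝓞 F) (𝓞 K) η with hz
    have hz0 : z ^ 2 + z + 1 = 0 := algebraMap_eta_eq hη
    obtain ⟨ε, m, hε, hdm, hm⟩ : ∃ ε m : ℤ, (ε = 1 ∨ ε = -1) ∧ d - ε = 3 * m ∧ ¬ 3 ∣ m := by
      rcases (by omega : d % 3 = 1 ∨ d % 3 = 2) with h | h
      · exact ⟨1, (d - 1) / 3, Or.inl rfl, by omega, by omega⟩
      · exact ⟨-1, (d + 1) / 3, Or.inr rfl, by omega, by omega⟩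
    have h3Q : (3 : 𝓞 K) ∈ Q := by exact_mod_cast hpQ
    have hzQ : z - 1 ∈ Q := by
      refine hprime.mem_of_pow_mem 2 ?_
      rw [show (z - 1) ^ 2 = -z * 3 by linear_combination hz0]
      exact Q.mul_mem_left _ h3Q
    have hdm' : (d : 𝓞 K) - ε = 3 * m := by
      exact_mod_cast congrArg (Int.cast : ℤ → 𝓞 K) hdm
    have hε3 : (ε : 𝓞 K) ^ 3 = ε := by rcases hε with rfl | rfl <;> norm_num
    have hθQ : θ - ε ∈ Q := by
      refine hprime.mem_of_pow_mem 3 ?_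
      rw [show (θ - ε) ^ 3 = (m - θ ^ 2 * ε + θ * ε ^ 2) * 3 by
        linear_combination hθ - hε3 + hdm']
      exact Q.mul_mem_left _ h3Q
    have hz1 : z * θ - ε ∈ Q := by
      rw [show z * θ - ε = θ * (z - 1) + (θ - ε) by ring]
      exact Q.add_mem (Q.mul_mem_left _ hzQ) hθQ
    have hz2 : z ^ 2 * θ - ε ∈ Q := by
      rw [show z ^ 2 * θ - ε = θ * z * (z - 1) + (z * θ - ε) by ring]
      exact Q.add_mem (Q.mul_mem_left _ hzQ) hz1
    have hprod : (3 * m : 𝓞 K) ∈ Q ^ 3 := by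
      rw [show (3 * m : 𝓞 K) = (θ - ε) * (z * θ - ε) * (z ^ 2 * θ - ε) by
        linear_combination (-1 : 𝓞 K) * hdm' - hθ + hε3 - ((z - 1) * θ ^ 3 - z * θ ^ 2 * ε +
          θ * ε ^ 2) * hz0, pow_succ, pow_two]
      exact Ideal.mul_mem_mul (Ideal.mul_mem_mul hθQ hz1) hz2
    have h81 : (81 : 𝓞 K) ∈ Q ^ 3 := by
      refine Ideal.pow_le_pow_right (show 3 ≤ 4 by norm_num) ?_
      rw [show (81 : 𝓞 K) = 3 ^ 4 by norm_num]
      exact Ideal.pow_mem_pow h3Q 4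
    have hcop : IsCoprime m (27 : ℤ) := by
      rw [show (27 : ℤ) = 3 ^ 3 by norm_num]
      refine IsCoprime.pow_right ?_
      exact ((Int.prime_three.irreducible.coprime_iff_not_dvd).mpr hm).symm
    obtain ⟨u, v, huv⟩ := hcop
    have huv' : (u * m + v * 27 : 𝓞 K) = 1 := by exact_mod_cast congrArg (Int.cast : ℤ → 𝓞 K) huv
    refine hp3 ?_
    rw [show ((3 : ℕ) : 𝓞 K) = u * (3 * m) + v * 81 by push_cast; linear_combination -3 * huv']
    exact add_mem (Ideal.mul_mem_left _ _ hprod) (Ideal.mul_mem_left _ _ h81)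

end KummerConverse

section PrimesOver

variable {N : Type*} [Field N]

lemma liesOver_span_natCast_iff {Q : Ideal (𝓞 N)} [hQ : Q.IsPrime] {p : ℕ} (hp : p.Prime) :
    Q.LiesOver (span {(p : ℤ)}) ↔ (p : 𝓞 N) ∈ Q := by
  have hmem : (p : ℤ) ∈ Q.under ℤ ↔ (p : 𝓞 N) ∈ Q := by
    rw [Ideal.under_def, Ideal.mem_comap]; simp
  constructor
  · intro h
    rw [← hmem, ← h.over]
    exact Ideal.mem_span_singleton_self _
  · intro h
    have hmax : (span {(p : ℤ)}).IsMaximal :=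
      PrincipalIdealRing.isMaximal_of_irreducible (Nat.prime_iff_prime_int.mp hp).irreducible
    refine ⟨hmax.eq_of_le (Ideal.IsPrime.ne_top inferInstance) ?_⟩
    rw [Ideal.span_singleton_le_iff_mem]
    exact hmem.mpr h

lemma exists_prime_natCast_mem {Q : Ideal (𝓞 N)} [Q.IsPrime] (hQ : Q ≠ ⊥) :
    ∃ p : ℕ, p.Prime ∧ (p : 𝓞 N) ∈ Q := by
  have : NeZero Q := ⟨hQ⟩
  refine ⟨_, Nat.absNorm_under_prime Q, ?_⟩
  exact_mod_cast Int.absNorm_under_mem Q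

end PrimesOver

section Eisenstein

variable {F : Type} [Field F] [NumberField F] [IsCyclotomicExtension {3} ℚ F]

lemma ncard_primesOver_eisenstein {p : ℕ} (hp : p.Prime) :
    (primesOver (span {(p : ℤ)}) (𝓞 F)).ncard = if p % 3 = 1 then 2 else 1 := by
  have := Fact.mk hp
  rcases eq_or_ne p 3 with rfl | hp3
  · rw [if_neg (by norm_num)]
    exact IsCyclotomicExtension.Rat.ncard_primesOver_of_prime 3 F
  have h3 : ¬ p ∣ 3 := fun h ↦ hp3 ((Nat.prime_dvd_prime_iff_eq hp Nat.prime_three).mp h)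
  have hG : IsGalois ℚ F := IsCyclotomicExtension.isGalois {3} ℚ F
  have hmax : (span {(p : ℤ)}).IsMaximal :=
    PrincipalIdealRing.isMaximal_of_irreducible (Nat.prime_iff_prime_int.mp hp).irreducible
  have h0 : span {(p : ℤ)} ≠ ⊥ := by simpa using hp.ne_zero
  have hF : Module.finrank ℚ F = 2 := by
    rw [IsCyclotomicExtension.finrank (n := 3) F
      (Polynomial.cyclotomic.irreducible_rat (by norm_num))]
    rfl
  have key := ncard_primesOver_mul_ramificationIdxIn_mul_inertiaDegIn (span {(p : ℤ)}) (𝓞 F)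
    Gal(F/ℚ)
  rw [IsCyclotomicExtension.Rat.ramificationIdxIn_eq_of_not_dvd (m := 3) (p := p) (K := F) h3,
    IsCyclotomicExtension.Rat.inertiaDegIn_eq_of_not_dvd (m := 3) (p := p) (K := F) h3, one_mul,
    IsGalois.card_aut_eq_finrank, hF] at key
  have h30 : p % 3 ≠ 0 := fun h ↦ hp3
    ((Nat.prime_dvd_prime_iff_eq Nat.prime_three hp).mp (Nat.dvd_of_mod_eq_zero h)).symm
  rcases (by omega : p % 3 = 1 ∨ p % 3 = 2) with h | h
  · have hc : (p : ZMod 3) = 1 := by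
      rw [← ZMod.natCast_mod, h, Nat.cast_one]
    rw [if_pos h]
    rwa [hc, orderOf_one, mul_one] at key
  · have hc : (p : ZMod 3) = -1 := by
      rw [← ZMod.natCast_mod, h]; rfl
    rw [if_neg (by omega)]
    have ho : orderOf (-1 : ZMod 3) = 2 := orderOf_eq_prime (by decide) (by decide)
    rw [hc, ho] at key
    omega

end Eisenstein

/-- The rational primes below the ramified primes of `ℚ(∛d, ζ₃) / ℚ(ζ₃)`. -/
def primesBelow (d : ℕ) : Finset ℕ :=
  d.primeFactors ∪ if d % 9 = 1 ∨ d % 9 = 8 then ∅ else {3}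

lemma mem_primesBelow {d p : ℕ} (hd : d ≠ 0) :
    p ∈ primesBelow d ↔ p.Prime ∧ IsRamifiedBelow d p := by
  unfold primesBelow IsRamifiedBelow
  rw [Finset.mem_union, Nat.mem_primeFactors]
  split_ifs with h
  · simp [hd, h]
  · simp only [Finset.mem_singleton, h, not_false_eq_true, and_true]
    constructor
    · rintro (⟨h1, h2, -⟩ | rfl)
      · exact ⟨h1, Or.inl h2⟩
      · exact ⟨Nat.prime_three, Or.inr rfl⟩
    · rintro ⟨h1, h2 | rfl⟩
      · exact Or.inl ⟨h1, h2, hd⟩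
      · exact Or.inr rfl

section Count

variable {F K : Type} [Field F] [NumberField F] [IsCyclotomicExtension {3} ℚ F]
  [Field K] [NumberField K] [Algebra F K] [IsGalois F K] {σ : Gal(K/F)}

open Pointwise in
omit [IsCyclotomicExtension {3} ℚ F] in
lemma injOn_under_ramifiedPrimes (h3 : Module.finrank F K = 3) (hσ : σ ≠ 1) :
    Set.InjOn (fun Q : Ideal (𝓞 K) ↦ Q.under (𝓞 F)) (ramifiedPrimes σ) := by
  intro Q hQ P hP hPQ
  have := Ideal.isPrime_of_prime hQ.1
  have := Ideal.isPrime_of_prime hP.1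
  have hover : P.LiesOver (Q.under (𝓞 F)) := ⟨hPQ⟩
  obtain ⟨g, rfl⟩ := Ideal.exists_smul_eq_of_isGaloisGroup (Q.under (𝓞 F)) Q P Gal(K/F)
  have hst : σ ∈ MulAction.stabilizer Gal(K/F) Q := smul_eq_of_mem_ramifiedPrimes h3 hQ
  exact (MulAction.mem_stabilizer_iff.mp
    ((Subgroup.zpowers_le.mpr hst) (gal_mem_zpowers h3 hσ g))).symm

variable {d : ℕ} {θ : 𝓞 K} (hθ : θ ^ 3 = d) {η : 𝓞 F} (hη : η ^ 2 + η + 1 = 0)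
  (hσθ : σ • θ = algebraMap (𝓞 F) (𝓞 K) η * θ)

include hθ hη hσθ in
lemma image_under_ramifiedPrimes (h3 : Module.finrank F K = 3) (hd : d ≠ 0)
    (hdcf : ∀ p : ℕ, p.Prime → ¬ p ^ 3 ∣ d) :
    (fun Q : Ideal (𝓞 K) ↦ Q.under (𝓞 F)) '' ramifiedPrimes σ =
      ⋃ p ∈ (primesBelow d : Set ℕ), primesOver (span {(p : ℤ)}) (𝓞 F) := by
  ext q
  simp only [Set.mem_image, Set.mem_iUnion, Finset.mem_coe, mem_primesBelow hd, exists_prop]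
  constructor
  · rintro ⟨Q, hQ, rfl⟩
    have := Ideal.isPrime_of_prime hQ.1
    obtain ⟨p, hp, hpQ⟩ := exists_prime_natCast_mem hQ.1.ne_zero
    refine ⟨p, ⟨hp, isRamifiedBelow_of_mem hθ hη hσθ hQ hp hpQ⟩, inferInstance, ?_⟩
    rw [liesOver_span_natCast_iff hp, Ideal.under_def, Ideal.mem_comap, map_natCast]
    exact hpQ
  · rintro ⟨p, ⟨hp, hpd⟩, hq⟩
    have := hq.1
    have hpq := (liesOver_span_natCast_iff hp).mp hq.2
    obtain ⟨⟨Q, hQ, hQq⟩⟩ := q.nonempty_primesOver (S := 𝓞 K)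
    have hpQ : (p : 𝓞 K) ∈ Q := by
      rw [hQq.over, Ideal.under_def, Ideal.mem_comap, map_natCast] at hpq
      exact hpq
    have hQ0 : Q ≠ ⊥ := by
      rintro rfl
      exact hp.ne_zero (by exact_mod_cast (Ideal.mem_bot.mp hpQ))
    exact ⟨Q, mem_ramifiedPrimes_of_isRamifiedBelow h3 hθ hη hdcf
      (Ideal.prime_of_isPrime hQ0 hQ) hp hpQ hpd, hQq.over.symm⟩

include hθ hη hσθ in
/-- The number of ramified primes. -/
lemma ncard_ramifiedPrimes (h3 : Module.finrank F K = 3) (hσ : σ ≠ 1) (hd : d ≠ 0)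
    (hdcf : ∀ p : ℕ, p.Prime → ¬ p ^ 3 ∣ d) :
    (ramifiedPrimes σ).ncard = ∑ p ∈ primesBelow d, if p % 3 = 1 then 2 else 1 := by
  rw [← (injOn_under_ramifiedPrimes h3 hσ).ncard_image,
    image_under_ramifiedPrimes hθ hη hσθ h3 hd hdcf, Set.Finite.ncard_biUnion
      (Finset.finite_toSet _), finsum_mem_coe_finset]
  · refine Finset.sum_congr rfl fun p hp ↦ ncard_primesOver_eisenstein ?_
    exact ((mem_primesBelow hd).mp hp).1
  · intro p hp
    refine Set.finite_of_ncard_ne_zero ?_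
    rw [ncard_primesOver_eisenstein ((mem_primesBelow hd).mp hp).1]
    split_ifs <;> norm_num
  · intro p hp r hr hpr
    have hp' := ((mem_primesBelow hd).mp hp).1
    have hr' := ((mem_primesBelow hd).mp hr).1
    refine Set.disjoint_left.mpr fun q hq hq' ↦ hpr ?_
    have := hq.1
    exact (Nat.prime_dvd_prime_iff_eq hp' hr').mp ((natCast_mem_iff hp'
      ((liesOver_span_natCast_iff hp').mp hq.2) r).mp ((liesOver_span_natCast_iff hr').mp hq'.2))

end Count

section NormUnit

namespace IsCubicSetup

variable {A R : Type*} [CommRing A] [CommRing R] [IsDedekindDomain R]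
    [Algebra A R] {s : R ≃+* R} {S : Finset (Ideal R)}

lemma multiplicity_cubicNorm (h : IsCubicSetup A s S) {Q : Ideal R} (hQ : Q ∈ S) {x : R}
    (hx : x ≠ 0) : multiplicity Q (span {s.cubicNorm x}) = 3 * multiplicity Q (span {x}) := by
  have hI : span {x} ≠ (0 : Ideal R) := by simpa using hx
  have h1 : span {s.cubicNorm x} =
      span {x} * (span {x}).map s * ((span {x}).map s).map s := by
    simp only [Ideal.map_span, Set.image_singleton, span_singleton_mul_span_singleton]
    rfl
  rw [h1, Ideal.multiplicity_mul_of_prime (h.prime Q hQ) (mul_ne_zero hI (map_ne_zero hI))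
    (map_ne_zero (map_ne_zero hI)), Ideal.multiplicity_mul_of_prime (h.prime Q hQ) hI
    (map_ne_zero hI), h.multiplicity_map hQ, h.multiplicity_map hQ, h.multiplicity_map hQ]
  ring

/-- A unit which is a norm of a quotient is the norm of a quotient of integers not divisible by a
given ramified prime. -/
lemma IsNormUnit.exists_notMem (h : IsCubicSetup A s S) {u : Aˣ} (hu : IsNormUnit s u)
    {Q : Ideal R} (hQ : Q ∈ S) :
    ∃ a b : R, a ∉ Q ∧ b ∉ Q ∧ algebraMap A R u * s.cubicNorm b = s.cubicNorm a := by
  obtain ⟨a, b, ha, hb, hab⟩ := hu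
  have hp := h.prime Q hQ
  have hA : span {a} ≠ (0 : Ideal R) := by simpa using ha
  have hB : span {b} ≠ (0 : Ideal R) := by simpa using hb
  have hmul : multiplicity Q (span {a}) = multiplicity Q (span {b}) := by
    have h1 := h.multiplicity_cubicNorm hQ ha
    have h2 := h.multiplicity_cubicNorm hQ hb
    have hspan : span {s.cubicNorm a} = span {s.cubicNorm b} := by
      rw [← hab, Ideal.span_singleton_eq_span_singleton, mul_comm]
      exact associated_mul_unit_left _ _ ((Units.isUnit u).map _)
    rw [hspan] at h1
    omega
  have hfa : FiniteMultiplicity Q (span {a}) := FiniteMultiplicity.of_prime_left hp hA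
  have hfb : FiniteMultiplicity Q (span {b}) := FiniteMultiplicity.of_prime_left hp hB
  obtain ⟨J, hJ, hQJ⟩ := hfb.exists_eq_pow_mul_and_not_dvd
  obtain ⟨j, hjJ, hjQ⟩ : ∃ j ∈ J, j ∉ Q := by
    by_contra! hcon
    exact hQJ (Ideal.dvd_iff_le.mpr hcon)
  have hj : j ≠ 0 := by
    rintro rfl
    exact hjQ Q.zero_mem
  obtain ⟨c, hc⟩ : ∃ c, a * j = b * c := by
    have : a * j ∈ span {b} := by
      rw [hJ]
      refine Ideal.mul_mem_mul ?_ hjJ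
      rw [← hmul, ← Ideal.dvd_span_singleton]
      exact pow_multiplicity_dvd _ _
    obtain ⟨c, hc⟩ := Ideal.mem_span_singleton.mp this
    exact ⟨c, hc⟩
  have hc0 : c ≠ 0 := by
    rintro rfl
    exact mul_ne_zero ha hj (by simpa using hc)
  refine ⟨c, j, ?_, hjQ, ?_⟩
  · have hm := congrArg (fun x ↦ multiplicity Q (span {x})) hc
    rw [← span_singleton_mul_span_singleton, ← span_singleton_mul_span_singleton,
      Ideal.multiplicity_mul_of_prime hp hA (by simpa using hj),
      Ideal.multiplicity_mul_of_prime hp hB (by simpa using hc0), hmul] at hm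
    rw [← Ideal.dvd_span_singleton, ← multiplicity_eq_zero] at hjQ ⊢
    omega
  · apply mul_left_cancel₀ (cubicNorm_ne_zero s hb)
    have := congrArg s.cubicNorm hc
    rw [map_mul, map_mul] at this
    linear_combination s.cubicNorm j * hab + this

end IsCubicSetup

variable {F K : Type} [Field F] [NumberField F] [IsCyclotomicExtension {3} ℚ F]
  [Field K] [NumberField K] [Algebra F K] [IsGalois F K] {σ : Gal(K/F)} {ζ : F}
  (hζ : IsPrimitiveRoot ζ 3)

lemma absNorm_of_mem_ramifiedPrimes (h3 : Module.finrank F K = 3) (hσ : σ ≠ 1) {Q : Ideal (𝓞 K)}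
    (hQ : Q ∈ ramifiedPrimes σ) {p : ℕ} (hp : p.Prime) (hpQ : (p : 𝓞 K) ∈ Q) :
    absNorm Q = p ∨ absNorm Q = p ^ 2 := by
  have := Ideal.isPrime_of_prime hQ.1
  have hp0 : span {(p : 𝓞 F)} ≠ ⊥ := by simpa using hp.ne_zero
  have hmap : (span {(p : 𝓞 F)}).map (algebraMap (𝓞 F) (𝓞 K)) = span {(p : 𝓞 K)} := by
    rw [Ideal.map_span, Set.image_singleton, map_natCast]
  have h3d := three_dvd_multiplicity h3 hσ hQ hp0
  rw [hmap] at h3d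
  have hpK : span {(p : 𝓞 K)} ≠ 0 := by simpa using hp.ne_zero
  have hfin : FiniteMultiplicity Q (span {(p : 𝓞 K)}) := FiniteMultiplicity.of_prime_left hQ.1 hpK
  have hpos : 1 ≤ multiplicity Q (span {(p : 𝓞 K)}) :=
    hfin.le_multiplicity_of_pow_dvd (by rwa [pow_one, Ideal.dvd_span_singleton])
  have hdvd : Q ^ 3 ∣ span {(p : 𝓞 K)} := pow_dvd_of_le_multiplicity (by omega)
  have hK : Module.finrank ℤ (𝓞 K) = 6 := by
    rw [RingOfIntegers.rank, ← Module.finrank_mul_finrank ℚ F K, h3,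
      IsCyclotomicExtension.finrank (n := 3) F
      (Polynomial.cyclotomic.irreducible_rat (by norm_num))]
    rfl
  have hN := map_dvd Ideal.absNorm hdvd
  have hNp : Ideal.absNorm (span {(p : 𝓞 K)}) = p ^ 6 := by
    have := Ideal.absNorm_span_singleton (p : 𝓞 K)
    rw [this, show (p : 𝓞 K) = algebraMap ℤ (𝓞 K) (p : ℤ) by simp, Algebra.norm_algebraMap, hK]
    simp [Int.natAbs_pow]
  rw [map_pow, hNp] at hN
  have h1 : Ideal.absNorm Q ∣ p ^ 6 := (dvd_pow_self _ (by norm_num)).trans hN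
  obtain ⟨k, hk, hk'⟩ := (Nat.dvd_prime_pow hp).mp h1
  have hk0 : k ≠ 0 := by
    rintro rfl
    rw [pow_zero, Ideal.absNorm_eq_one_iff] at hk'
    exact Ideal.IsPrime.ne_top inferInstance hk'
  rw [hk', ← pow_mul, Nat.pow_dvd_pow_iff_le_right hp.one_lt] at hN
  rcases (by omega : k = 1 ∨ k = 2) with rfl | rfl
  · exact Or.inl (by rw [hk', pow_one])
  · exact Or.inr hk'

lemma mod_nine_of_isNormUnit (h3 : Module.finrank F K = 3) (hσ : σ ≠ 1)
    (hH : IsCubicSetup.IsNormUnit (galRingEquiv σ) (etaUnit hζ)) {Q : Ideal (𝓞 K)}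
    (hQ : Q ∈ ramifiedPrimes σ) {p : ℕ} (hp : p.Prime) (hpQ : (p : 𝓞 K) ∈ Q) (hp3 : p ≠ 3) :
    p % 9 = 1 ∨ p % 9 = 8 := by
  have := IsCyclotomicExtension.Rat.three_pid F
  have hprime := Ideal.isPrime_of_prime hQ.1
  have hmax : Q.IsMaximal := hprime.isMaximal hQ.1.ne_zero
  obtain ⟨a, b, ha, hb, hab⟩ := IsCubicSetup.IsNormUnit.exists_notMem
    (isCubicSetup_galRingEquiv h3 hσ) hH ((finite_ramifiedPrimes hσ).mem_toFinset.mpr hQ)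
  let : Field (𝓞 K ⧸ Q) := Ideal.Quotient.field Q
  set π := Ideal.Quotient.mk Q
  have hπσ : ∀ x, π (galRingEquiv σ x) = π x := fun x ↦ Ideal.Quotient.eq.mpr (hQ.2 x)
  have hnorm : ∀ x, π ((galRingEquiv σ).cubicNorm x) = π x ^ 3 := fun x ↦ by
    rw [RingEquiv.cubicNorm_apply, map_mul, map_mul, hπσ, hπσ, hπσ]; ring
  have ha0 : π a ≠ 0 := fun h ↦ ha (Ideal.Quotient.eq_zero_iff_mem.mp h)
  have hb0 : π b ≠ 0 := fun h ↦ hb (Ideal.Quotient.eq_zero_iff_mem.mp h)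
  set z := algebraMap (𝓞 F) (𝓞 K) (etaUnit hζ) with hz
  have hη : ((etaUnit hζ : (𝓞 F)ˣ) : 𝓞 F) ^ 2 + (etaUnit hζ : (𝓞 F)ˣ) + 1 = 0 := by
    apply RingOfIntegers.ext
    have : ζ ^ 2 + ζ + 1 = 0 := by
      have h0 := hζ.geom_sum_eq_zero (by norm_num)
      simp only [Finset.sum_range_succ, Finset.sum_range_zero] at h0
      linear_combination h0
    simpa [coe_etaUnit] using this
  have hz0 : z ^ 2 + z + 1 = 0 := algebraMap_eta_eq hη
  set c := π a / π b with hc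
  have hc3 : c ^ 3 = π z := by
    have := congrArg π hab
    rw [map_mul, hnorm, hnorm] at this
    rw [hc, div_pow, ← this]
    field_simp
  have hz3 : z ^ 3 = 1 := by linear_combination (z - 1) * hz0
  have hc9 : c ^ 9 = 1 := by
    rw [show 9 = 3 * 3 by norm_num, pow_mul, hc3, ← map_pow, hz3, map_one]
  have hc1 : c ^ 3 ≠ 1 := by
    rw [hc3, ← map_one π]
    intro h
    have hzQ : z - 1 ∈ Q := Ideal.Quotient.eq.mp h
    have h3Q : ((3 : ℕ) : 𝓞 K) ∈ Q := by
      rw [show ((3 : ℕ) : 𝓞 K) = -z ^ 2 * (z - 1) * (z - 1) by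
        push_cast
        linear_combination (z ^ 2 - 3 * z + 3) * hz0]
      exact Q.mul_mem_left _ hzQ
    exact hp3 ((Nat.prime_dvd_prime_iff_eq hp Nat.prime_three).mp
      ((natCast_mem_iff hp hpQ 3).mp h3Q))
  have hord : orderOf c = 3 ^ (1 + 1) :=
    orderOf_eq_prime_pow (by simpa using hc1) (by simpa using hc9)
  have hfin : Finite (𝓞 K ⧸ Q) := Ideal.finiteQuotientOfFreeOfNeBot Q hQ.1.ne_zero
  let := Fintype.ofFinite (𝓞 K ⧸ Q)
  have hcard : c ^ (Fintype.card (𝓞 K ⧸ Q) - 1) = 1 :=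
    FiniteField.pow_card_sub_one_eq_one c (div_ne_zero ha0 hb0)
  have hdvd := orderOf_dvd_of_pow_eq_one hcard
  rw [hord, ← Nat.card_eq_fintype_card, ← Submodule.cardQuot_apply, ← Ideal.absNorm_apply]
    at hdvd
  have hpos := hp.one_lt
  rcases absNorm_of_mem_ramifiedPrimes h3 hσ hQ hp hpQ with h | h
  · rw [h] at hdvd
    omega
  · rw [h] at hdvd
    have hp2 : p ^ 2 % 9 = 1 := by
      have : 1 ≤ p ^ 2 := Nat.one_le_pow _ _ hp.pos
      omega
    rw [Nat.pow_mod] at hp2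
    have := Nat.mod_lt p (show 0 < 9 by norm_num)
    interval_cases p % 9 <;> simp_all

end NormUnit

section CyclotomicNine

variable (L : Type*) [Field L] [NumberField L] [IsCyclotomicExtension {9} ℚ L]

lemma finrank_cyclotomic_nine : Module.finrank ℚ L = 6 := by
  rw [IsCyclotomicExtension.finrank (n := 9) L
    (Polynomial.cyclotomic.irreducible_rat (by norm_num))]
  decide

lemma minkowski_cyclotomic_nine :
    ⌊(4 / Real.pi) ^ InfinitePlace.nrComplexPlaces L *
      ((Module.finrank ℚ L).factorial / (Module.finrank ℚ L) ^ (Module.finrank ℚ L) *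
        √|NumberField.discr L|)⌋₊ ≤ 4 := by
  have h9 : IsCyclotomicExtension {3 ^ (1 + 1)} ℚ L := by
    norm_num; infer_instance
  have hd : NumberField.discr L = -19683 := by
    rw [IsCyclotomicExtension.Rat.discr_prime_pow_succ 3 1 L]
    norm_num
  have hc : InfinitePlace.nrComplexPlaces L = 3 := by
    rw [IsCyclotomicExtension.Rat.nrComplexPlaces_eq_totient_div_two 9]
    decide
  rw [finrank_cyclotomic_nine, hd, hc]
  refine Nat.lt_succ_iff.mp ((Nat.floor_lt (by positivity)).mpr ?_)
  have h1 : √|((-19683 : ℤ) : ℝ)| ≤ 141 := by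
    rw [Real.sqrt_le_left (by norm_num)]
    norm_num
  have h2 : (4 / Real.pi) ≤ 4 / 3.14 := by
    gcongr
    exact Real.pi_gt_d2.le
  have h3 : (4 / Real.pi) ^ 3 * ((Nat.factorial 6 : ℕ) / ((6 : ℕ) : ℝ) ^ 6 *
      √|((-19683 : ℤ) : ℝ)|) ≤
      (4 / 3.14) ^ 3 * ((Nat.factorial 6 : ℕ) / ((6 : ℕ) : ℝ) ^ 6 * 141) := by
    gcongr
  refine lt_of_le_of_lt h3 ?_
  rw [show Nat.factorial 6 = 720 from rfl]
  norm_num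

lemma isPrincipalIdealRing_cyclotomic_nine : IsPrincipalIdealRing (𝓞 L) := by
  refine
    RingOfIntegers.isPrincipalIdealRing_of_isPrincipal_of_pow_le_of_mem_primesOver_of_mem_Icc ?_
  intro p _ hp P hP hle
  have := Fact.mk hp
  have := hP.1
  have := hP.2
  have hle4 := hle.trans (minkowski_cyclotomic_nine L)
  rcases eq_or_ne p 3 with rfl | hp3
  · have h9 : IsCyclotomicExtension {3 ^ (1 + 1)} ℚ L := by
      norm_num; infer_instance
    rw [IsCyclotomicExtension.Rat.eq_span_zeta_sub_one_of_liesOver 3 1 L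
      (IsCyclotomicExtension.zeta_spec (3 ^ (1 + 1)) ℚ L) P]
    exact ⟨_, rfl⟩
  · have hp9 : ¬ p ∣ 9 := fun h ↦ hp3 ((Nat.prime_dvd_prime_iff_eq hp Nat.prime_three).mp
      (hp.dvd_of_dvd_pow (show p ∣ 3 ^ 2 by simpa using h)))
    rw [IsCyclotomicExtension.Rat.inertiaDeg_eq_of_not_dvd (m := 9) (p := p) (K := L) P hp9]
      at hle4
    have hpos : orderOf (p : ZMod 9) ≠ 0 := by
      rw [← IsCyclotomicExtension.Rat.inertiaDeg_eq_of_not_dvd (m := 9) (p := p) (K := L) P hp9]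
      have : (span {(p : ℤ)}).IsMaximal :=
        PrincipalIdealRing.isMaximal_of_irreducible (Nat.prime_iff_prime_int.mp hp).irreducible
      have : P.IsMaximal := Ideal.isMaximal_of_mem_primesOver hP
      exact (inertiaDeg_pos ..).ne'
    have hp4 : p ≤ 4 := (Nat.le_self_pow hpos p).trans hle4
    have hp2 := hp.two_le
    obtain rfl : p = 2 := by
      interval_cases p
      · rfl
      · exact absurd rfl hp3
      · exact absurd hp (by norm_num)
    exfalso
    have h6 : orderOf ((2 : ℕ) : ZMod 9) = 6 := by
      rw [orderOf_eq_iff (by norm_num)]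
      refine ⟨by decide, fun m hm hm0 ↦ ?_⟩
      interval_cases m <;> decide
    rw [h6] at hle4
    norm_num at hle4

end CyclotomicNine

section CyclotomicNineNorm

variable {F L : Type} [Field F] [NumberField F] [IsCyclotomicExtension {3} ℚ F]
    [Field L] [NumberField L] [Algebra F L] [IsCyclotomicExtension {9} F L]

lemma isCyclotomicExtension_nine_rat (F L : Type) [Field F] [NumberField F]
    [IsCyclotomicExtension {3} ℚ F] [Field L] [NumberField L] [Algebra F L]
    [IsCyclotomicExtension {9} F L] : IsCyclotomicExtension {9} ℚ L := by
  have h : IsCyclotomicExtension ({3} ∪ {9}) ℚ L :=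
    IsCyclotomicExtension.trans {3} {9} ℚ F L (algebraMap F L).injective
  rw [Set.union_comm] at h
  exact (IsCyclotomicExtension.iff_union_of_dvd (S := {9}) (n := 3) ℚ L ⟨9, rfl, by norm_num, by norm_num⟩).mpr h

variable (F L) in
lemma finrank_cyclotomic_nine_three : Module.finrank F L = 3 := by
  have := isCyclotomicExtension_nine_rat F L
  have h6 := finrank_cyclotomic_nine L
  have h2 : Module.finrank ℚ F = 2 := by
    rw [IsCyclotomicExtension.finrank (n := 3) F
      (Polynomial.cyclotomic.irreducible_rat (by norm_num))]
    decide
  have := Module.finrank_mul_finrank ℚ F L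
  rw [h2, h6] at this
  omega

variable (L) in
omit [NumberField F] [IsCyclotomicExtension {3} ℚ F] [NumberField L] in
lemma exists_primitiveRoot_nine {ζ : F} (hζ : IsPrimitiveRoot ζ 3) :
    ∃ η : L, IsPrimitiveRoot η 9 ∧ η ^ 3 = algebraMap F L ζ := by
  have h9 := IsCyclotomicExtension.zeta_spec 9 F L
  have h3 : IsPrimitiveRoot (IsCyclotomicExtension.zeta 9 F L ^ 3) 3 :=
    h9.pow (by norm_num) (by norm_num)
  have hz : IsPrimitiveRoot (algebraMap F L ζ) 3 := hζ.map_of_injective (algebraMap F L).injective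
  obtain ⟨i, hi, hcop, hi3⟩ := (h3.isPrimitiveRoot_iff).mp hz
  refine ⟨IsCyclotomicExtension.zeta 9 F L ^ i, h9.pow_of_coprime i ?_, ?_⟩
  · exact Nat.Coprime.pow_right (m := 3) 2 hcop
  · rw [← hi3, ← pow_mul, ← pow_mul, mul_comm]

lemma exists_eq_add_of_primitiveRoot_nine {η : L} (hη : IsPrimitiveRoot η 9) (v : L) :
    ∃ x y z : F, v = algebraMap F L x + algebraMap F L y * η + algebraMap F L z * η ^ 2 := by
  have : IsGalois F L := IsCyclotomicExtension.isGalois {9} F L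
  obtain ⟨f, hf, hv⟩ := (hη.powerBasis F).exists_eq_aeval v
  have hdim : (hη.powerBasis F).dim = 3 := by
    rw [← (hη.powerBasis F).finrank, finrank_cyclotomic_nine_three F L]
  rw [hdim] at hf
  refine ⟨f.coeff 0, f.coeff 1, f.coeff 2, ?_⟩
  rw [hv, Polynomial.aeval_eq_sum_range' hf, hη.powerBasis_gen F]
  simp [Finset.sum_range_succ, Algebra.smul_def]

lemma norm_add_of_primitiveRoot_nine {ζ : F} (hζ : IsPrimitiveRoot ζ 3) {η : L}
    (hη : IsPrimitiveRoot η 9) (hηζ : η ^ 3 = algebraMap F L ζ) (x y z : F) :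
    Algebra.norm F (algebraMap F L x + algebraMap F L y * η + algebraMap F L z * η ^ 2) =
      x ^ 3 + ζ * y ^ 3 + ζ ^ 2 * z ^ 3 - 3 * ζ * x * y * z := by
  have : IsGalois F L := IsCyclotomicExtension.isGalois {9} F L
  have h3 := finrank_cyclotomic_nine_three F L
  have hcard := IsGalois.card_aut_eq_finrank F L
  obtain ⟨τ, hτ⟩ : ∃ τ : Gal(L/F), τ ≠ 1 := by
    by_contra! h
    have : Subsingleton Gal(L/F) := ⟨fun a b ↦ (h a).trans (h b).symm⟩
    rw [h3, Nat.card_of_subsingleton 1] at hcard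
    omega
  have hη0 : η ≠ 0 := hη.ne_zero (by norm_num)
  obtain ⟨ω, hω⟩ : ∃ ω, τ η = ω * η := ⟨τ η / η, by field_simp⟩
  have hτη : τ η ≠ η := fun h ↦ hτ (by
    have := (hη.powerBasis F).algHom_ext (f := (τ : L →ₐ[F] L)) (g := AlgHom.id F L)
      (by simpa [hη.powerBasis_gen F] using h)
    exact AlgEquiv.ext fun x ↦ congrArg (fun f : L →ₐ[F] L ↦ f x) this)
  have hω3 : ω ^ 3 = 1 := by
    have h := congrArg τ hηζ
    rw [map_pow, hω, AlgEquiv.commutes, mul_pow, hηζ] at h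
    have hz : algebraMap F L ζ ≠ 0 := hηζ ▸ pow_ne_zero 3 hη0
    exact mul_right_cancel₀ hz (h.trans (one_mul _).symm)
  have hω1 : ω ≠ 1 := by
    rintro rfl
    exact hτη (by rw [hω, one_mul])
  have hωq : ω ^ 2 + ω + 1 = 0 := by
    have : (ω - 1) * (ω ^ 2 + ω + 1) = 0 := by linear_combination hω3
    exact (mul_eq_zero.mp this).resolve_left (sub_ne_zero.mpr hω1)
  have hτω : τ ω = ω := by
    have hz : IsPrimitiveRoot (algebraMap F L ζ) 3 :=
      hζ.map_of_injective (algebraMap F L).injective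
    obtain ⟨i, -, hi⟩ := hz.eq_pow_of_pow_eq_one hω3
    rw [← hi, map_pow, AlgEquiv.commutes]
  apply (algebraMap F L).injective
  rw [algebraMap_norm_eq_of_cubic h3 hτ]
  simp only [map_add, map_sub, map_mul, map_pow, AlgEquiv.commutes, hω, hτω, ← hηζ, map_ofNat]
  generalize algebraMap F L x = X
  generalize algebraMap F L y = Y
  generalize algebraMap F L z = Z
  have e1 : ω * (ω * η) = (-1 - ω) * η := by linear_combination η * hωq
  have e2 : (ω * η) ^ 2 = (-1 - ω) * η ^ 2 := by linear_combination η ^ 2 * hωq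
  have e3 : ((-1 - ω) * η) ^ 2 = ω * η ^ 2 := by linear_combination η ^ 2 * hωq
  rw [e1, e2, e3]
  linear_combination (X + Y * η + Z * η ^ 2) *
    (2 * Y * Z * η ^ 3 - (Y * η) ^ 2 - (Z * η ^ 2) ^ 2) * hωq

end CyclotomicNineNorm

section CyclotomicNineNorm

variable {F : Type} (L : Type) [Field F] [NumberField F] [IsCyclotomicExtension {3} ℚ F]
    [Field L] [NumberField L] [Algebra F L] [IsCyclotomicExtension {9} F L]

lemma unit_mem_mrange_norm (u : (𝓞 F)ˣ) :
    ((u : 𝓞 F) : F) ∈ MonoidHom.mrange (Algebra.norm F : L →* F) := by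
  have hζ := IsCyclotomicExtension.zeta_spec 3 ℚ F
  obtain ⟨η, hη, hηζ⟩ := exists_primitiveRoot_nine L hζ
  have hz : ((etaUnit hζ : 𝓞 F) : F) ∈ MonoidHom.mrange (Algebra.norm F : L →* F) := by
    refine ⟨algebraMap F L 0 + algebraMap F L 1 * η + algebraMap F L 0 * η ^ 2, ?_⟩
    rw [norm_add_of_primitiveRoot_nine hζ hη hηζ, coe_etaUnit]
    ring
  have hn : (-1 : F) ∈ MonoidHom.mrange (Algebra.norm F : L →* F) := by
    refine ⟨algebraMap F L (-1), ?_⟩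
    rw [Algebra.norm_algebraMap, finrank_cyclotomic_nine_three F L]
    norm_num
  rcases units_eq_or hζ u with rfl | rfl | rfl | rfl | rfl | rfl
  · simp
  · simpa using hn
  · exact hz
  · simpa using mul_mem hn hz
  · simpa using pow_mem hz 2
  · simpa using mul_mem hn (pow_mem hz 2)

lemma orderOf_nine_eq_orderOf_three {p : ℕ} (hp : p % 9 = 1 ∨ p % 9 = 8) :
    orderOf (p : ZMod 9) = orderOf (p : ZMod 3) := by
  rcases hp with h | h
  · rw [show (p : ZMod 9) = 1 by rw [← ZMod.natCast_mod, h]; rfl,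
      show (p : ZMod 3) = 1 by rw [← ZMod.natCast_mod, show p % 3 = 1 by omega]; rfl]
    simp
  · rw [show (p : ZMod 9) = -1 by rw [← ZMod.natCast_mod, h]; rfl,
      show (p : ZMod 3) = -1 by rw [← ZMod.natCast_mod, show p % 3 = 2 by omega]; rfl]
    rw [orderOf_eq_prime (p := 2) (by decide) (by decide),
      orderOf_eq_prime (p := 2) (by decide) (by decide)]

lemma prime_mem_mrange_norm {p : ℕ} (hp : p.Prime) (h : p = 3 ∨ p % 9 = 1 ∨ p % 9 = 8)
    {π : 𝓞 F} (hπ : Prime π) (hπp : π ∣ p) :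
    (π : F) ∈ MonoidHom.mrange (Algebra.norm F : L →* F) := by
  have hL := isCyclotomicExtension_nine_rat F L
  have hPID := isPrincipalIdealRing_cyclotomic_nine L
  have := Fact.mk hp
  have hq : (span {π}).IsPrime := (span_singleton_prime hπ.ne_zero).mpr hπ
  have hqm : (span {π}).IsMaximal := hq.isMaximal (by simpa using hπ.ne_zero)
  obtain ⟨P, hP, hPq⟩ := exists_maximal_ideal_liesOver_of_isIntegral (S := 𝓞 L) (span {π})
  have hqp : (span {π}).LiesOver (span {(p : ℤ)}) :=
    (liesOver_span_natCast_iff hp).mpr (mem_span_singleton.mpr hπp)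
  have hPp : P.LiesOver (span {(p : ℤ)}) := LiesOver.trans P (span {π}) _
  have hf : P.inertiaDeg ℤ = (span {π}).inertiaDeg ℤ := by
    rcases h with rfl | h
    · have h9 : IsCyclotomicExtension {3 ^ (1 + 1)} ℚ L := by
        norm_num; infer_instance
      have h3 : IsCyclotomicExtension {3 ^ (0 + 1)} ℚ F := by
        norm_num; infer_instance
      rw [IsCyclotomicExtension.Rat.inertiaDeg_eq_of_prime_pow 3 1 L P,
        IsCyclotomicExtension.Rat.inertiaDeg_eq_of_prime_pow 3 0 F (span {π})]
    · have h3 : ¬ p ∣ 3 := fun h' ↦ by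
        have := (Nat.prime_dvd_prime_iff_eq hp Nat.prime_three).mp h'
        omega
      have h9 : ¬ p ∣ 9 := fun h' ↦ h3 (hp.dvd_of_dvd_pow (show p ∣ 3 ^ 2 by simpa using h'))
      rw [IsCyclotomicExtension.Rat.inertiaDeg_eq_of_not_dvd (m := 9) (p := p) (K := L) P h9,
        IsCyclotomicExtension.Rat.inertiaDeg_eq_of_not_dvd (m := 3) (p := p) (K := F) (span {π}) h3,
        orderOf_nine_eq_orderOf_three h]
  have hf1 : P.inertiaDeg (𝓞 F) = 1 := by
    have htower := inertiaDeg_tower (R := ℤ) (span {π}) P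
    have : (span {(p : ℤ)}).IsMaximal :=
      PrincipalIdealRing.isMaximal_of_irreducible (Nat.prime_iff_prime_int.mp hp).irreducible
    have hpos : 0 < (span {π}).inertiaDeg ℤ := inertiaDeg_pos ..
    rw [hf] at htower
    exact Nat.eq_of_mul_eq_mul_left hpos (htower.symm.trans (mul_one _).symm)
  have hrel := relNorm_eq_pow_of_isMaximal P (span {π})
  obtain ⟨β, rfl⟩ := (IsPrincipalIdealRing.principal P).principal
  rw [hf1, pow_one, submodule_span_eq, relNorm_singleton, span_singleton_eq_span_singleton] at hrel
  obtain ⟨u, hu⟩ := hrel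
  rw [← hu]
  have := Algebra.algebraMap_intNorm (A := 𝓞 F) (K := F) (L := L) (B := 𝓞 L) β
  have h1 : ((Algebra.intNorm (𝓞 F) (𝓞 L) β : 𝓞 F) : F) ∈
      MonoidHom.mrange (Algebra.norm F : L →* F) := ⟨_, this.symm⟩
  simpa using mul_mem h1 (unit_mem_mrange_norm L u)

lemma mem_mrange_norm_of_forall_prime {a : 𝓞 F} (ha : a ≠ 0)
    (h : ∀ π : 𝓞 F, Prime π → π ∣ a → (π : F) ∈ MonoidHom.mrange (Algebra.norm F : L →* F)) :
    (a : F) ∈ MonoidHom.mrange (Algebra.norm F : L →* F) := by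
  have hPID := IsCyclotomicExtension.Rat.three_pid F
  induction a using UniqueFactorizationMonoid.induction_on_prime with
  | h₁ => exact absurd rfl ha
  | h₂ x hx =>
    obtain ⟨u, rfl⟩ := hx
    exact unit_mem_mrange_norm L u
  | h₃ a π ha0 hπ ih =>
    have h1 := ih ha0 fun π' hπ' hd ↦ h π' hπ' (hd.mul_left _)
    have h2 := h π hπ (dvd_mul_right _ _)
    simpa using mul_mem h2 h1

lemma natCast_mem_mrange_norm {d : ℕ} (hd : d ≠ 0)
    (h : ∀ p : ℕ, p.Prime → p ∣ d → p = 3 ∨ p % 9 = 1 ∨ p % 9 = 8) :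
    (d : F) ∈ MonoidHom.mrange (Algebra.norm F : L →* F) := by
  have := mem_mrange_norm_of_forall_prime L (a := (d : 𝓞 F)) (by exact_mod_cast hd) ?_
  · simpa using this
  intro π hπ hπd
  have hd' : (d : 𝓞 F) = (((d.primeFactorsList).map (Nat.cast : ℕ → 𝓞 F)).prod) := by
    rw [← Nat.cast_list_prod, Nat.prod_primeFactorsList hd]
  rw [hd', hπ.dvd_prod_iff] at hπd
  obtain ⟨_, hmem, hdvd⟩ := hπd
  obtain ⟨p, hp, rfl⟩ := List.mem_map.mp hmem
  have hpp := Nat.prime_of_mem_primeFactorsList hp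
  exact prime_mem_mrange_norm L hpp (h p hpp (Nat.dvd_of_mem_primeFactorsList hp)) hπ hdvd

end CyclotomicNineNorm

section Sufficiency

variable {F K : Type} [Field F] [NumberField F] [IsCyclotomicExtension {3} ℚ F]
    [Field K] [NumberField K] [Algebra F K] [IsGalois F K]
    {ζ : F} (hζ : IsPrimitiveRoot ζ 3) (h3 : Module.finrank F K = 3)
    {σ : Gal(K/F)} (hσ : σ ≠ 1)

include h3 hσ in
omit [IsCyclotomicExtension {3} ℚ F] in
lemma isNormUnit_of_norm_eq {u : (𝓞 F)ˣ} {α β : K} (hα : α ≠ 0) (hβ : β ≠ 0)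
    (h : ((u : 𝓞 F) : F) * Algebra.norm F β = Algebra.norm F α) :
    IsCubicSetup.IsNormUnit (galRingEquiv σ) u := by
  obtain ⟨a, c, hc, rfl⟩ := IsFractionRing.div_surjective (𝓞 K) α
  obtain ⟨b, e, he, rfl⟩ := IsFractionRing.div_surjective (𝓞 K) β
  have hc0 := nonZeroDivisors.ne_zero hc
  have he0 := nonZeroDivisors.ne_zero he
  have hcK : algebraMap (𝓞 K) K c ≠ 0 := by simpa using hc0
  have heK : algebraMap (𝓞 K) K e ≠ 0 := by simpa using he0
  have ha0 : a ≠ 0 := by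
    rintro rfl
    simp at hα
  have hb0 : b ≠ 0 := by
    rintro rfl
    simp at hβ
  refine ⟨a * e, b * c, mul_ne_zero ha0 he0, mul_ne_zero hb0 hc0, ?_⟩
  apply RingOfIntegers.ext
  have hcoe : ∀ x : 𝓞 K, (((galRingEquiv σ).cubicNorm x : 𝓞 K) : K) =
      algebraMap F K (Algebra.norm F (x : K)) := fun x ↦ by
    rw [algebraMap_norm_eq_of_cubic h3 hσ]
    rfl
  rw [show ∀ w, ((algebraMap (𝓞 F) (𝓞 K) u * w : 𝓞 K) : K) =
    algebraMap F K ((u : 𝓞 F) : F) * w from fun w ↦ rfl, hcoe, hcoe, ← map_mul]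
  congr 1
  have hA := map_mul (Algebra.norm F) (algebraMap (𝓞 K) K a / algebraMap (𝓞 K) K c)
    (algebraMap (𝓞 K) K c)
  have hB := map_mul (Algebra.norm F) (algebraMap (𝓞 K) K b / algebraMap (𝓞 K) K e)
    (algebraMap (𝓞 K) K e)
  rw [div_mul_cancel₀ _ hcK] at hA
  rw [div_mul_cancel₀ _ heK] at hB
  simp only [map_mul, hA, hB]
  linear_combination Algebra.norm F (algebraMap (𝓞 K) K c) *
    Algebra.norm F (algebraMap (𝓞 K) K e) * h

include hζ h3 hσ in
theorem isNormUnit_etaUnit_of_forall_prime {d : ℕ} (hd : d ≠ 0) {θ : K} (hθ : θ ^ 3 = d)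
    (hσθ : σ θ = algebraMap F K ζ * θ)
    (h : ∀ p : ℕ, p.Prime → p ∣ d → p = 3 ∨ p % 9 = 1 ∨ p % 9 = 8) :
    IsCubicSetup.IsNormUnit (galRingEquiv σ) (etaUnit hζ) := by
  let L := CyclotomicField 9 F
  have : NumberField L := IsCyclotomicExtension.numberField {9} F L
  obtain ⟨v, hv⟩ := natCast_mem_mrange_norm (F := F) L hd h
  obtain ⟨η, hη, hηζ⟩ := exists_primitiveRoot_nine L hζ
  obtain ⟨x, y, z, rfl⟩ := exists_eq_add_of_primitiveRoot_nine (F := F) hη v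
  rw [norm_add_of_primitiveRoot_nine hζ hη hηζ] at hv
  have hζq : ζ ^ 2 + ζ + 1 = 0 := by
    have h1 := hζ.pow_eq_one
    have h2 := hζ.ne_one (by norm_num)
    have : (ζ - 1) * (ζ ^ 2 + ζ + 1) = 0 := by linear_combination h1
    exact (mul_eq_zero.mp this).resolve_left (sub_ne_zero.mpr h2)
  have hd0 : (d : F) ≠ 0 := by exact_mod_cast hd
  have hθ0 : θ ≠ 0 := by
    rintro rfl
    rw [zero_pow three_ne_zero] at hθ
    exact hd (by exact_mod_cast hθ.symm)
  have hlin : ∀ a b : F, algebraMap F K a + algebraMap F K b * θ = 0 → a = 0 ∧ b = 0 := by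
    intro a b hab
    have h1 := congrArg σ hab
    rw [map_add, map_mul, hσθ, AlgEquiv.commutes, AlgEquiv.commutes, map_zero] at h1
    have h2 : (algebraMap F K (ζ - 1) * θ) * algebraMap F K b = 0 := by
      rw [map_sub, map_one]
      linear_combination h1 - hab
    have hz1 : algebraMap F K (ζ - 1) ≠ 0 := by
      simpa [sub_eq_zero] using hζ.ne_one (by norm_num)
    have hb : b = 0 := by
      simpa using (mul_eq_zero.mp h2).resolve_left (mul_ne_zero hz1 hθ0)
    subst hb
    simpa using hab
  have hnorm : ∀ a b : F, Algebra.norm F (algebraMap F K a + algebraMap F K b * θ) =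
      a ^ 3 + d * b ^ 3 := by
    intro a b
    apply (algebraMap F K).injective
    rw [algebraMap_norm_eq_of_cubic h3 hσ]
    simp only [map_add, map_mul, map_pow, AlgEquiv.commutes, hσθ, map_natCast, ← hθ]
    have hq : algebraMap F K ζ ^ 2 + algebraMap F K ζ + 1 = 0 := by
      simpa using congrArg (algebraMap F K) hζq
    generalize algebraMap F K a = a'
    generalize algebraMap F K b = b'
    linear_combination (a' ^ 2 * (b' * θ) + algebraMap F K ζ * a' * (b' * θ) ^ 2 +
      (algebraMap F K ζ - 1) * (b' * θ) ^ 3) * hq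
  have hnc : ∀ c : F, c ^ 3 ≠ d := by
    intro c hc
    have hc0 : algebraMap F K c ≠ 0 := by
      simp only [ne_eq, map_eq_zero]
      rintro rfl
      exact hd0 (by simpa using hc.symm)
    have hz : IsPrimitiveRoot (algebraMap F K ζ) 3 :=
      hζ.map_of_injective (algebraMap F K).injective
    obtain ⟨i, -, hi⟩ := hz.eq_pow_of_pow_eq_one (ξ := θ / algebraMap F K c) (by
      rw [div_pow, hθ, ← map_pow, hc, map_natCast, div_self (by exact_mod_cast hd)])
    have := (hlin (ζ ^ i * c) (-1) (by
      rw [map_mul, map_pow, hi, div_mul_cancel₀ _ hc0]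
      simp)).2
    simp at this
  refine isNormUnit_of_norm_eq h3 hσ
    (α := algebraMap F K (-(x * y - ζ * z ^ 2)) + algebraMap F K y * θ)
    (β := algebraMap F K (y ^ 2 - x * z) + algebraMap F K z * θ) ?_ ?_ ?_
  · intro h0
    obtain ⟨h1, rfl⟩ := hlin _ _ h0
    obtain rfl : z = 0 := by simpa [hζ.ne_zero] using h1
    exact hnc x (by rw [← hv]; ring)
  · intro h0
    obtain ⟨h1, rfl⟩ := hlin _ _ h0
    obtain rfl : y = 0 := by simpa using h1
    exact hnc x (by rw [← hv]; ring)
  · rw [hnorm, hnorm, coe_etaUnit, ← hv]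
    ring

end Sufficiency

section KummerCriterion

variable {F K : Type} [Field F] [NumberField F] [IsCyclotomicExtension {3} ℚ F]
    [Field K] [NumberField K] [Algebra F K] [IsGalois F K]

/-- For a Kummer extension `F(∛d)/F` of degree three, there are exactly three ambiguous classes if
and only if two primes ramify and every prime divisor of `d` other than `3` is `± 1` modulo `9`, or
three primes ramify and some prime divisor of `d` other than `3` is not `± 1` modulo `9`. -/
theorem card_fixedClass_kummer_eq_three_iff (h3 : Module.finrank F K = 3) {σ : Gal(K/F)} {d : ℕ}
    (hd : d ≠ 0) (hdcf : ∀ p : ℕ, p.Prime → ¬ p ^ 3 ∣ d) {θ : K} (hθ : θ ^ 3 = d)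
    (hσθ : σ θ ≠ θ) :
    Nat.card {c // IsCubicSetup.IsFixedClass (galRingEquiv σ) c} = 3 ↔
      ((∑ p ∈ primesBelow d, if p % 3 = 1 then 2 else 1) = 2 ∧
        ∀ p : ℕ, p.Prime → p ∣ d → p = 3 ∨ p % 9 = 1 ∨ p % 9 = 8) ∨
      ((∑ p ∈ primesBelow d, if p % 3 = 1 then 2 else 1) = 3 ∧
        ¬ ∀ p : ℕ, p.Prime → p ∣ d → p = 3 ∨ p % 9 = 1 ∨ p % 9 = 8) := by
  have hσ : σ ≠ 1 := fun h ↦ hσθ (by rw [h]; rfl)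
  have hθ0 : θ ≠ 0 := by
    rintro rfl
    exact hσθ (map_zero σ)
  have hz := IsCyclotomicExtension.zeta_spec 3 ℚ F
  obtain ⟨i, -, hi⟩ := (hz.map_of_injective (algebraMap F K).injective).eq_pow_of_pow_eq_one
    (ξ := σ θ / θ) (by
      rw [div_pow, ← map_pow, hθ, map_natCast, div_self (by exact_mod_cast hd)])
  obtain ⟨ζ, hζdef⟩ : ∃ ζ, ζ = IsCyclotomicExtension.zeta 3 ℚ F ^ i := ⟨_, rfl⟩
  have hσζ : σ θ = algebraMap F K ζ * θ := by
    rw [hζdef, map_pow, hi, div_mul_cancel₀ _ hθ0]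
  have hζ1 : ζ ≠ 1 := by
    rintro rfl
    exact hσθ (by rw [hσζ, map_one, one_mul])
  have hζ : IsPrimitiveRoot ζ 3 := by
    have h1 : ζ ^ 3 = 1 := by rw [hζdef, ← pow_mul, mul_comm, pow_mul, hz.pow_eq_one, one_pow]
    rw [← orderOf_eq_prime h1 hζ1]
    exact IsPrimitiveRoot.orderOf ζ
  have h_int : IsIntegral ℤ θ := by
    refine IsIntegral.of_pow three_pos ?_
    rw [hθ]
    simpa using isIntegral_algebraMap (R := ℤ) (A := K) (x := (d : ℤ))
  obtain ⟨t, ht⟩ : ∃ t : 𝓞 K, (t : K) = θ := ⟨⟨θ, h_int⟩, rfl⟩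
  have hθ' : t ^ 3 = d := RingOfIntegers.ext (by simpa [ht] using hθ)
  have hη : (etaUnit hζ : 𝓞 F) ^ 2 + (etaUnit hζ : 𝓞 F) + 1 = 0 := by
    apply RingOfIntegers.ext
    have h1 := hζ.pow_eq_one
    have : (ζ - 1) * (ζ ^ 2 + ζ + 1) = 0 := by linear_combination h1
    simpa [coe_etaUnit] using (mul_eq_zero.mp this).resolve_left (sub_ne_zero.mpr hζ1)
  have hσθ' : σ • t = algebraMap (𝓞 F) (𝓞 K) (etaUnit hζ) * t := by
    apply RingOfIntegers.ext
    change σ (t : K) = algebraMap F K ((etaUnit hζ : 𝓞 F) : F) * t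
    rw [ht, hσζ, coe_etaUnit]
  have hnorm : IsCubicSetup.IsNormUnit (galRingEquiv σ) (etaUnit hζ) ↔
      ∀ p : ℕ, p.Prime → p ∣ d → p = 3 ∨ p % 9 = 1 ∨ p % 9 = 8 := by
    refine ⟨fun h p hp hpd ↦ ?_, isNormUnit_etaUnit_of_forall_prime hζ h3 hσ hd hθ hσζ⟩
    rw [or_iff_not_imp_left]
    intro hp3
    have : (span {(p : ℤ)}).IsPrime :=
      (span_singleton_prime (by exact_mod_cast hp.ne_zero)).mpr (Nat.prime_iff_prime_int.mp hp)
    obtain ⟨⟨Q, hQ, hQp⟩⟩ := (span {(p : ℤ)}).nonempty_primesOver (S := 𝓞 K)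
    have hpQ := (liesOver_span_natCast_iff hp).mp hQp
    have hQ0 : Q ≠ ⊥ := by
      rintro rfl
      exact hp.ne_zero (by exact_mod_cast (Ideal.mem_bot.mp hpQ))
    have hQS : Q ∈ ramifiedPrimes σ := mem_ramifiedPrimes_of_isRamifiedBelow h3 hθ' hη hdcf
      (Ideal.prime_of_isPrime hQ0 hQ) hp hpQ (Or.inl hpd)
    exact mod_nine_of_isNormUnit hζ h3 hσ h hQS hp hpQ hp3
  rw [card_fixedClass_eq_three_iff hζ h3 hσ, hnorm,
    ncard_ramifiedPrimes hθ' hη hσθ' h3 hσ hd hdcf]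

end KummerCriterion

section PureCubic

lemma mem_of_cbrtK_mem_of_zetaK_mem {d : ℕ} {S : Subfield (Kc d)} (hc : cbrtK d ∈ S)
    (hz : zetaK d ∈ S) (x : Kc d) : x ∈ S := by
  have h : ∀ (y : ℂ) (hy : y ∈ Kc d), (⟨y, hy⟩ : Kc d) ∈ S := by
    intro y hy
    refine IntermediateField.adjoin_induction ℚ (p := fun y hy ↦ (⟨y, hy⟩ : Kc d) ∈ S)
      ?_ ?_ ?_ ?_ ?_ hy
    · rintro y (rfl | rfl)
      · exact hc
      · exact hz
    · intro q
      exact SubfieldClass.ratCast_mem S q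
    · intro a b ha hb h1 h2
      exact add_mem h1 h2
    · intro a ha h1
      exact inv_mem h1
    · intro a b ha hb h1 h2
      exact mul_mem h1 h2
  exact h x.1 x.2

lemma adjoin_k0S_cbrtK (d : ℕ) : (k0S d)⟮cbrtK d⟯ = ⊤ := by
  rw [_root_.eq_top_iff]
  intro x _
  exact mem_of_cbrtK_mem_of_zetaK_mem (S := (k0S d)⟮cbrtK d⟯.toSubfield)
    (IntermediateField.mem_adjoin_simple_self _ _)
    ((k0S d)⟮cbrtK d⟯.algebraMap_mem (zetaK0 d)) x

lemma cbrtK_pow_three (d : ℕ) : cbrtK d ^ 3 = d :=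
  Subtype.ext (by simpa [cbrtK] using cbrt_pow_three d)

lemma zetaK_isPrimitiveRoot (d : ℕ) : IsPrimitiveRoot (zetaK d) 3 :=
  IsPrimitiveRoot.of_map_of_injective (f := (Kc d).val) zeta3_isPrimitiveRoot
    (Kc d).val.injective

lemma zetaK0_isPrimitiveRoot (d : ℕ) : IsPrimitiveRoot (zetaK0 d) 3 :=
  IsPrimitiveRoot.of_map_of_injective (f := (k0S d).val) (zetaK_isPrimitiveRoot d)
    (k0S d).val.injective

lemma isCyclotomicExtension_k0S (d : ℕ) : IsCyclotomicExtension {3} ℚ (k0S d) :=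
  (zetaK_isPrimitiveRoot d).intermediateField_adjoin_isCyclotomicExtension ℚ

variable {d : ℕ} {σ : ↥(Kc d) ≃ₐ[ℚ] ↥(Kc d)}

/-- An automorphism of `k` fixing `k₀`, as an element of the Galois group of `k/k₀`. -/
def galOfFix (hσfix : ∀ x : ↥(Kc d), x ∈ k0S d → σ x = x) : Gal(Kc d/k0S d) :=
  { σ with commutes' := fun x ↦ hσfix _ x.2 }

variable (hσfix : ∀ x : ↥(Kc d), x ∈ k0S d → σ x = x)

include hσfix in
lemma apply_cbrtK_ne (hσne : σ ≠ 1) : σ (cbrtK d) ≠ cbrtK d := by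
  intro h
  apply hσne
  ext1 x
  exact mem_of_cbrtK_mem_of_zetaK_mem
    (S := RingHom.eqLocusField (σ : Kc d →+* Kc d) (RingHom.id _)) h (hσfix _ (zetaK0 d).2) x

include hσfix in
lemma irreducible_X_pow_three_sub_C (hd : d ≠ 0) (hσne : σ ≠ 1) :
    Irreducible (Polynomial.X ^ 3 - Polynomial.C (d : k0S d)) := by
  rw [X_pow_sub_C_irreducible_iff_of_prime Nat.prime_three]
  intro b hb
  apply apply_cbrtK_ne hσfix hσne
  have hb0 : (b : Kc d) ≠ 0 := by
    intro h0
    rw [ZeroMemClass.coe_eq_zero] at h0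
    rw [h0, zero_pow three_ne_zero] at hb
    exact hd (by exact_mod_cast hb.symm)
  have hb3 : (b : Kc d) ^ 3 = d := by exact_mod_cast congrArg (algebraMap (k0S d) (Kc d)) hb
  obtain ⟨i, -, hi⟩ := (zetaK_isPrimitiveRoot d).eq_pow_of_pow_eq_one (ξ := cbrtK d / b) (by
    rw [div_pow, cbrtK_pow_three, hb3, div_self (by exact_mod_cast hd)])
  refine hσfix _ ?_
  rw [← div_mul_cancel₀ (cbrtK d) hb0, ← hi]
  exact mul_mem (pow_mem (zetaK0 d).2 i) b.2

include hσfix in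
lemma finrank_k0S (hd : d ≠ 0) (hσne : σ ≠ 1) : Module.finrank (k0S d) (Kc d) = 3 := by
  have hirr := irreducible_X_pow_three_sub_C hσfix hd hσne
  have h_int : IsIntegral (k0S d) (cbrtK d) := Algebra.IsIntegral.isIntegral _
  rw [← IntermediateField.finrank_top', ← adjoin_k0S_cbrtK, IntermediateField.adjoin.finrank h_int,
    ← minpoly.eq_of_irreducible_of_monic hirr (by simp [cbrtK_pow_three])
      (Polynomial.monic_X_pow_sub_C _ three_ne_zero), Polynomial.natDegree_X_pow_sub_C]

include hσfix in
lemma isGalois_k0S (hd : d ≠ 0) (hσne : σ ≠ 1) : IsGalois (k0S d) (Kc d) := by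
  have h3 := finrank_k0S hσfix hd hσne
  have hz : (primitiveRoots 3 (k0S d)).Nonempty :=
    ⟨zetaK0 d, (mem_primitiveRoots three_pos).mpr (zetaK0_isPrimitiveRoot d)⟩
  have hsplit := isSplittingField_X_pow_sub_C_of_root_adjoin_eq_top (K := k0S d) (L := Kc d)
    (a := (d : k0S d)) (by rwa [h3]) (by rw [h3, cbrtK_pow_three, map_natCast])
    (adjoin_k0S_cbrtK d)
  rw [h3] at hsplit
  exact isGalois_of_isSplittingField_X_pow_sub_C hz
    (irreducible_X_pow_three_sub_C hσfix hd hσne) (Kc d)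

end PureCubic

namespace IsCubicSetup

variable {R : Type} [CommRing R] [IsDedekindDomain R] {s : R ≃+* R} {c c' : ClassGroup R}

lemma IsFixedClass.mk0_eq (hc : IsFixedClass s c) {I J : (Ideal R)⁰}
    (hI : ClassGroup.mk0 I = c) (hJ : (J : Ideal R) = (I : Ideal R).map s) :
    ClassGroup.mk0 J = c := by
  obtain ⟨I', a, b, ha, hb, hI', hab⟩ := hc
  let J' : (Ideal R)⁰ := ⟨(I' : Ideal R).map s,
    mem_nonZeroDivisors_of_ne_zero (map_ne_zero (nonZeroDivisors.coe_ne_zero I'))⟩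
  have h1 : ClassGroup.mk0 J' = ClassGroup.mk0 I' :=
    ClassGroup.mk0_eq_mk0_iff.mpr ⟨b, a, hb, ha, hab⟩
  obtain ⟨x, y, hx, hy, hxy⟩ := ClassGroup.mk0_eq_mk0_iff.mp (hI.trans hI'.symm)
  have h2 := congrArg (Ideal.map s) hxy
  rw [Ideal.map_mul, Ideal.map_mul, Ideal.map_span, Ideal.map_span, Set.image_singleton,
    Set.image_singleton, ← hJ] at h2
  have h3 : ClassGroup.mk0 J = ClassGroup.mk0 J' :=
    ClassGroup.mk0_eq_mk0_iff.mpr ⟨s x, s y, (map_ne_zero_iff s s.injective).mpr hx,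
      (map_ne_zero_iff s s.injective).mpr hy, h2⟩
  rw [h3, h1, hI']

lemma isFixedClass_of_mk0_eq {I J : (Ideal R)⁰} (hI : ClassGroup.mk0 I = c)
    (hJ : (J : Ideal R) = (I : Ideal R).map s) (h : ClassGroup.mk0 J = c) : IsFixedClass s c := by
  obtain ⟨x, y, hx, hy, hxy⟩ := ClassGroup.mk0_eq_mk0_iff.mp (h.trans hI.symm)
  exact ⟨I, y, x, hy, hx, hI, by rw [← hJ, hxy]⟩

lemma isFixedClass_one : IsFixedClass s (1 : ClassGroup R) :=
  ⟨1, 1, 1, one_ne_zero, one_ne_zero, map_one _, by simp [Ideal.one_eq_top, Ideal.map_top]⟩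

lemma IsFixedClass.mul (hc : IsFixedClass s c) (hc' : IsFixedClass s c') :
    IsFixedClass s (c * c') := by
  obtain ⟨I, a, b, ha, hb, rfl, hab⟩ := hc
  obtain ⟨I', a', b', ha', hb', rfl, hab'⟩ := hc'
  refine ⟨I * I', a * a', b * b', mul_ne_zero ha ha', mul_ne_zero hb hb', map_mul _ _ _, ?_⟩
  rw [Submonoid.coe_mul, Ideal.map_mul, ← Ideal.span_singleton_mul_span_singleton,
    ← Ideal.span_singleton_mul_span_singleton, mul_mul_mul_comm, hab, hab', mul_mul_mul_comm]

end IsCubicSetup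

section PureCubic

variable {d : ℕ} {σ : ↥(Kc d) ≃ₐ[ℚ] ↥(Kc d)}
  (hσfix : ∀ x : ↥(Kc d), x ∈ k0S d → σ x = x)

lemma map_mapRingHom (I : Ideal (𝓞 (Kc d))) :
    I.map (RingOfIntegers.mapRingHom σ) = I.map (galRingEquiv (galOfFix hσfix)) := by
  unfold Ideal.map
  congr 1

lemma mem_ambiguousSet_iff (c : ClassGroup (𝓞 (Kc d))) :
    c ∈ ambiguousSet d σ ↔ IsCubicSetup.IsFixedClass (galRingEquiv (galOfFix hσfix)) c := by
  constructor
  · intro h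
    obtain ⟨I, hI⟩ := ClassGroup.mk0_surjective c
    let J : (Ideal (𝓞 (Kc d)))⁰ := ⟨(I : Ideal (𝓞 (Kc d))).map (galRingEquiv (galOfFix hσfix)),
      mem_nonZeroDivisors_of_ne_zero
        (IsCubicSetup.map_ne_zero (nonZeroDivisors.coe_ne_zero I))⟩
    exact IsCubicSetup.isFixedClass_of_mk0_eq hI (J := J) rfl
      (h I hI J (map_mapRingHom hσfix _).symm)
  · intro h I hI J hJ
    exact h.mk0_eq hI (hJ.trans (map_mapRingHom hσfix _))

theorem rank_ambiguousClassGroup_eq_one_iff_card (hd : d ≠ 0) (hσne : σ ≠ 1) :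
    Group.rank (ambiguousClassGroup d σ) = 1 ↔ Nat.card
      {c // IsCubicSetup.IsFixedClass (galRingEquiv (galOfFix hσfix)) c} = 3 := by
  have hcyc := isCyclotomicExtension_k0S d
  have hgal := isGalois_k0S hσfix hd hσne
  have hpid : IsPrincipalIdealRing (𝓞 (k0S d)) := IsCyclotomicExtension.Rat.three_pid (k0S d)
  have h3 := finrank_k0S hσfix hd hσne
  have hσ1 : galOfFix hσfix ≠ 1 := by
    intro h
    exact hσne (AlgEquiv.ext fun x ↦ congrArg (fun τ : Gal(Kc d/k0S d) ↦ τ x) h)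
  have hpow : ∀ c, IsCubicSetup.IsFixedClass (galRingEquiv (galOfFix hσfix)) c → c ^ 3 = 1 :=
    fun c hc ↦ IsCubicSetup.pow_three_of_isFixedClass (isCubicSetup_galRingEquiv h3 hσ1) hc
  have hmem : ∀ c, c ∈ ambiguousClassGroup d σ ↔
      IsCubicSetup.IsFixedClass (galRingEquiv (galOfFix hσfix)) c := by
    intro c
    refine ⟨fun h ↦ ?_, fun h ↦ ⟨?_, ?_⟩⟩
    · refine Subgroup.closure_induction (fun x hx ↦ (mem_ambiguousSet_iff hσfix x).mp hx)
        IsCubicSetup.isFixedClass_one (fun x y _ _ hx hy ↦ hx.mul hy) (fun x _ hx ↦ ?_) h.2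
      have : x⁻¹ = x * x := by
        rw [inv_eq_iff_mul_eq_one, ← pow_three, hpow x hx]
      rw [this]
      exact hx.mul hx
    · exact CommGroup.mem_primaryComponent.mpr ⟨1, by simpa using hpow c h⟩
    · exact Subgroup.subset_closure ((mem_ambiguousSet_iff hσfix c).mpr h)
  rw [Group.rank_eq_one_iff_card fun x ↦ Subtype.ext (hpow _ ((hmem _).mp x.2)),
    Nat.card_congr (Equiv.subtypeEquivRight hmem)]

end PureCubic

/-- The residue class of `n` modulo `9` is that of `1` or `-1`. -/
def IsPMOne (n : ℕ) : Prop := n % 9 = 1 ∨ n % 9 = 8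

instance : DecidablePred IsPMOne := fun n ↦ inferInstanceAs (Decidable (n % 9 = 1 ∨ n % 9 = 8))

lemma isPMOne_mul_iff {a b : ℕ} (ha : IsPMOne a) : IsPMOne (a * b) ↔ IsPMOne b := by
  unfold IsPMOne at *
  rw [Nat.mul_mod]
  have := Nat.mod_lt b (show 9 > 0 by norm_num)
  generalize b % 9 = r at *
  rcases ha with ha | ha <;> rw [ha] <;> interval_cases r <;> simp

lemma isPMOne_mul_iff' {a b : ℕ} (hb : IsPMOne b) : IsPMOne (a * b) ↔ IsPMOne a := by
  rw [mul_comm, isPMOne_mul_iff hb]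

lemma isPMOne_pow_iff {p e : ℕ} (he : e = 1 ∨ e = 2) : IsPMOne (p ^ e) ↔ IsPMOne p := by
  unfold IsPMOne
  rw [Nat.pow_mod]
  have := Nat.mod_lt p (show 9 > 0 by norm_num)
  generalize p % 9 = r at *
  rcases he with rfl | rfl <;> interval_cases r <;> simp

lemma not_isPMOne_of_three_dvd {n : ℕ} (h : 3 ∣ n) : ¬ IsPMOne n := by
  unfold IsPMOne
  omega

lemma prime_mod_three {p : ℕ} (hp : p.Prime) (h3 : p ≠ 3) : p % 3 = 1 ∨ p % 3 = 2 := by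
  have : ¬ 3 ∣ p := fun h ↦ h3 ((Nat.prime_dvd_prime_iff_eq Nat.prime_three hp).mp h).symm
  omega

/-- The contribution of a prime `p` dividing `d` to the number of ramified primes. -/
def primeWeight (p : ℕ) : ℕ := if p = 3 then 0 else if p % 3 = 1 then 2 else 1

lemma primeWeight_three : primeWeight 3 = 0 := rfl

lemma primeWeight_of_mod_eq_one {p : ℕ} (h : p % 3 = 1) : primeWeight p = 2 := by
  unfold primeWeight
  rw [if_neg (by omega), if_pos h]

lemma primeWeight_of_mod_eq_two {p : ℕ} (h : p % 3 = 2) : primeWeight p = 1 := by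
  unfold primeWeight
  rw [if_neg (by omega), if_neg (by omega)]

lemma sum_primesBelow (d : ℕ) :
    (∑ p ∈ primesBelow d, if p % 3 = 1 then 2 else 1) =
      (if IsPMOne d then 0 else 1) + ∑ p ∈ d.primeFactors, primeWeight p := by
  have hw : ∀ p ∈ d.primeFactors.erase 3, primeWeight p = if p % 3 = 1 then 2 else 1 := by
    intro p hp
    rw [primeWeight, if_neg (Finset.ne_of_mem_erase hp)]
  have herase : ∑ p ∈ d.primeFactors, primeWeight p =
      ∑ p ∈ d.primeFactors.erase 3, if p % 3 = 1 then 2 else 1 := by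
    rw [← Finset.sum_congr rfl hw]
    exact (Finset.sum_erase _ primeWeight_three).symm
  rw [herase]
  by_cases h : IsPMOne d
  · have h3 : 3 ∉ d.primeFactors := fun h' ↦
      not_isPMOne_of_three_dvd (Nat.dvd_of_mem_primeFactors h') h
    rw [if_pos h, primesBelow, if_pos (show d % 9 = 1 ∨ d % 9 = 8 from h),
      Finset.union_empty, Finset.erase_eq_of_notMem h3, zero_add]
  · have : primesBelow d = insert 3 (d.primeFactors.erase 3) := by
      rw [primesBelow, if_neg (show ¬ (d % 9 = 1 ∨ d % 9 = 8) from h)]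
      ext p
      by_cases hp : p = 3 <;> simp [hp]
    rw [if_neg h, this, Finset.sum_insert (Finset.notMem_erase _ _)]
    rfl

lemma forall_prime_dvd_iff {d : ℕ} (hd : d ≠ 0) :
    (∀ p : ℕ, p.Prime → p ∣ d → p = 3 ∨ p % 9 = 1 ∨ p % 9 = 8) ↔
      ∀ p ∈ d.primeFactors, p = 3 ∨ IsPMOne p := by
  simp only [Nat.mem_primeFactors, IsPMOne]
  exact ⟨fun h p hp ↦ h p hp.1 hp.2.1, fun h p hp hpd ↦ h p ⟨hp, hpd, hd⟩⟩

lemma primeFactors_mul_prime_pow {m p e : ℕ} (hm : m ≠ 0) (hp : p.Prime) (he : e = 1 ∨ e = 2) :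
    (m * p ^ e).primeFactors = insert p m.primeFactors := by
  rw [Nat.primeFactors_mul hm (pow_ne_zero _ hp.ne_zero),
    Nat.primeFactors_prime_pow (by omega) hp, Finset.union_comm, Finset.singleton_union]

lemma IsCubeFree.factorization_eq {d p : ℕ} (h : IsCubeFree d) (hp : p ∈ d.primeFactors) :
    d.factorization p = 1 ∨ d.factorization p = 2 := by
  have hprime := Nat.prime_of_mem_primeFactors hp
  have h0 : d ≠ 0 := (Nat.mem_primeFactors.mp hp).2.2
  have h1 := (hprime.dvd_iff_one_le_factorization h0).mp (Nat.dvd_of_mem_primeFactors hp)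
  have h2 : ¬ 3 ≤ d.factorization p := fun h' ↦
    h p hprime ((hprime.pow_dvd_iff_le_factorization h0).mpr h')
  omega

/-- The finite sets of primes different from `3` of total weight at most `3`. -/
lemma eq_of_sum_primeWeight_le_three {T : Finset ℕ} (hT : ∀ p ∈ T, p.Prime ∧ p ≠ 3)
    (h : ∑ p ∈ T, primeWeight p ≤ 3) :
    T = ∅ ∨ (∃ p, p % 3 = 1 ∧ T = {p}) ∨ (∃ q, q % 3 = 2 ∧ T = {q}) ∨
    (∃ p q, p ≠ q ∧ p % 3 = 1 ∧ q % 3 = 2 ∧ T = {p, q}) ∨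
    (∃ p q, p ≠ q ∧ p % 3 = 2 ∧ q % 3 = 2 ∧ T = {p, q}) ∨
    (∃ p q r, p ≠ q ∧ p ≠ r ∧ q ≠ r ∧ p % 3 = 2 ∧ q % 3 = 2 ∧ r % 3 = 2 ∧ T = {p, q, r}) := by
  have hmod : ∀ p ∈ T, p % 3 = 1 ∧ primeWeight p = 2 ∨ p % 3 = 2 ∧ primeWeight p = 1 := by
    intro p hp
    rcases prime_mod_three (hT p hp).1 (hT p hp).2 with h1 | h1
    · exact Or.inl ⟨h1, primeWeight_of_mod_eq_one h1⟩
    · exact Or.inr ⟨h1, primeWeight_of_mod_eq_two h1⟩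
  have hcard : T.card ≤ 3 := by
    refine le_trans ?_ h
    rw [Finset.card_eq_sum_ones]
    refine Finset.sum_le_sum fun p hp ↦ ?_
    rcases hmod p hp with h1 | h1 <;> omega
  obtain h0 | h0 | h0 | h0 : T.card = 0 ∨ T.card = 1 ∨ T.card = 2 ∨ T.card = 3 := by omega
  · exact Or.inl (Finset.card_eq_zero.mp h0)
  · obtain ⟨p, rfl⟩ := Finset.card_eq_one.mp h0
    rcases hmod p (by simp) with h1 | h1
    · exact Or.inr (Or.inl ⟨p, h1.1, rfl⟩)
    · exact Or.inr (Or.inr (Or.inl ⟨p, h1.1, rfl⟩))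
  · obtain ⟨p, q, hpq, rfl⟩ := Finset.card_eq_two.mp h0
    rw [Finset.sum_pair hpq] at h
    rcases hmod p (by simp) with h1 | h1 <;> rcases hmod q (by simp) with h2 | h2
    · omega
    · exact Or.inr (Or.inr (Or.inr (Or.inl ⟨p, q, hpq, h1.1, h2.1, rfl⟩)))
    · exact Or.inr (Or.inr (Or.inr (Or.inl ⟨q, p, hpq.symm, h2.1, h1.1, Finset.pair_comm _ _⟩)))
    · exact Or.inr (Or.inr (Or.inr (Or.inr (Or.inl ⟨p, q, hpq, h1.1, h2.1, rfl⟩))))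
  · obtain ⟨p, q, r, hpq, hpr, hqr, rfl⟩ := Finset.card_eq_three.mp h0
    rw [Finset.sum_insert (by simp [hpq, hpr]), Finset.sum_pair hqr] at h
    have h1 := hmod p (by simp)
    have h2 := hmod q (by simp)
    have h3 := hmod r (by simp)
    exact Or.inr (Or.inr (Or.inr (Or.inr (Or.inr ⟨p, q, r, hpq, hpr, hqr, by omega, by omega,
      by omega, rfl⟩))))

lemma IsCubeFree.exists_eq_prod {d : ℕ} (h : IsCubeFree d) (hd : d ≠ 0) :
    ∃ f : ℕ → ℕ, (∀ p ∈ d.primeFactors, f p = 1 ∨ f p = 2) ∧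
      (d = ∏ p ∈ d.primeFactors.erase 3, p ^ f p ∨
        ∃ e, (e = 1 ∨ e = 2) ∧ d = 3 ^ e * ∏ p ∈ d.primeFactors.erase 3, p ^ f p) := by
  refine ⟨d.factorization, fun p hp ↦ h.factorization_eq hp, ?_⟩
  have hprod : ∏ p ∈ d.primeFactors, p ^ d.factorization p = d :=
    Nat.prod_factorization_pow_eq_self hd
  by_cases h3 : 3 ∈ d.primeFactors
  · refine Or.inr ⟨d.factorization 3, h.factorization_eq h3, ?_⟩
    rw [Finset.mul_prod_erase _ (fun p ↦ p ^ d.factorization p) h3, hprod]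
  · rw [Finset.erase_eq_of_notMem h3]
    exact Or.inl hprod.symm

/-- The criterion on the ramification of `ℚ(∛d, ζ₃) / ℚ(ζ₃)`: either there are two
ramified primes and all units are local norms, or there are three and some unit is not. -/
def RamificationCriterion (d : ℕ) : Prop :=
  ((if IsPMOne d then 0 else 1) + ∑ p ∈ d.primeFactors, primeWeight p = 2 ∧
    ∀ p ∈ d.primeFactors, p = 3 ∨ IsPMOne p) ∨
  ((if IsPMOne d then 0 else 1) + ∑ p ∈ d.primeFactors, primeWeight p = 3 ∧
    ¬ ∀ p ∈ d.primeFactors, p = 3 ∨ IsPMOne p)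

lemma primeFactors_prime_pow {p e : ℕ} (hp : p.Prime) (he : e = 1 ∨ e = 2) :
    (p ^ e).primeFactors = {p} :=
  Nat.primeFactors_prime_pow (by omega) hp

lemma not_isPMOne_three_pow_mul {e m : ℕ} (he : e = 1 ∨ e = 2) : ¬ IsPMOne (3 ^ e * m) :=
  not_isPMOne_of_three_dvd (Dvd.dvd.mul_right (dvd_pow_self 3 (by omega)) m)

theorem exists_form_of_ramificationCriterion {d : ℕ} (hd : 1 < d) (hdcf : IsCubeFree d)
    (h : RamificationCriterion d) :
      ((∃ p e₁ : ℕ, p.Prime ∧ p % 3 = 1 ∧ (e₁ = 1 ∨ e₁ = 2) ∧ d = p ^ e₁) ∨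
      (∃ p e e₁ : ℕ, p.Prime ∧ (p % 9 = 4 ∨ p % 9 = 7) ∧ (e = 1 ∨ e = 2) ∧ (e₁ = 1 ∨ e₁ = 2) ∧
        d = 3 ^ e * p ^ e₁) ∨
      (∃ p q e₁ f₁ : ℕ, p.Prime ∧ q.Prime ∧ (p % 9 = 4 ∨ p % 9 = 7) ∧
        (q % 9 = 2 ∨ q % 9 = 5) ∧ (e₁ = 1 ∨ e₁ = 2) ∧ (f₁ = 1 ∨ f₁ = 2) ∧
        d = p ^ e₁ * q ^ f₁ ∧ (d % 9 = 1 ∨ d % 9 = 8)) ∨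
      (∃ q e f₁ : ℕ, q.Prime ∧ q % 9 = 8 ∧ (e = 1 ∨ e = 2) ∧ (f₁ = 1 ∨ f₁ = 2) ∧
        d = 3 ^ e * q ^ f₁) ∨
      (∃ q₁ q₂ f₁ f₂ : ℕ, q₁.Prime ∧ q₂.Prime ∧ q₁ ≠ q₂ ∧ q₁ % 9 = 8 ∧ q₂ % 9 = 8 ∧
        (f₁ = 1 ∨ f₁ = 2) ∧ (f₂ = 1 ∨ f₂ = 2) ∧ d = q₁ ^ f₁ * q₂ ^ f₂) ∨
      (∃ q₁ q₂ f₁ f₂ : ℕ, q₁.Prime ∧ q₂.Prime ∧ q₁ ≠ q₂ ∧ q₁ % 3 = 2 ∧ q₂ % 3 = 2 ∧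
        (q₁ % 9 ≠ 8 ∨ q₂ % 9 ≠ 8) ∧ (f₁ = 1 ∨ f₁ = 2) ∧ (f₂ = 1 ∨ f₂ = 2) ∧
        d = q₁ ^ f₁ * q₂ ^ f₂ ∧ ¬(d % 9 = 1 ∨ d % 9 = 8)) ∨
      (∃ q₁ q₂ e f₁ f₂ : ℕ, q₁.Prime ∧ q₂.Prime ∧ q₁ ≠ q₂ ∧ q₁ % 3 = 2 ∧ q₂ % 3 = 2 ∧
        (q₁ % 9 ≠ 8 ∨ q₂ % 9 ≠ 8) ∧ (e = 1 ∨ e = 2) ∧ (f₁ = 1 ∨ f₁ = 2) ∧ (f₂ = 1 ∨ f₂ = 2) ∧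
        d = 3 ^ e * q₁ ^ f₁ * q₂ ^ f₂) ∨
      (∃ q₁ q₂ q₃ f₁ f₂ f₃ : ℕ, q₁.Prime ∧ q₂.Prime ∧ q₃.Prime ∧
        q₁ ≠ q₂ ∧ q₁ ≠ q₃ ∧ q₂ ≠ q₃ ∧
        (q₁ % 9 = 2 ∨ q₁ % 9 = 5) ∧ (q₂ % 9 = 2 ∨ q₂ % 9 = 5) ∧ q₃ % 9 = 8 ∧
        (f₁ = 1 ∨ f₁ = 2) ∧ (f₂ = 1 ∨ f₂ = 2) ∧ (f₃ = 1 ∨ f₃ = 2) ∧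
        d = q₁ ^ f₁ * q₂ ^ f₂ * q₃ ^ f₃ ∧ (d % 9 = 1 ∨ d % 9 = 8)) ∨
      (∃ q₁ q₂ q₃ f₁ f₂ f₃ : ℕ, q₁.Prime ∧ q₂.Prime ∧ q₃.Prime ∧
        q₁ ≠ q₂ ∧ q₁ ≠ q₃ ∧ q₂ ≠ q₃ ∧
        (q₁ % 9 = 2 ∨ q₁ % 9 = 5) ∧ (q₂ % 9 = 2 ∨ q₂ % 9 = 5) ∧ (q₃ % 9 = 2 ∨ q₃ % 9 = 5) ∧
        (f₁ = 1 ∨ f₁ = 2) ∧ (f₂ = 1 ∨ f₂ = 2) ∧ (f₃ = 1 ∨ f₃ = 2) ∧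
        d = q₁ ^ f₁ * q₂ ^ f₂ * q₃ ^ f₃ ∧ (d % 9 = 1 ∨ d % 9 = 8))) := by
  obtain ⟨f, hf, hprod⟩ := hdcf.exists_eq_prod (by omega)
  have hS : ∑ p ∈ d.primeFactors.erase 3, primeWeight p = ∑ p ∈ d.primeFactors, primeWeight p :=
    Finset.sum_erase _ primeWeight_three
  have hall : (∀ p ∈ d.primeFactors, p = 3 ∨ IsPMOne p) ↔
      ∀ p ∈ d.primeFactors.erase 3, IsPMOne p := by
    simp only [Finset.mem_erase]
    exact ⟨fun h p hp ↦ (h p hp.2).resolve_left hp.1,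
      fun h p hp ↦ or_iff_not_imp_left.mpr fun h3 ↦ h p ⟨h3, hp⟩⟩
  have hT : ∀ p ∈ d.primeFactors.erase 3, p.Prime ∧ p ≠ 3 := fun p hp ↦
    ⟨Nat.prime_of_mem_primeFactors (Finset.mem_of_mem_erase hp), Finset.ne_of_mem_erase hp⟩
  replace hf : ∀ p ∈ d.primeFactors.erase 3, f p = 1 ∨ f p = 2 := fun p hp ↦
    hf p (Finset.mem_of_mem_erase hp)
  unfold RamificationCriterion at h
  rw [hall, ← hS] at h
  clear hS hall
  generalize d.primeFactors.erase 3 = T at *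
  rcases eq_of_sum_primeWeight_le_three hT (by omega) with rfl | ⟨p, hp, rfl⟩ | ⟨q, hq, rfl⟩ |
    ⟨p, q, hpq, hp, hq, rfl⟩ | ⟨p, q, hpq, hp, hq, rfl⟩ | ⟨p, q, r, hpq, hpr, hqr, hp, hq, hr, rfl⟩
  · rw [Finset.sum_empty] at h
    exfalso
    rcases h with ⟨h, -⟩ | ⟨h, -⟩ <;> split_ifs at h <;> omega
  · rw [Finset.sum_singleton, primeWeight_of_mod_eq_one hp] at h
    simp only [Finset.mem_singleton, forall_eq, Finset.prod_singleton] at h hT hf hprod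
    rcases hprod with hprod | ⟨e, he, hprod⟩
    · exact Or.inl ⟨p, f p, hT.1, hp, hf, hprod⟩
    · rw [if_neg (hprod ▸ not_isPMOne_three_pow_mul he)] at h
      refine Or.inr (Or.inl ⟨p, e, f p, hT.1, ?_, he, hf, hprod⟩)
      unfold IsPMOne at h
      omega
  · rw [Finset.sum_singleton, primeWeight_of_mod_eq_two hq] at h
    simp only [Finset.mem_singleton, forall_eq, Finset.prod_singleton] at h hT hf hprod
    rcases hprod with hprod | ⟨e, he, hprod⟩
    · have hiff : IsPMOne d ↔ IsPMOne q := by rw [hprod, isPMOne_pow_iff hf]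
      by_cases h1 : IsPMOne q <;> simp [hiff, h1] at h
    · rw [if_neg (hprod ▸ not_isPMOne_three_pow_mul he)] at h
      refine Or.inr (Or.inr (Or.inr (Or.inl ⟨q, e, f q, hT.1, ?_, he, hf, hprod⟩)))
      unfold IsPMOne at h
      omega
  · rw [Finset.sum_pair hpq, primeWeight_of_mod_eq_one hp, primeWeight_of_mod_eq_two hq] at h
    simp only [Finset.mem_insert, Finset.mem_singleton, forall_eq_or_imp, forall_eq,
      Finset.prod_pair hpq] at h hT hf hprod
    have h1 : IsPMOne d := by
      by_contra h1
      rw [if_neg h1] at h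
      omega
    rw [if_pos h1] at h
    rcases hprod with hprod | ⟨e, he, hprod⟩
    · refine Or.inr (Or.inr (Or.inl ⟨p, q, f p, f q, hT.1.1, hT.2.1, ?_, ?_, hf.1, hf.2, hprod,
        h1⟩))
      all_goals
        rw [hprod] at h1
        by_cases h2 : IsPMOne p
        · rw [isPMOne_mul_iff ((isPMOne_pow_iff hf.1).mpr h2), isPMOne_pow_iff hf.2] at h1
          simp [h1, h2] at h
        by_cases h3 : IsPMOne q
        · rw [isPMOne_mul_iff' ((isPMOne_pow_iff hf.2).mpr h3), isPMOne_pow_iff hf.1] at h1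
          exact absurd h1 h2
        unfold IsPMOne at h2 h3
        omega
    · exact absurd h1 (hprod ▸ not_isPMOne_three_pow_mul he)
  · rw [Finset.sum_pair hpq, primeWeight_of_mod_eq_two hp, primeWeight_of_mod_eq_two hq] at h
    simp only [Finset.mem_insert, Finset.mem_singleton, forall_eq_or_imp, forall_eq,
      Finset.prod_pair hpq] at h hT hf hprod
    rcases hprod with hprod | ⟨e, he, hprod⟩
    · by_cases h1 : IsPMOne d
      · rw [if_pos h1] at h
        refine Or.inr (Or.inr (Or.inr (Or.inr (Or.inl ⟨p, q, f p, f q, hT.1.1, hT.2.1, hpq, ?_, ?_,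
          hf.1, hf.2, hprod⟩))))
        all_goals
          unfold IsPMOne at h
          omega
      · rw [if_neg h1] at h
        refine Or.inr (Or.inr (Or.inr (Or.inr (Or.inr (Or.inl ⟨p, q, f p, f q, hT.1.1, hT.2.1, hpq,
          hp, hq, ?_, hf.1, hf.2, hprod, h1⟩)))))
        unfold IsPMOne at h
        omega
    · rw [if_neg (hprod ▸ not_isPMOne_three_pow_mul he)] at h
      refine Or.inr (Or.inr (Or.inr (Or.inr (Or.inr (Or.inr (Or.inl ⟨p, q, e, f p, f q, hT.1.1,
        hT.2.1, hpq, hp, hq, ?_, he, hf.1, hf.2, by rw [hprod, mul_assoc]⟩))))))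
      unfold IsPMOne at h
      omega
  · rw [Finset.sum_insert (by simp [hpq, hpr]), Finset.sum_pair hqr, primeWeight_of_mod_eq_two hp,
      primeWeight_of_mod_eq_two hq, primeWeight_of_mod_eq_two hr] at h
    rw [Finset.prod_insert (by simp [hpq, hpr]), Finset.prod_pair hqr] at hprod
    simp only [Finset.mem_insert, Finset.mem_singleton, forall_eq_or_imp, forall_eq] at h hT hf
    have h1 : IsPMOne d := by
      by_contra h1
      rw [if_neg h1] at h
      omega
    rw [if_pos h1] at h
    obtain ⟨⟨hpp, -⟩, ⟨hqp, -⟩, hrp, -⟩ := hT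
    obtain ⟨hfp, hfq, hfr⟩ := hf
    rcases hprod with hprod | ⟨e, he, hprod⟩
    · have h2 := h1
      rw [hprod] at h2
      by_cases hp1 : IsPMOne p
      · rw [isPMOne_mul_iff ((isPMOne_pow_iff hfp).mpr hp1)] at h2
        have hq1 : ¬ IsPMOne q := by
          intro hq1
          rw [isPMOne_mul_iff ((isPMOne_pow_iff hfq).mpr hq1), isPMOne_pow_iff hfr] at h2
          simp [hp1, hq1, h2] at h
        have hr1 : ¬ IsPMOne r := by
          intro hr1
          rw [isPMOne_mul_iff' ((isPMOne_pow_iff hfr).mpr hr1), isPMOne_pow_iff hfq] at h2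
          exact hq1 h2
        unfold IsPMOne at hp1 hq1 hr1
        exact Or.inr (Or.inr (Or.inr (Or.inr (Or.inr (Or.inr (Or.inr (Or.inl ⟨q, r, p, f q, f r,
          f p, hqp, hrp, hpp, hqr, hpq.symm, hpr.symm, by omega, by omega, by omega, hfq, hfr, hfp,
          by rw [hprod, mul_comm], h1⟩)))))))
      have hqr1 : ¬ (IsPMOne q ∧ IsPMOne r) := by
        rintro ⟨hq1, hr1⟩
        rw [isPMOne_mul_iff' ((isPMOne_mul_iff ((isPMOne_pow_iff hfq).mpr hq1)).mpr
          ((isPMOne_pow_iff hfr).mpr hr1)), isPMOne_pow_iff hfp] at h2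
        exact hp1 h2
      by_cases hq1 : IsPMOne q
      · have hr1 : ¬ IsPMOne r := fun hr1 ↦ hqr1 ⟨hq1, hr1⟩
        unfold IsPMOne at hp1 hq1 hr1
        exact Or.inr (Or.inr (Or.inr (Or.inr (Or.inr (Or.inr (Or.inr (Or.inl ⟨p, r, q, f p, f r,
          f q, hpp, hrp, hqp, hpr, hpq, hqr.symm, by omega, by omega, by omega, hfp, hfr, hfq,
          by rw [hprod]; ring, h1⟩)))))))
      by_cases hr1 : IsPMOne r
      · unfold IsPMOne at hp1 hq1 hr1
        exact Or.inr (Or.inr (Or.inr (Or.inr (Or.inr (Or.inr (Or.inr (Or.inl ⟨p, q, r, f p, f q,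
          f r, hpp, hqp, hrp, hpq, hpr, hqr, by omega, by omega, by omega, hfp, hfq, hfr,
          by rw [hprod, mul_assoc], h1⟩)))))))
      · unfold IsPMOne at hp1 hq1 hr1
        exact Or.inr (Or.inr (Or.inr (Or.inr (Or.inr (Or.inr (Or.inr (Or.inr ⟨p, q, r, f p, f q,
          f r, hpp, hqp, hrp, hpq, hpr, hqr, by omega, by omega, by omega, hfp, hfq, hfr,
          by rw [hprod, mul_assoc], h1⟩)))))))
    · exact absurd h1 (hprod ▸ not_isPMOne_three_pow_mul he)

theorem ramificationCriterion_of_exists_form {d : ℕ} (h :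
      ((∃ p e₁ : ℕ, p.Prime ∧ p % 3 = 1 ∧ (e₁ = 1 ∨ e₁ = 2) ∧ d = p ^ e₁) ∨
      (∃ p e e₁ : ℕ, p.Prime ∧ (p % 9 = 4 ∨ p % 9 = 7) ∧ (e = 1 ∨ e = 2) ∧ (e₁ = 1 ∨ e₁ = 2) ∧
        d = 3 ^ e * p ^ e₁) ∨
      (∃ p q e₁ f₁ : ℕ, p.Prime ∧ q.Prime ∧ (p % 9 = 4 ∨ p % 9 = 7) ∧
        (q % 9 = 2 ∨ q % 9 = 5) ∧ (e₁ = 1 ∨ e₁ = 2) ∧ (f₁ = 1 ∨ f₁ = 2) ∧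
        d = p ^ e₁ * q ^ f₁ ∧ (d % 9 = 1 ∨ d % 9 = 8)) ∨
      (∃ q e f₁ : ℕ, q.Prime ∧ q % 9 = 8 ∧ (e = 1 ∨ e = 2) ∧ (f₁ = 1 ∨ f₁ = 2) ∧
        d = 3 ^ e * q ^ f₁) ∨
      (∃ q₁ q₂ f₁ f₂ : ℕ, q₁.Prime ∧ q₂.Prime ∧ q₁ ≠ q₂ ∧ q₁ % 9 = 8 ∧ q₂ % 9 = 8 ∧
        (f₁ = 1 ∨ f₁ = 2) ∧ (f₂ = 1 ∨ f₂ = 2) ∧ d = q₁ ^ f₁ * q₂ ^ f₂) ∨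
      (∃ q₁ q₂ f₁ f₂ : ℕ, q₁.Prime ∧ q₂.Prime ∧ q₁ ≠ q₂ ∧ q₁ % 3 = 2 ∧ q₂ % 3 = 2 ∧
        (q₁ % 9 ≠ 8 ∨ q₂ % 9 ≠ 8) ∧ (f₁ = 1 ∨ f₁ = 2) ∧ (f₂ = 1 ∨ f₂ = 2) ∧
        d = q₁ ^ f₁ * q₂ ^ f₂ ∧ ¬(d % 9 = 1 ∨ d % 9 = 8)) ∨
      (∃ q₁ q₂ e f₁ f₂ : ℕ, q₁.Prime ∧ q₂.Prime ∧ q₁ ≠ q₂ ∧ q₁ % 3 = 2 ∧ q₂ % 3 = 2 ∧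
        (q₁ % 9 ≠ 8 ∨ q₂ % 9 ≠ 8) ∧ (e = 1 ∨ e = 2) ∧ (f₁ = 1 ∨ f₁ = 2) ∧ (f₂ = 1 ∨ f₂ = 2) ∧
        d = 3 ^ e * q₁ ^ f₁ * q₂ ^ f₂) ∨
      (∃ q₁ q₂ q₃ f₁ f₂ f₃ : ℕ, q₁.Prime ∧ q₂.Prime ∧ q₃.Prime ∧
        q₁ ≠ q₂ ∧ q₁ ≠ q₃ ∧ q₂ ≠ q₃ ∧
        (q₁ % 9 = 2 ∨ q₁ % 9 = 5) ∧ (q₂ % 9 = 2 ∨ q₂ % 9 = 5) ∧ q₃ % 9 = 8 ∧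
        (f₁ = 1 ∨ f₁ = 2) ∧ (f₂ = 1 ∨ f₂ = 2) ∧ (f₃ = 1 ∨ f₃ = 2) ∧
        d = q₁ ^ f₁ * q₂ ^ f₂ * q₃ ^ f₃ ∧ (d % 9 = 1 ∨ d % 9 = 8)) ∨
      (∃ q₁ q₂ q₃ f₁ f₂ f₃ : ℕ, q₁.Prime ∧ q₂.Prime ∧ q₃.Prime ∧
        q₁ ≠ q₂ ∧ q₁ ≠ q₃ ∧ q₂ ≠ q₃ ∧
        (q₁ % 9 = 2 ∨ q₁ % 9 = 5) ∧ (q₂ % 9 = 2 ∨ q₂ % 9 = 5) ∧ (q₃ % 9 = 2 ∨ q₃ % 9 = 5) ∧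
        (f₁ = 1 ∨ f₁ = 2) ∧ (f₂ = 1 ∨ f₂ = 2) ∧ (f₃ = 1 ∨ f₃ = 2) ∧
        d = q₁ ^ f₁ * q₂ ^ f₂ * q₃ ^ f₃ ∧ (d % 9 = 1 ∨ d % 9 = 8)))) : RamificationCriterion d := by
  unfold RamificationCriterion
  rcases h with ⟨p, e, hp, h3, he, rfl⟩ | ⟨p, e, f, hp, h9, he, hf, rfl⟩ |
    ⟨p, q, e, f, hp, hq, hp9, hq9, he, hf, rfl, hd⟩ | ⟨q, e, f, hq, hq9, he, hf, rfl⟩ |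
    ⟨p, q, e, f, hp, hq, hpq, hp9, hq9, he, hf, rfl⟩ |
    ⟨p, q, e, f, hp, hq, hpq, hp9, hq9, h9, he, hf, rfl, hd⟩ |
    ⟨p, q, g, e, f, hp, hq, hpq, hp9, hq9, h9, hg, he, hf, rfl⟩ |
    ⟨p, q, r, e, f, g, hp, hq, hr, hpq, hpr, hqr, hp9, hq9, hr9, he, hf, hg, rfl, hd⟩ |
    ⟨p, q, r, e, f, g, hp, hq, hr, hpq, hpr, hqr, hp9, hq9, hr9, he, hf, hg, rfl, hd⟩
  · rw [primeFactors_prime_pow hp he]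
    simp only [isPMOne_pow_iff he, Finset.sum_singleton, primeWeight_of_mod_eq_one h3, Finset.mem_singleton, forall_eq]
    by_cases h : IsPMOne p
    · simp [h]
    · have : p ≠ 3 := by omega
      simp [h, this]
  · have h3 : 3 ≠ p := by omega
    rw [if_neg (not_isPMOne_three_pow_mul he), primeFactors_mul_prime_pow (by positivity) hp hf,
      primeFactors_prime_pow Nat.prime_three he, Finset.sum_pair h3.symm, primeWeight_three,
      primeWeight_of_mod_eq_one (by omega)]
    simp only [Finset.mem_insert, Finset.mem_singleton, forall_eq_or_imp, forall_eq,
      true_or, and_true]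
    unfold IsPMOne
    omega
  · rw [if_pos (show IsPMOne _ from hd), primeFactors_mul_prime_pow (pow_ne_zero _ hp.ne_zero) hq hf,
      primeFactors_prime_pow hp he, Finset.sum_pair (by omega),
      primeWeight_of_mod_eq_two (by omega), primeWeight_of_mod_eq_one (by omega)]
    simp only [Finset.mem_insert, Finset.mem_singleton, forall_eq_or_imp, forall_eq]
    unfold IsPMOne
    omega
  · rw [if_neg (not_isPMOne_three_pow_mul he), primeFactors_mul_prime_pow (by positivity) hq hf,
      primeFactors_prime_pow Nat.prime_three he, Finset.sum_pair (by omega), primeWeight_three,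
      primeWeight_of_mod_eq_two (by omega)]
    simp only [Finset.mem_insert, Finset.mem_singleton, forall_eq_or_imp, forall_eq,
      true_or, and_true]
    unfold IsPMOne
    omega
  · have hd : IsPMOne (p ^ e * q ^ f) :=
      (isPMOne_mul_iff ((isPMOne_pow_iff he).mpr (Or.inr hp9))).mpr
        ((isPMOne_pow_iff hf).mpr (Or.inr hq9))
    rw [if_pos (show IsPMOne _ from hd), primeFactors_mul_prime_pow (pow_ne_zero _ hp.ne_zero) hq hf,
      primeFactors_prime_pow hp he, Finset.sum_pair hpq.symm,
      primeWeight_of_mod_eq_two (by omega), primeWeight_of_mod_eq_two (by omega)]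
    simp only [Finset.mem_insert, Finset.mem_singleton, forall_eq_or_imp, forall_eq]
    unfold IsPMOne
    omega
  · rw [if_neg (show ¬ IsPMOne _ from hd), primeFactors_mul_prime_pow (pow_ne_zero _ hp.ne_zero) hq hf,
      primeFactors_prime_pow hp he, Finset.sum_pair hpq.symm,
      primeWeight_of_mod_eq_two (by omega), primeWeight_of_mod_eq_two (by omega)]
    simp only [Finset.mem_insert, Finset.mem_singleton, forall_eq_or_imp, forall_eq]
    unfold IsPMOne
    omega
  · have h0 : 3 ^ g * p ^ e ≠ 0 := mul_ne_zero (by positivity) (pow_ne_zero _ hp.ne_zero)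
    rw [if_neg (by rw [mul_assoc]; exact not_isPMOne_three_pow_mul hg),
      primeFactors_mul_prime_pow h0 hq hf, primeFactors_mul_prime_pow (by positivity) hp he,
      primeFactors_prime_pow Nat.prime_three hg,
      Finset.sum_insert (by simp [hpq.symm]; omega), Finset.sum_pair (by omega), primeWeight_three,
      primeWeight_of_mod_eq_two hp9, primeWeight_of_mod_eq_two hq9]
    simp only [Finset.mem_insert, Finset.mem_singleton, forall_eq_or_imp, forall_eq,
      true_or, and_true]
    unfold IsPMOne
    omega
  all_goals
    have h0 : p ^ e * q ^ f ≠ 0 := mul_ne_zero (pow_ne_zero _ hp.ne_zero) (pow_ne_zero _ hq.ne_zero)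
    rw [if_pos (show IsPMOne _ from hd), primeFactors_mul_prime_pow h0 hr hg,
      primeFactors_mul_prime_pow (pow_ne_zero _ hp.ne_zero) hq hf, primeFactors_prime_pow hp he,
      Finset.sum_insert (by simp [hpr.symm, hqr.symm]), Finset.sum_pair hpq.symm,
      primeWeight_of_mod_eq_two (by omega), primeWeight_of_mod_eq_two (by omega),
      primeWeight_of_mod_eq_two (by omega)]
    simp only [Finset.mem_insert, Finset.mem_singleton, forall_eq_or_imp, forall_eq]
    unfold IsPMOne
    omega

end AmbiguousClasses

/-- **Main Theorem** (Theorem 1.1): for a cube-free integer `d > 1`, the `3`-group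
`C_{k,3}^{(σ)}` of ambiguous ideal classes of `k/k₀`, `k = ℚ(∛d, ζ₃)`, has rank `1`
if and only if `d` is of one of the nine listed forms. -/
theorem rank_ambiguousClassGroup_eq_one_iff
    (d : ℕ) (hd : 1 < d) (hdcf : IsCubeFree d)
    (σ : ↥(Kc d) ≃ₐ[ℚ] ↥(Kc d)) (hσfix : ∀ x : ↥(Kc d), x ∈ k0S d → σ x = x)
    (hσne : σ ≠ 1) :
    Group.rank ↥(ambiguousClassGroup d σ) = 1 ↔
      ((∃ p e₁ : ℕ, p.Prime ∧ p % 3 = 1 ∧ (e₁ = 1 ∨ e₁ = 2) ∧ d = p ^ e₁) ∨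
      (∃ p e e₁ : ℕ, p.Prime ∧ (p % 9 = 4 ∨ p % 9 = 7) ∧ (e = 1 ∨ e = 2) ∧ (e₁ = 1 ∨ e₁ = 2) ∧
        d = 3 ^ e * p ^ e₁) ∨
      (∃ p q e₁ f₁ : ℕ, p.Prime ∧ q.Prime ∧ (p % 9 = 4 ∨ p % 9 = 7) ∧
        (q % 9 = 2 ∨ q % 9 = 5) ∧ (e₁ = 1 ∨ e₁ = 2) ∧ (f₁ = 1 ∨ f₁ = 2) ∧
        d = p ^ e₁ * q ^ f₁ ∧ (d % 9 = 1 ∨ d % 9 = 8)) ∨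
      (∃ q e f₁ : ℕ, q.Prime ∧ q % 9 = 8 ∧ (e = 1 ∨ e = 2) ∧ (f₁ = 1 ∨ f₁ = 2) ∧
        d = 3 ^ e * q ^ f₁) ∨
      (∃ q₁ q₂ f₁ f₂ : ℕ, q₁.Prime ∧ q₂.Prime ∧ q₁ ≠ q₂ ∧ q₁ % 9 = 8 ∧ q₂ % 9 = 8 ∧
        (f₁ = 1 ∨ f₁ = 2) ∧ (f₂ = 1 ∨ f₂ = 2) ∧ d = q₁ ^ f₁ * q₂ ^ f₂) ∨
      (∃ q₁ q₂ f₁ f₂ : ℕ, q₁.Prime ∧ q₂.Prime ∧ q₁ ≠ q₂ ∧ q₁ % 3 = 2 ∧ q₂ % 3 = 2 ∧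
        (q₁ % 9 ≠ 8 ∨ q₂ % 9 ≠ 8) ∧ (f₁ = 1 ∨ f₁ = 2) ∧ (f₂ = 1 ∨ f₂ = 2) ∧
        d = q₁ ^ f₁ * q₂ ^ f₂ ∧ ¬(d % 9 = 1 ∨ d % 9 = 8)) ∨
      (∃ q₁ q₂ e f₁ f₂ : ℕ, q₁.Prime ∧ q₂.Prime ∧ q₁ ≠ q₂ ∧ q₁ % 3 = 2 ∧ q₂ % 3 = 2 ∧
        (q₁ % 9 ≠ 8 ∨ q₂ % 9 ≠ 8) ∧ (e = 1 ∨ e = 2) ∧ (f₁ = 1 ∨ f₁ = 2) ∧ (f₂ = 1 ∨ f₂ = 2) ∧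
        d = 3 ^ e * q₁ ^ f₁ * q₂ ^ f₂) ∨
      (∃ q₁ q₂ q₃ f₁ f₂ f₃ : ℕ, q₁.Prime ∧ q₂.Prime ∧ q₃.Prime ∧
        q₁ ≠ q₂ ∧ q₁ ≠ q₃ ∧ q₂ ≠ q₃ ∧
        (q₁ % 9 = 2 ∨ q₁ % 9 = 5) ∧ (q₂ % 9 = 2 ∨ q₂ % 9 = 5) ∧ q₃ % 9 = 8 ∧
        (f₁ = 1 ∨ f₁ = 2) ∧ (f₂ = 1 ∨ f₂ = 2) ∧ (f₃ = 1 ∨ f₃ = 2) ∧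
        d = q₁ ^ f₁ * q₂ ^ f₂ * q₃ ^ f₃ ∧ (d % 9 = 1 ∨ d % 9 = 8)) ∨
      (∃ q₁ q₂ q₃ f₁ f₂ f₃ : ℕ, q₁.Prime ∧ q₂.Prime ∧ q₃.Prime ∧
        q₁ ≠ q₂ ∧ q₁ ≠ q₃ ∧ q₂ ≠ q₃ ∧
        (q₁ % 9 = 2 ∨ q₁ % 9 = 5) ∧ (q₂ % 9 = 2 ∨ q₂ % 9 = 5) ∧ (q₃ % 9 = 2 ∨ q₃ % 9 = 5) ∧
        (f₁ = 1 ∨ f₁ = 2) ∧ (f₂ = 1 ∨ f₂ = 2) ∧ (f₃ = 1 ∨ f₃ = 2) ∧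
        d = q₁ ^ f₁ * q₂ ^ f₂ * q₃ ^ f₃ ∧ (d % 9 = 1 ∨ d % 9 = 8))) := by
  have hd0 : d ≠ 0 := by omega
  have hcyc := isCyclotomicExtension_k0S d
  have hgal := isGalois_k0S hσfix hd0 hσne
  rw [rank_ambiguousClassGroup_eq_one_iff_card hσfix hd0 hσne,
    card_fixedClass_kummer_eq_three_iff (finrank_k0S hσfix hd0 hσne) hd0 hdcf (cbrtK_pow_three d)
      (apply_cbrtK_ne hσfix hσne), sum_primesBelow, forall_prime_dvd_iff hd0]
  exact ⟨exists_form_of_ramificationCriterion hd hdcf, ramificationCriterion_of_exists_form⟩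

end
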